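/- arXiv:1502.06513 — 7 statements merged into one kernel-verified Lean document; each statement's English description precedes it below -/
import Mathlib

section
/- Let A, B ⊆ ℝ be measurable sets with 0 < |A|, |B| < ∞. If |A + B| < |A| + |B| + δ for some δ with 0 ≤ δ ≤ min{|A|, |B|}, then there exist two intervals I, J ⊆ ℝ such that A ⊆ I, B ⊆ J, |I \ A| ≤ δ, and |J \ B| ≤ δ. -/
open MeasureTheory Set Pointwise

theorem inter_cont {T : ℝ} [hT : Fact (0 < T)] (A B : Set (AddCircle T)) (hA : MeasurableSet A)
    (hB : MeasurableSet B) :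
    Continuous (fun t : AddCircle T => volume.real (B ∩ (fun z => z + t) ⁻¹' A)) := by
  rw [continuous_iff_continuousAt]
  intro t
  have key : Filter.Tendsto (fun s : AddCircle T => volume.real
      (symmDiff ((fun z => z + s) ⁻¹' A) ((fun z => z + t) ⁻¹' A))) (nhds t) (nhds 0) := by
    have h := tendsto_measure_symmDiff_preimage_nhds_zero (μ := (volume : Measure (AddCircle T)))
      (ν := (volume : Measure (AddCircle T))) (l := nhds t)
      (f := fun s : AddCircle T => (⟨fun z => z + s, by fun_prop⟩ : C(AddCircle T, AddCircle T)))
      (g := (⟨fun z => z + t, by fun_prop⟩ : C(AddCircle T, AddCircle T)))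
      (s := A) ?_ ?_ ?_ hA.nullMeasurableSet (measure_ne_top _ _)
    · exact (ENNReal.tendsto_toReal ENNReal.zero_ne_top).comp h
    · apply Continuous.tendsto (f := fun s : AddCircle T =>
        (⟨fun z => z + s, by fun_prop⟩ : C(AddCircle T, AddCircle T)))
      exact ContinuousMap.continuous_of_continuous_uncurry _ (by
        simp only [Function.uncurry_def, ContinuousMap.coe_mk]; fun_prop)
    · exact Filter.Eventually.of_forall fun s => measurePreserving_add_right _ s
    · exact measurePreserving_add_right _ t
  rw [ContinuousAt, tendsto_iff_dist_tendsto_zero]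
  refine squeeze_zero (fun _ => dist_nonneg) (fun s => ?_) key
  have m : ∀ s, MeasurableSet ((fun z : AddCircle T => z + s) ⁻¹' A) :=
    fun s => (measurable_add_const s) hA
  rw [Real.dist_eq, abs_le]
  have h1 : ∀ s t : AddCircle T, volume.real (B ∩ (fun z => z + s) ⁻¹' A) ≤
    volume.real (B ∩ (fun z => z + t) ⁻¹' A) +
     volume.real (symmDiff ((fun z => z + s) ⁻¹' A) ((fun z => z + t) ⁻¹' A)) := by
    intro s t
    refine le_trans (measureReal_mono ?_ (measure_ne_top _ _)) (measureReal_union_le _ _)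
    intro x hx
    by_cases hx' : x ∈ (fun z => z + t) ⁻¹' A
    · exact Or.inl ⟨hx.1, hx'⟩
    · exact Or.inr (Or.inl ⟨hx.2, hx'⟩)
  have h2 := h1 t s
  rw [symmDiff_comm] at h2
  have h3 := h1 s t
  constructor <;> linarith

theorem inter_int {T : ℝ} [hT : Fact (0 < T)] (A B : Set (AddCircle T)) (hA : MeasurableSet A)
    (hB : MeasurableSet B) :
    ∫⁻ t : AddCircle T, volume (B ∩ (fun z => z + t) ⁻¹' A) = volume A * volume B := by
  have m : ∀ s, MeasurableSet ((fun z : AddCircle T => z + s) ⁻¹' A) :=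
    fun s => (measurable_add_const s) hA
  have h0 : Measurable (fun p : AddCircle T × AddCircle T =>
      B.indicator (1 : AddCircle T → ENNReal) p.2 * A.indicator (1 : AddCircle T → ENNReal) (p.2 + p.1)) := by
    exact ((measurable_one.indicator hB).comp measurable_snd).mul
      ((measurable_one.indicator hA).comp (measurable_snd.add measurable_fst))
  have h1 : ∀ t : AddCircle T, volume (B ∩ (fun z => z + t) ⁻¹' A) =
      ∫⁻ z : AddCircle T, B.indicator (1 : AddCircle T → ENNReal) z * A.indicator (1 : AddCircle T → ENNReal) (z + t) := by
    intro t
    rw [← lintegral_indicator_one (hB.inter (m t))]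
    congr 1; ext z
    by_cases h : z ∈ B <;> by_cases h' : z + t ∈ A <;> simp [h, h']
  simp_rw [h1]
  rw [lintegral_lintegral_swap h0.aemeasurable]
  have h2 : ∀ z : AddCircle T, ∫⁻ t : AddCircle T, B.indicator (1 : AddCircle T → ENNReal) z * A.indicator (1 : AddCircle T → ENNReal) (z + t)
     = B.indicator (1 : AddCircle T → ENNReal) z * volume A := by
    intro z
    rw [lintegral_const_mul _ (show Measurable fun t => A.indicator (1 : AddCircle T → ENNReal) (z + t) from
        (measurable_one.indicator hA).comp (measurable_const_add z)),
      lintegral_add_left_eq_self (μ := (volume : Measure (AddCircle T))) (A.indicator 1) z, lintegral_indicator_one hA]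
  simp_rw [h2]
  rw [lintegral_mul_const _ (measurable_one.indicator hB), lintegral_indicator_one hB, mul_comm]

theorem exists_shift {T : ℝ} [hT : Fact (0 < T)] (A B : Set (AddCircle T)) (hA : MeasurableSet A)
    (hB : MeasurableSet B) :
    ∃ t : AddCircle T, volume.real (B ∩ (fun z => z + t) ⁻¹' A) = volume.real A * volume.real B / T := by
  have hT0 : 0 < T := hT.out
  have hc := inter_cont A B hA hB
  have hi : ∫ t : AddCircle T, volume.real (B ∩ (fun z => z + t) ⁻¹' A) = volume.real A * volume.real B := by
    simp_rw [measureReal_def]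
    rw [integral_toReal, inter_int A B hA hB, ENNReal.toReal_mul]
    · have := (hc.measurable).ennreal_ofReal
      simpa [measureReal_def] using this.aemeasurable
    · exact Filter.Eventually.of_forall fun _ => measure_lt_top _ _
  have hint : Integrable (fun t : AddCircle T => volume.real (B ∩ (fun z => z + t) ⁻¹' A)) :=
    hc.integrable_of_hasCompactSupport (HasCompactSupport.of_compactSpace _)
  have hne : (volume : Measure (AddCircle T)) ≠ 0 := by
    intro h
    have := AddCircle.measure_univ T
    rw [h] at this
    simp at this
    linarith
  have hav : ⨍ t : AddCircle T, volume.real (B ∩ (fun z => z + t) ⁻¹' A) = volume.real A * volume.real B / T := by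
    rw [average_eq, hi, measureReal_def, AddCircle.measure_univ, ENNReal.toReal_ofReal hT0.le, smul_eq_mul]
    ring
  obtain ⟨x, hx⟩ := exists_le_average hne hint
  obtain ⟨y, hy⟩ := exists_average_le hne hint
  rw [hav] at hx hy
  have : PreconnectedSpace (AddCircle T) := inferInstance
  obtain ⟨t, ht⟩ := mem_range_of_exists_le_of_exists_ge hc ⟨x, hx⟩ ⟨y, hy⟩
  exact ⟨t, ht⟩

theorem raikov_step {T : ℝ} [hT : Fact (0 < T)] (A B : Set (AddCircle T)) (hA : MeasurableSet A)
    (hB : MeasurableSet B) (hA0 : 0 < volume.real A) (hB0 : 0 < volume.real B) 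
    (hAB : volume.real A + volume.real B ≤ T) (n : ℕ) :
    ∃ A' B' : Set (AddCircle T), MeasurableSet A' ∧ MeasurableSet B' ∧ 0 < volume.real A' ∧
      0 < volume.real B' ∧ volume.real A' + volume.real B' = volume.real A + volume.real B ∧
      volume.real B' ≤ T / (n + 1) ∧ volume.real (A' + B') ≤ volume.real (A + B) := by
  have hT0 : 0 < T := hT.out
  induction n with
  | zero => exact ⟨A, B, hA, hB, hA0, hB0, rfl, by simp; linarith, le_rfl⟩
  | succ n ih =>
    obtain ⟨A', B', hA', hB', hA0', hB0', hs, hn, hle⟩ := ih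
    obtain ⟨t, ht⟩ := exists_shift A' B' hA' hB'
    have m : MeasurableSet ((fun z : AddCircle T => z + t) ⁻¹' A') := (measurable_add_const t) hA'
    have hm : volume.real ((fun z : AddCircle T => z + t) ⁻¹' A') = volume.real A' := by
      rw [measureReal_def, measure_preimage_add_right, measureReal_def]
    have hu := measureReal_union_add_inter (μ := volume) (s := B') (t := (fun z : AddCircle T => z + t) ⁻¹' A') m
    have hpos : 0 < volume.real (B' ∩ (fun z : AddCircle T => z + t) ⁻¹' A') := by
      rw [ht]; positivity
    refine ⟨B' ∪ (fun z : AddCircle T => z + t) ⁻¹' A', B' ∩ (fun z : AddCircle T => z + t) ⁻¹' A',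
      hB'.union m, hB'.inter m, ?_, hpos, ?_, ?_, ?_⟩
    · have := measureReal_mono (μ := volume) (s₁ := (fun z : AddCircle T => z + t) ⁻¹' A')
        (subset_union_right (s := B')) (measure_ne_top _ _)
      linarith
    · linarith
    · rw [ht, div_le_div_iff₀ hT0 (by positivity)]
      rw [le_div_iff₀ (by positivity)] at hn
      push_cast
      have hn0 : (0:ℝ) ≤ n := n.cast_nonneg
      have h1 : volume.real A' ≤ T - volume.real B' := by linarith
      set x := volume.real B'
      have h2 : volume.real A' * x ≤ (T - x) * x := by gcongr
      have h3 : (T - x) * x * (n + 1 + 1) ≤ T * T := by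
        by_cases h : x * (n + 1 + 1) ≤ T
        · nlinarith
        · push Not at h
          nlinarith
      nlinarith
    · refine le_trans ?_ hle
      have hsub : (B' ∪ (fun z : AddCircle T => z + t) ⁻¹' A') + (B' ∩ (fun z : AddCircle T => z + t) ⁻¹' A')
         ⊆ (fun z : AddCircle T => z + t) ⁻¹' (A' + B') := by
        rintro _ ⟨x, hx, y, hy, rfl⟩
        rcases hx with hx | hx
        · exact ⟨y + t, hy.2, x, hx, by simp only; abel⟩
        · exact ⟨x + t, hx, y, hy.1, by simp only; abel⟩
      refine (measureReal_mono hsub (measure_ne_top _ _)).trans (le_of_eq ?_)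
      rw [measureReal_def, measure_preimage_add_right, measureReal_def]

theorem raikov {T : ℝ} [hT : Fact (0 < T)] (A B : Set (AddCircle T)) (hA : MeasurableSet A)
    (hB : MeasurableSet B) (hA0 : 0 < volume.real A) (hB0 : 0 < volume.real B) 
    (hAB : volume.real A + volume.real B ≤ T) :
    volume.real A + volume.real B ≤ volume.real (A + B) := by
  have hT0 : 0 < T := hT.out
  have key : ∀ n : ℕ, volume.real A + volume.real B - volume.real (A + B) ≤ T * (1 / ((n:ℝ) + 1)) := by
    intro n
    obtain ⟨A', B', hA', hB', hA0', hB0', hs, hn, hle⟩ := raikov_step A B hA hB hA0 hB0 hAB n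
    have hne : B'.Nonempty := by
      rw [nonempty_iff_ne_empty]; rintro rfl; simp at hB0'
    obtain ⟨b, hb⟩ := hne
    have : volume.real A' ≤ volume.real (A' + B') := by
      have hsub : A' ⊆ (fun z : AddCircle T => z + b) ⁻¹' (A' + B') :=
        fun x hx => ⟨x, hx, b, hb, rfl⟩
      refine (measureReal_mono hsub (measure_ne_top _ _)).trans (le_of_eq ?_)
      rw [measureReal_def, measure_preimage_add_right, measureReal_def]
    rw [mul_one_div]
    linarith
  have := ge_of_tendsto' ((tendsto_one_div_add_atTop_nhds_zero_nat (𝕜 := ℝ)).const_mul T) key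
  linarith

theorem pigeon {T : ℝ} [hT : Fact (0 < T)] (A B : Set (AddCircle T)) (hA : MeasurableSet A)
    (hB : MeasurableSet B) (hAB : T < volume.real A + volume.real B) : A + B = univ := by
  rw [eq_univ_iff_forall]
  intro t
  have m : MeasurableSet ((fun z : AddCircle T => t - z) ⁻¹' A) := (measurable_const_sub t) hA
  have hm : volume.real ((fun z : AddCircle T => t - z) ⁻¹' A) = volume.real A :=
    (Measure.measurePreserving_sub_left volume t).measureReal_preimage hA.nullMeasurableSet
  have hu := measureReal_union_add_inter (μ := volume) (s := B) (t := (fun z : AddCircle T => t - z) ⁻¹' A) m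
  have h1 : volume.real (B ∪ (fun z : AddCircle T => t - z) ⁻¹' A) ≤ T := by
    refine (measureReal_mono (subset_univ _) (measure_ne_top _ _)).trans ?_
    rw [measureReal_def, AddCircle.measure_univ, ENNReal.toReal_ofReal hT.out.le]
  have hne : (B ∩ (fun z : AddCircle T => t - z) ⁻¹' A).Nonempty := by
    rw [nonempty_iff_ne_empty]; intro h; rw [h] at hu; simp at hu; linarith
  obtain ⟨z, hz, hz'⟩ := hne
  exact ⟨t - z, hz', z, hz, by simp⟩

theorem proj_eq {T : ℝ} [hT : Fact (0 < T)] (E : Set ℝ) (hE : MeasurableSet E) (t : ℝ)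
    (hsub : E ⊆ Ioc t (t + T)) :
    volume ((fun x : ℝ => (x : AddCircle T)) '' E) = volume E := by
  have hinj : InjOn (fun x : ℝ => (x : AddCircle T)) (Ioc t (t + T)) := by
    intro x hx y hy hxy
    have := (AddCircle.equivIoc T t).symm.injective (a₁ := ⟨x, hx⟩) (a₂ := ⟨y, hy⟩) hxy
    exact congrArg Subtype.val this
  have hm : MeasurableSet ((fun x : ℝ => (x : AddCircle T)) '' E) := by
    apply hE.image_of_measurable_injOn AddCircle.measurable_mk' (hinj.mono hsub)
  rw [AddCircle.add_projection_respects_measure T t hm]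
  congr 1
  ext x
  constructor
  · rintro ⟨⟨y, hy, hxy⟩, hx⟩
    rw [← hinj (hsub hy) hx hxy]; exact hy
  · intro hx
    exact ⟨⟨x, hx, rfl⟩, hsub hx⟩

theorem proj_le {T : ℝ} [hT : Fact (0 < T)] (E : Set ℝ) (hE : MeasurableSet E) :
    volume ((fun x : ℝ => (x : AddCircle T)) '' E) ≤ volume E := by
  have hU : E = ⋃ n : ℤ, E ∩ Ioc (n • T) (n • T + T) := by
    rw [← inter_iUnion]
    have := iUnion_Ioc_zsmul hT.out
    simp only [add_zsmul, one_zsmul] at this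
    rw [this, inter_univ]
  have hd : Pairwise (Function.onFun Disjoint fun n : ℤ => E ∩ Ioc (n • T) (n • T + T)) := by
    intro i j hij
    have := pairwise_disjoint_Ioc_zsmul T hij
    simp only [Function.onFun, add_zsmul, one_zsmul] at this
    exact this.mono inter_subset_right inter_subset_right
  have hm := measure_iUnion (μ := volume) hd (fun n => hE.inter measurableSet_Ioc)
  rw [← hU] at hm
  rw [hm]
  conv_lhs => rw [hU, image_iUnion]
  refine (measure_iUnion_le _).trans ?_
  gcongr with n
  rw [proj_eq _ (hE.inter measurableSet_Ioc) (n • T) inter_subset_right]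

theorem proj_ge {T : ℝ} [hT : Fact (0 < T)] (E : Set ℝ) (hE : MeasurableSet E) (t : ℝ) :
    volume.real (E ∩ Icc t (t + T)) ≤ volume.real ((fun x : ℝ => (x : AddCircle T)) '' E) := by
  have h1 := proj_eq (T := T) (E ∩ Ioc t (t + T)) (hE.inter measurableSet_Ioc) t inter_subset_right
  have h2 : volume (E ∩ Icc t (t + T)) = volume (E ∩ Ioc t (t + T)) :=
    measure_congr (Filter.EventuallyEq.rfl.inter Ioc_ae_eq_Icc.symm)
  rw [measureReal_def, measureReal_def, h2, ← h1]
  exact ENNReal.toReal_mono (measure_ne_top _ _) (measure_mono (image_mono inter_subset_left))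

theorem fibre {T : ℝ} [hT : Fact (0 < T)] (K L : Set ℝ) (hK : IsCompact K) (hL : IsCompact L)
    (x : ℝ) (hx : x ∈ L) (hxT : x + T ∈ L) :
    volume.real K + volume.real ((fun x : ℝ => (x : AddCircle T)) '' K +
      (fun x : ℝ => (x : AddCircle T)) '' L) ≤ volume.real (K + L) := by
  have hT0 : 0 < T := hT.out
  set π : ℝ → AddCircle T := fun x : ℝ => (x : AddCircle T) with hπ
  have hS : IsCompact (K + L) := hK.add hL
  have hP : π '' K + π '' L ⊆ π '' ((K + L) \ ((fun z => z + x) '' K)) := by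
    rintro _ ⟨_, ⟨k, hk, rfl⟩, _, ⟨l, hl, rfl⟩, rfl⟩
    by_contra hcon
    have hf : ∀ s ∈ K + L, π s = π (k + l) → s - x ∈ K := by
      intro s hs hp
      by_contra hsx
      refine hcon ⟨s, ⟨hs, ?_⟩, by rw [hp]; simp [hπ]⟩
      rintro ⟨z, hz, rfl⟩
      simp at hsx; exact hsx hz
    have hn : ∀ n : ℕ, (k + l - x) + n * T ∈ K := by
      intro n
      induction n with
      | zero => simpa using hf (k + l) ⟨k, hk, l, hl, rfl⟩ rfl
      | succ n ih =>
        have := hf (((k + l - x) + n * T) + (x + T)) ⟨_, ih, _, hxT, rfl⟩ ?_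
        · convert this using 1; push_cast; ring
        · have e : ((k + l - x) + n * T) + (x + T) = (k + l) + ((n + 1 : ℕ) : ℤ) • T := by
            simp; ring
          rw [e]
          simp only [hπ]
          rw [AddCircle.coe_add _ (k + l)]
          rw [AddCircle.coe_zsmul, AddCircle.coe_period, smul_zero, add_zero]
    obtain ⟨M, hM⟩ := hK.bddAbove
    obtain ⟨n, hn'⟩ := exists_nat_gt ((M - (k + l - x)) / T)
    rw [div_lt_iff₀ hT0] at hn'
    have := hM (hn n)
    linarith
  have hKx : MeasurableSet ((fun z => z + x) '' K) :=
    (hK.image (by fun_prop)).measurableSet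
  have hsub : (fun z => z + x) '' K ⊆ K + L := by
    rintro _ ⟨z, hz, rfl⟩; exact ⟨z, hz, x, hx, rfl⟩
  have h1 : volume.real ((fun z => z + x) '' K) = volume.real K := by
    simp [measureReal_def]
  have h2 := measureReal_sdiff_add_inter (μ := volume) (s := K + L) hKx hS.measure_ne_top
  rw [inter_eq_self_of_subset_right hsub, h1] at h2
  have h3 : volume.real (π '' K + π '' L) ≤ volume.real ((K + L) \ ((fun z => z + x) '' K)) := by
    refine ENNReal.toReal_mono ?_ ?_
    · exact ((measure_mono sdiff_subset).trans_lt hS.measure_lt_top).ne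
    · exact (measure_mono hP).trans (proj_le _ (hS.measurableSet.diff hKx))
  linarith

theorem compact_case (K L : Set ℝ) (hK : IsCompact K) (hL : IsCompact L)
    (hK0 : 0 < volume.real K) (hL0 : 0 < volume.real L) (k l a b : ℝ) (hk : k ∈ K) (hka : k + a ∈ K)
    (hKs : K ⊆ Icc k (k + a)) (hl : l ∈ L) (hlb : l + b ∈ L)
    (hLs : L ⊆ Icc l (l + b)) (hab : a ≤ b)
    (h : volume.real (K + L) < volume.real K + volume.real L + min (volume.real K) (volume.real L)) :
    volume.real K + b ≤ volume.real (K + L) ∧ volume.real L + a ≤ volume.real (K + L) := by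
  have ha : 0 < a := by
    by_contra hc
    have h1 : volume.real K ≤ volume.real (Icc k (k + a)) := measureReal_mono hKs (by simp)
    rw [Real.volume_real_Icc, max_eq_right (by linarith)] at h1
    linarith
  have hb : 0 < b := by linarith
  have hLb : volume.real L ≤ b := by
    have h1 : volume.real L ≤ volume.real (Icc l (l + b)) := measureReal_mono hLs (by simp)
    rw [Real.volume_real_Icc, max_eq_left (by linarith)] at h1
    linarith
  have mp : ∀ (T : ℝ) (E : Set ℝ), IsCompact E →
      MeasurableSet ((fun x : ℝ => (x : AddCircle T)) '' E) := by
    intro T E hE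
    exact (hE.image (AddCircle.continuous_mk' T)).measurableSet
  have hu : ∀ (T : ℝ) [hT : Fact (0 < T)], volume.real (univ : Set (AddCircle T)) = T := by
    intro T hT
    rw [measureReal_def, AddCircle.measure_univ, ENNReal.toReal_ofReal hT.out.le]
  have hf : b < volume.real K + volume.real L := by
    by_contra hc
    push Not at hc
    have : Fact (0 < b) := ⟨hb⟩
    have h1 := fibre (T := b) K L hK hL l hl hlb
    have h2 := proj_ge (T := b) K hK.measurableSet k
    have h3 := proj_ge (T := b) L hL.measurableSet l
    rw [inter_eq_self_of_subset_left (hKs.trans (Icc_subset_Icc_right (by linarith)))] at h2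
    rw [inter_eq_self_of_subset_left hLs] at h3
    have h4 := proj_le (T := b) K hK.measurableSet
    have h5 := proj_le (T := b) L hL.measurableSet
    have h4 := ENNReal.toReal_mono hK.measure_ne_top h4
    have h5 := ENNReal.toReal_mono hL.measure_ne_top h5
    rw [← measureReal_def, ← measureReal_def] at h4 h5
    have h6 := raikov _ _ (mp b K hK) (mp b L hL) (by linarith) (by linarith) (by linarith)
    have := min_le_left (volume.real K) (volume.real L)
    linarith
  constructor
  · have : Fact (0 < b) := ⟨hb⟩
    have h1 := fibre (T := b) K L hK hL l hl hlb
    have h2 := proj_ge (T := b) K hK.measurableSet k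
    have h3 := proj_ge (T := b) L hL.measurableSet l
    rw [inter_eq_self_of_subset_left (hKs.trans (Icc_subset_Icc_right (by linarith)))] at h2
    rw [inter_eq_self_of_subset_left hLs] at h3
    rw [pigeon _ _ (mp b K hK) (mp b L hL) (by linarith), hu b] at h1
    exact h1
  · have : Fact (0 < a) := ⟨ha⟩
    have h1 := fibre (T := a) L K hL hK k hk hka
    have h2 := proj_ge (T := a) K hK.measurableSet k
    have h3 := proj_ge (T := a) L hL.measurableSet l
    rw [inter_eq_self_of_subset_left hKs] at h2
    have h4 : volume.real L ≤ volume.real (L ∩ Icc l (l + a)) + (b - a) := by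
      have h5 : L ⊆ (L ∩ Icc l (l + a)) ∪ Icc (l + a) (l + b) := by
        intro x hx
        by_cases hxa : x ≤ l + a
        · exact Or.inl ⟨hx, (hLs hx).1, hxa⟩
        · exact Or.inr ⟨by linarith, (hLs hx).2⟩
      have h6 := (measureReal_mono (μ := volume) h5 
        (((hL.inter isCompact_Icc).union isCompact_Icc).measure_ne_top)).trans (measureReal_union_le _ _)
      rw [Real.volume_real_Icc (a := l + a), max_eq_left (by linarith)] at h6
      linarith
    rw [pigeon _ _ (mp a L hL) (mp a K hK) (by linarith), hu a, add_comm L K] at h1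
    exact h1

/-- Any compact set is approximated so that it has given points as extremal points. -/
theorem approx (A : Set ℝ) (hA : MeasurableSet A) (hA0 : 0 < volume A) (hAfin : volume A < ⊤)
    (ε : ℝ) (hε : 0 < ε) (p q : ℝ) (hp : p ∈ A) (hq : q ∈ A) :
    ∃ K ⊆ A, IsCompact K ∧ p ∈ K ∧ q ∈ K ∧ volume.real A - ε < volume.real K := by
  have h : volume A - ENNReal.ofReal ε < volume A :=
    ENNReal.sub_lt_self hAfin.ne hA0.ne' (by simpa using hε)
  obtain ⟨K, hKA, hK, hlt⟩ := hA.exists_lt_isCompact h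
  refine ⟨K ∪ {p, q}, union_subset hKA (by rintro x (rfl | rfl) <;> assumption),
    hK.union (by simp), by simp, by simp, ?_⟩
  have h1 : volume.real K ≤ volume.real (K ∪ {p, q}) :=
    measureReal_mono subset_union_left (hK.union (by simp)).measure_ne_top
  refine lt_of_lt_of_le ?_ h1
  have h2 : volume A < volume K + ENNReal.ofReal ε :=
    ENNReal.lt_add_of_sub_lt_right (Or.inl hAfin.ne) hlt
  have hKf : volume K ≠ ⊤ := hK.measure_ne_top
  have h3 := (ENNReal.toReal_lt_toReal hAfin.ne (by finiteness)).2 h2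
  rw [ENNReal.toReal_add hKf (by simp), ENNReal.toReal_ofReal hε.le] at h3
  simp only [measureReal_def]
  linarith

theorem compact_sym (K L : Set ℝ) (hK : IsCompact K) (hL : IsCompact L)
    (hK0 : 0 < volume.real K) (hL0 : 0 < volume.real L)
    (h : volume.real (K + L) < volume.real K + volume.real L + min (volume.real K) (volume.real L)) :
    (∀ x ∈ L, ∀ y ∈ L, volume.real K + (y - x) ≤ volume.real (K + L)) ∧
    (∀ x ∈ K, ∀ y ∈ K, volume.real L + (y - x) ≤ volume.real (K + L)) := by
  have ne : ∀ E : Set ℝ, 0 < volume.real E → E.Nonempty := by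
    intro E hE
    rw [nonempty_iff_ne_empty]; rintro rfl; simp at hE
  have hk := hK.sInf_mem (ne K hK0)
  have hk' := hK.sSup_mem (ne K hK0)
  have hl := hL.sInf_mem (ne L hL0)
  have hl' := hL.sSup_mem (ne L hL0)
  have hKs : K ⊆ Icc (sInf K) (sSup K) := fun x hx =>
    ⟨csInf_le hK.bddBelow hx, le_csSup hK.bddAbove hx⟩
  have hLs : L ⊆ Icc (sInf L) (sSup L) := fun x hx =>
    ⟨csInf_le hL.bddBelow hx, le_csSup hL.bddAbove hx⟩
  have main : volume.real K + (sSup L - sInf L) ≤ volume.real (K + L) ∧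
      volume.real L + (sSup K - sInf K) ≤ volume.real (K + L) := by
    rcases le_total (sSup K - sInf K) (sSup L - sInf L) with hab | hab
    · exact compact_case K L hK hL hK0 hL0 (sInf K) (sInf L) _ _ hk (by simpa using hk')
        (by simpa using hKs) hl (by simpa using hl') (by simpa using hLs) hab h
    · have := compact_case L K hL hK hL0 hK0 (sInf L) (sInf K) _ _ hl (by simpa using hl')
        (by simpa using hLs) hk (by simpa using hk') (by simpa using hKs) hab
        (by rw [add_comm L K, min_comm]; linarith)
      rw [add_comm L K] at this
      exact this.symm
  constructor
  · intro x hx y hy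
    linarith [(hLs hx).1, (hLs hy).2]
  · intro x hx y hy
    linarith [(hKs hx).1, (hKs hy).2]

theorem hull (A : Set ℝ) (hA : MeasurableSet A) (hA0 : 0 < volume A) (hAfin : volume A < ⊤)
    (δ : ℝ) (hδ : 0 ≤ δ) (h : ∀ x ∈ A, ∀ y ∈ A, y - x ≤ volume.real A + δ) :
    ∃ I : Set ℝ, I.OrdConnected ∧ A ⊆ I ∧ volume (I \ A) ≤ ENNReal.ofReal δ := by
  have hne : A.Nonempty := by
    rw [nonempty_iff_ne_empty]; rintro rfl; simp at hA0
  obtain ⟨z, hz⟩ := hne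
  have hbb : BddBelow A := ⟨z - (volume.real A + δ), fun x hx => by linarith [h x hx z hz]⟩
  have hba : BddAbove A := ⟨z + (volume.real A + δ), fun x hx => by linarith [h z hz x hx]⟩
  have hs : A ⊆ Icc (sInf A) (sSup A) := fun x hx => ⟨csInf_le hbb hx, le_csSup hba hx⟩
  refine ⟨Icc (sInf A) (sSup A), ordConnected_Icc, hs, ?_⟩
  have hd : sSup A - sInf A ≤ volume.real A + δ := by
    have h1 : sSup A ≤ volume.real A + δ + sInf A := by
      apply csSup_le ⟨z, hz⟩
      intro y hy
      have : y - (volume.real A + δ) ≤ sInf A := by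
        apply le_csInf ⟨z, hz⟩
        intro x hx
        linarith [h x hx y hy]
      linarith
    linarith
  rw [measure_sdiff hs hA.nullMeasurableSet hAfin.ne, Real.volume_Icc, tsub_le_iff_left]
  refine (ENNReal.ofReal_le_ofReal hd).trans ?_
  rw [ENNReal.ofReal_add measureReal_nonneg hδ, ofReal_measureReal hAfin.ne]

theorem statement0 (A B : Set ℝ) (hA : MeasurableSet A) (hB : MeasurableSet B)
    (hA0 : 0 < volume A) (hAfin : volume A < ⊤)
    (hB0 : 0 < volume B) (hBfin : volume B < ⊤)
    (δ : ℝ) (hδ0 : 0 ≤ δ)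
    (hδmin : ENNReal.ofReal δ ≤ min (volume A) (volume B))
    (hsum : volume (A + B) < volume A + volume B + ENNReal.ofReal δ) :
    ∃ I J : Set ℝ, I.OrdConnected ∧ J.OrdConnected ∧ A ⊆ I ∧ B ⊆ J ∧
      volume (I \ A) ≤ ENNReal.ofReal δ ∧ volume (J \ B) ≤ ENNReal.ofReal δ := by
  have hfin : volume (A + B) ≠ ⊤ := hsum.ne_top
  have hA0' : 0 < volume.real A := ENNReal.toReal_pos hA0.ne' hAfin.ne
  have hB0' : 0 < volume.real B := ENNReal.toReal_pos hB0.ne' hBfin.ne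
  have hs : volume.real (A + B) < volume.real A + volume.real B + δ := by
    have := (ENNReal.toReal_lt_toReal hfin (by finiteness)).2 hsum
    rwa [ENNReal.toReal_add (by finiteness) (by simp), ENNReal.toReal_add hAfin.ne hBfin.ne,
      ENNReal.toReal_ofReal hδ0] at this
  have hdA : δ ≤ volume.real A :=
    (ENNReal.ofReal_le_iff_le_toReal hAfin.ne).1 (hδmin.trans (min_le_left _ _))
  have hdB : δ ≤ volume.real B :=
    (ENNReal.ofReal_le_iff_le_toReal hBfin.ne).1 (hδmin.trans (min_le_right _ _))
  have main : ∀ p ∈ A, ∀ q ∈ A, ∀ r ∈ B, ∀ s ∈ B, 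
      q - p ≤ volume.real A + δ ∧ s - r ≤ volume.real B + δ := by
    intro p hp q hq r hr s hs'
    obtain ⟨ε, hε, h1, h2, h3⟩ : ∃ ε : ℝ, 0 < ε ∧
        3 * ε < volume.real A + volume.real B + δ - volume.real (A + B) ∧
        ε < volume.real A ∧ ε < volume.real B := by
      have h1 : 0 < min ((volume.real A + volume.real B + δ - volume.real (A + B)) / 3)
        (min (volume.real A) (volume.real B)) := by
        refine lt_min (by linarith) (lt_min hA0' hB0')
      obtain ⟨ε, h, h'⟩ := exists_between h1
      simp only [lt_min_iff] at h'
      exact ⟨ε, h, by linarith, h'.2.1, h'.2.2⟩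
    obtain ⟨K, hKA, hK, hpK, hqK, hKε⟩ := approx A hA hA0 hAfin ε hε p q hp hq
    obtain ⟨L, hLB, hL, hrL, hsL, hLε⟩ := approx B hB hB0 hBfin ε hε r s hr hs'
    have hle : volume.real (K + L) ≤ volume.real (A + B) :=
      measureReal_mono (add_subset_add hKA hLB) hfin
    have hmin : δ - ε < min (volume.real K) (volume.real L) :=
      lt_min (by linarith) (by linarith)
    obtain ⟨c1, c2⟩ := compact_sym K L hK hL (by linarith) (by linarith) (by linarith)
    have c1 := c1 r hrL s hsL
    have c2 := c2 p hpK q hqK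
    constructor <;> linarith
  have neA : A.Nonempty := by
    rw [nonempty_iff_ne_empty]; rintro rfl; simp at hA0
  have neB : B.Nonempty := by
    rw [nonempty_iff_ne_empty]; rintro rfl; simp at hB0
  obtain ⟨a, ha⟩ := neA
  obtain ⟨b, hb⟩ := neB
  obtain ⟨I, hI, hAI, hI'⟩ := hull A hA hA0 hAfin δ hδ0
    (fun x hx y hy => (main x hx y hy b hb b hb).1)
  obtain ⟨J, hJ, hBJ, hJ'⟩ := hull B hB hB0 hBfin δ hδ0
    (fun x hx y hy => (main a ha a ha x hx y hy).2)
  exact ⟨I, J, hI, hJ, hAI, hBJ, hI', hJ'⟩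
end

section
/- Let n ≥ 2, let A, B ⊆ ℝⁿ be compact sets, and let t ∈ (0, 1). Then |A| = |A^∗| = |A^⋆| = |A^♮|, and moreover |tA^∗ + (1 − t)B^∗| ≤ |tA + (1 − t)B|, |tA^⋆ + (1 − t)B^⋆| ≤ |tA + (1 − t)B|, and |tA^♮ + (1 − t)B^♮| ≤ |tA + (1 − t)B|. -/
open MeasureTheory Set Pointwise
open scoped ENNReal

/-- Vertical slice `E(s) = {y : (y, s) ∈ E}` of a set `E ⊆ ℝ^{k} × ℝ`. -/
def vslice {k : ℕ} (E : Set (EuclideanSpace ℝ (Fin k) × ℝ)) (s : ℝ) :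
    Set (EuclideanSpace ℝ (Fin k)) := {y | (y, s) ∈ E}

/-- Fiber `E_y = {s : (y, s) ∈ E}` of a set `E ⊆ ℝ^{k} × ℝ`. -/
def hfiber {k : ℕ} (E : Set (EuclideanSpace ℝ (Fin k) × ℝ))
    (y : EuclideanSpace ℝ (Fin k)) : Set ℝ := {s | (y, s) ∈ E}

/-- Radius of the closed Euclidean ball in `ℝ^k` whose volume is `v`. -/
noncomputable def diskRadius (k : ℕ) (v : ℝ≥0∞) : ℝ :=
  ((v / volume (Metric.closedBall (0 : EuclideanSpace ℝ (Fin k)) 1)).toReal) ^ ((1 : ℝ) / k)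

/-- Schwarz symmetrization `E^∗`: each horizontal slice of positive measure is replaced by
the closed disk centered at the origin with the same measure; slices of measure zero are
replaced by the empty set. -/
noncomputable def schwarzSymm {k : ℕ} (E : Set (EuclideanSpace ℝ (Fin k) × ℝ)) :
    Set (EuclideanSpace ℝ (Fin k) × ℝ) :=
  {p | 0 < volume (vslice E p.2) ∧
      p.1 ∈ Metric.closedBall 0 (diskRadius k (volume (vslice E p.2)))}

/-- Steiner symmetrization `E^⋆`: each vertical fiber of positive length is replaced by the
closed interval centered at `0` of the same length; fibers of length zero are replaced by
the empty set. -/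
noncomputable def steinerSymm {k : ℕ} (E : Set (EuclideanSpace ℝ (Fin k) × ℝ)) :
    Set (EuclideanSpace ℝ (Fin k) × ℝ) :=
  {p | 0 < volume (hfiber E p.1) ∧
      p.2 ∈ Set.Icc (-((volume (hfiber E p.1)).toReal / 2))
        ((volume (hfiber E p.1)).toReal / 2)}

/-- `E^♮ = (E^⋆)^∗`. -/
noncomputable def natSymm {k : ℕ} (E : Set (EuclideanSpace ℝ (Fin k) × ℝ)) :
    Set (EuclideanSpace ℝ (Fin k) × ℝ) :=
  schwarzSymm (steinerSymm E)

theorem bm_one_compact {K L : Set ℝ} (hK : IsCompact K) (hL : IsCompact L)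
    (hK0 : K.Nonempty) (hL0 : L.Nonempty) : volume K + volume L ≤ volume (K + L) := by
  obtain ⟨a, haK, ha⟩ := hK.exists_isGreatest hK0
  obtain ⟨b, hbL, hb⟩ := hL.exists_isLeast hL0
  have h1 : volume ((fun x => x + b) '' K) = volume K := by
    simp
  have h2 : volume ((fun x => a + x) '' L) = volume L := by
    simp
  have hm : MeasurableSet ((fun x => a + x) '' L) :=
    (hL.image (by fun_prop)).isClosed.measurableSet
  rw [← h1, ← h2, ← measure_union₀ hm.nullMeasurableSet]
  · apply measure_mono
    rintro _ (⟨x, hx, rfl⟩ | ⟨x, hx, rfl⟩)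
    · exact add_mem_add hx hbL
    · exact add_mem_add haK hx
  · refine measure_mono_null (t := {a + b}) ?_ (by simp)
    rintro _ ⟨⟨x, hx, rfl⟩, ⟨y, hy, hxy⟩⟩
    have := ha hx
    have := hb hy
    simp only [mem_singleton_iff] at *
    linarith

theorem vol_eq_iSup {X : Set ℝ} (hX : MeasurableSet X) :
    volume X ≤ ⨆ K : {K : Set ℝ // K ⊆ X ∧ IsCompact K ∧ (X.Nonempty → K.Nonempty)}, volume K.1 := by
  refine le_of_forall_lt fun r hr => ?_
  obtain ⟨K, hKX, hK, hr'⟩ := hX.exists_lt_isCompact hr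
  refine lt_of_lt_of_le hr' (le_iSup_of_le ⟨K, hKX, hK, fun _ => ?_⟩ le_rfl)
  rw [nonempty_iff_ne_empty]
  rintro rfl
  simp at hr'

theorem bm_one {X Y Z : Set ℝ} (hX : MeasurableSet X) (hY : MeasurableSet Y)
    (hX0 : X.Nonempty) (hY0 : Y.Nonempty) {t : ℝ} (ht : t ∈ Ioo (0 : ℝ) 1)
    (H : ∀ x ∈ X, ∀ y ∈ Y, t * x + (1 - t) * y ∈ Z) :
    ENNReal.ofReal t * volume X + ENNReal.ofReal (1 - t) * volume Y ≤ volume Z := by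
  have n1 : ∀ {X : Set ℝ}, X.Nonempty →
      Nonempty {K : Set ℝ // K ⊆ X ∧ IsCompact K ∧ (X.Nonempty → K.Nonempty)} := by
    rintro X ⟨x, hx⟩
    exact ⟨⟨{x}, by simpa using hx, isCompact_singleton, fun _ => singleton_nonempty x⟩⟩
  have := n1 hX0
  have := n1 hY0
  grw [vol_eq_iSup hX, vol_eq_iSup hY]
  rw [ENNReal.mul_iSup, ENNReal.mul_iSup]
  refine ENNReal.iSup_add_iSup_le ?_
  rintro ⟨K, hKX, hK, hK0⟩ ⟨L, hLY, hL, hL0⟩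
  have h1 : ENNReal.ofReal t * volume K = volume (t • K) := by
    rw [Measure.addHaar_smul]; simp [abs_of_pos ht.1]
  have h2 : ENNReal.ofReal (1 - t) * volume L = volume ((1 - t) • L) := by
    rw [Measure.addHaar_smul]; simp [abs_of_pos (sub_pos.2 ht.2)]
  simp only
  rw [h1, h2]
  refine (bm_one_compact (hK.smul t) (hL.smul (1 - t)) ((hK0 hX0).smul_set)
    ((hL0 hY0).smul_set)).trans (measure_mono ?_)
  rintro _ ⟨_, ⟨x, hx, rfl⟩, _, ⟨y, hy, rfl⟩, rfl⟩
  exact H x (hKX hx) y (hLY hy)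

theorem layer_cake {f : ℝ → ℝ≥0∞} (hf : Measurable f) (hft : ∀ x, f x ≠ ⊤) :
    ∫⁻ x, f x = ∫⁻ s in Ioi (0 : ℝ), volume {x | ENNReal.ofReal s < f x} := by
  have := lintegral_eq_lintegral_meas_lt (volume : Measure ℝ) (f := fun x => (f x).toReal)
    (Filter.Eventually.of_forall fun x => ENNReal.toReal_nonneg) (by fun_prop)
  simp only [ENNReal.ofReal_toReal (hft _)] at this
  rw [this]
  refine setLIntegral_congr_fun measurableSet_Ioi fun s hs => ?_
  simp only [ENNReal.ofReal_lt_iff_lt_toReal (le_of_lt hs) (hft _)]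

theorem amgm {t : ℝ} (ht : t ∈ Ioo (0 : ℝ) 1) (a b : ℝ≥0∞) :
    a ^ t * b ^ (1 - t) ≤ ENNReal.ofReal t * a + ENNReal.ofReal (1 - t) * b := by
  have h0 := ht.1
  have h1 : 0 < 1 - t := sub_pos.2 ht.2
  rcases eq_or_ne a ⊤ with rfl | ha
  · rw [ENNReal.mul_top (by simpa using h0)]; simp
  rcases eq_or_ne b ⊤ with rfl | hb
  · rw [ENNReal.mul_top (by simpa using ht.2)]; simp
  lift a to NNReal using ha
  lift b to NNReal using hb
  have := NNReal.geom_mean_le_arith_mean2_weighted ⟨t, h0.le⟩ ⟨1 - t, h1.le⟩ a b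
    (NNReal.eq (by change t + (1 - t) = 1; ring))
  rw [← ENNReal.coe_rpow_of_nonneg _ h0.le, ← ENNReal.coe_rpow_of_nonneg _ h1.le,
    ENNReal.ofReal_eq_coe_nnreal h0.le, ENNReal.ofReal_eq_coe_nnreal h1.le]
  exact_mod_cast this

theorem pl_norm {t : ℝ} (ht : t ∈ Ioo (0 : ℝ) 1) {f g h : ℝ → ℝ≥0∞} (hf : Measurable f)
    (hg : Measurable g) (hh : Measurable h) (f1 : ⨆ x, f x = 1) (g1 : ⨆ x, g x = 1)
    (H : ∀ x y, f x ^ t * g y ^ (1 - t) ≤ h (t * x + (1 - t) * y)) :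
    ENNReal.ofReal t * (∫⁻ x, f x) + ENNReal.ofReal (1 - t) * (∫⁻ x, g x) ≤ ∫⁻ x, h x := by
  have h0 := ht.1
  have h1 : 0 < 1 - t := sub_pos.2 ht.2
  have fl : ∀ x, f x ≤ 1 := fun x => f1 ▸ le_iSup f x
  have gl : ∀ x, g x ≤ 1 := fun x => g1 ▸ le_iSup g x
  calc _ ≤ ∫⁻ x, min (h x) 1 := ?_
    _ ≤ _ := lintegral_mono fun x => min_le_left _ _
  rw [layer_cake hf (fun x => ne_top_of_le_ne_top ENNReal.one_ne_top (fl x)),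
    layer_cake hg (fun x => ne_top_of_le_ne_top ENNReal.one_ne_top (gl x)),
    layer_cake (hh.min measurable_const)
      (fun x => ne_top_of_le_ne_top ENNReal.one_ne_top (min_le_right _ _))]
  have am : ∀ u : ℝ → ℝ≥0∞, Measurable fun s : ℝ => volume {x | ENNReal.ofReal s < u x} := by
    intro u
    refine Antitone.measurable fun s s' hs => measure_mono fun x hx => ?_
    exact lt_of_le_of_lt (ENNReal.ofReal_le_ofReal hs) hx
  rw [← lintegral_const_mul _ (am f), ← lintegral_const_mul _ (am g),
    ← lintegral_add_left ((am f).const_mul _)]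
  refine setLIntegral_mono' measurableSet_Ioi fun s hs => ?_
  by_cases hs1 : ENNReal.ofReal s < 1
  · have hne : ∀ u : ℝ → ℝ≥0∞, ⨆ x, u x = 1 → {x | ENNReal.ofReal s < u x}.Nonempty :=
      fun u hu => lt_iSup_iff.1 (lt_of_lt_of_eq hs1 hu.symm)
    refine bm_one (measurableSet_lt measurable_const hf) (measurableSet_lt measurable_const hg)
      (hne f f1) (hne g g1) ht ?_
    intro x hx y hy
    refine lt_min (lt_of_lt_of_le ?_ (H x y)) hs1
    calc ENNReal.ofReal s = ENNReal.ofReal s ^ t * ENNReal.ofReal s ^ (1 - t) := by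
          rw [← ENNReal.rpow_add_of_nonneg _ _ h0.le h1.le]; simp
      _ < _ := ENNReal.mul_lt_mul (ENNReal.rpow_lt_rpow hx h0) (ENNReal.rpow_lt_rpow hy h1)
  · have e : ∀ u : ℝ → ℝ≥0∞, (∀ x, u x ≤ 1) → {x | ENNReal.ofReal s < u x} = ∅ := by
      intro u hu
      ext x
      simpa using (hu x).trans (not_lt.1 hs1)
    simp [e f fl, e g gl]

theorem pl_bdd {t : ℝ} (ht : t ∈ Ioo (0 : ℝ) 1) {f g h : ℝ → ℝ≥0∞} (hf : Measurable f)
    (hg : Measurable g) (hh : Measurable h) (f1 : ⨆ x, f x ≠ ⊤) (g1 : ⨆ x, g x ≠ ⊤)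
    (H : ∀ x y, f x ^ t * g y ^ (1 - t) ≤ h (t * x + (1 - t) * y)) :
    (∫⁻ x, f x) ^ t * (∫⁻ x, g x) ^ (1 - t) ≤ ∫⁻ x, h x := by
  have h0 := ht.1
  have h1 : 0 < 1 - t := sub_pos.2 ht.2
  set a := ⨆ x, f x with ha
  set b := ⨆ x, g x with hb
  rcases eq_or_ne a 0 with a0 | a0
  · have : ∀ x, f x = 0 := ENNReal.iSup_eq_zero.1 a0
    simp [this, h0]
  rcases eq_or_ne b 0 with b0 | b0
  · have : ∀ x, g x = 0 := ENNReal.iSup_eq_zero.1 b0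
    simp [this, ht.2]
  set c := a ^ t * b ^ (1 - t) with hc
  have c0 : c ≠ 0 := by simp [hc, a0, b0, h0, h1, f1, g1]
  have ct : c ≠ ⊤ := ENNReal.mul_ne_top (ENNReal.rpow_ne_top_of_nonneg h0.le f1)
    (ENNReal.rpow_ne_top_of_nonneg h1.le g1)
  have key := pl_norm ht (f := fun x => a⁻¹ * f x) (g := fun x => b⁻¹ * g x)
    (h := fun x => c⁻¹ * h x) (by fun_prop) (by fun_prop) (by fun_prop)
    (by rw [← ENNReal.mul_iSup, ENNReal.inv_mul_cancel a0 f1])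
    (by rw [← ENNReal.mul_iSup, ENNReal.inv_mul_cancel b0 g1]) ?_
  · replace key := (amgm ht _ _).trans key
    rw [lintegral_const_mul _ hf, lintegral_const_mul _ hg, lintegral_const_mul _ hh,
      ENNReal.mul_rpow_of_nonneg _ _ h0.le, ENNReal.mul_rpow_of_nonneg _ _ h1.le,
      ENNReal.inv_rpow, ENNReal.inv_rpow, mul_mul_mul_comm,
      ← ENNReal.mul_inv (by simp [a0, f1]) (by simp [b0, g1]), ← hc] at key
    exact (ENNReal.mul_le_mul_iff_right (ENNReal.inv_ne_zero.2 ct) (ENNReal.inv_ne_top.2 c0)).1 key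
  · intro x y
    rw [ENNReal.mul_rpow_of_nonneg _ _ h0.le, ENNReal.mul_rpow_of_nonneg _ _ h1.le,
      ENNReal.inv_rpow, ENNReal.inv_rpow, mul_mul_mul_comm,
      ← ENNReal.mul_inv (by simp [a0, f1]) (by simp [b0, g1]), ← hc]
    gcongr
    exact H x y

/-- Prekopa-Leindler property of a measure space. -/
def PLProp (E : Type) [AddCommGroup E] [Module ℝ E] [MeasureSpace E] : Prop :=
  ∀ t : ℝ, t ∈ Ioo (0 : ℝ) 1 → ∀ f g h : E → ℝ≥0∞, Measurable f → Measurable g → Measurable h →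
    (∀ x y, f x ^ t * g y ^ (1 - t) ≤ h (t • x + (1 - t) • y)) →
    (∫⁻ x, f x) ^ t * (∫⁻ x, g x) ^ (1 - t) ≤ ∫⁻ x, h x

theorem lint_trunc {f : ℝ → ℝ≥0∞} (hf : Measurable f) :
    Filter.Tendsto (fun n : ℕ => ∫⁻ x, min (f x) n) Filter.atTop (nhds (∫⁻ x, f x)) := by
  refine lintegral_tendsto_of_tendsto_of_monotone (fun n => (hf.min measurable_const).aemeasurable)
    (Filter.Eventually.of_forall fun x m n hmn => ?_) (Filter.Eventually.of_forall fun x => ?_)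
  · exact min_le_min_left _ (by exact_mod_cast hmn)
  · have := (tendsto_const_nhds (x := f x) (f := Filter.atTop)).min ENNReal.tendsto_nat_nhds_top
    simpa using this

theorem pl_real : PLProp ℝ := by
  intro t ht f g h hf hg hh H
  have h0 := ht.1
  have h1 : 0 < 1 - t := sub_pos.2 ht.2
  rcases eq_or_ne (∫⁻ x, f x) 0 with a0 | a0
  · simp [a0, h0]
  rcases eq_or_ne (∫⁻ x, g x) 0 with b0 | b0
  · simp [b0, ht.2]
  refine le_of_tendsto (ENNReal.Tendsto.mul
    ((ENNReal.continuous_rpow_const.tendsto _).comp (lint_trunc hf)) (Or.inl ?_)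
    ((ENNReal.continuous_rpow_const.tendsto _).comp (lint_trunc hg)) (Or.inl ?_))
    (Filter.Eventually.of_forall fun n => ?_)
  · simp [a0, h0, h0.not_gt]
  · simp [b0, ht.2, h1.not_gt]
  · have bd : ∀ u : ℝ → ℝ≥0∞, ⨆ x, min (u x) (n : ℝ≥0∞) ≠ ⊤ := fun u =>
      ne_top_of_le_ne_top (ENNReal.natCast_ne_top n) (iSup_le fun x => min_le_right _ _)
    refine pl_bdd ht (hf.min measurable_const) (hg.min measurable_const) hh (bd f) (bd g) ?_
    intro x y
    refine le_trans ?_ (H x y)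
    gcongr <;> exact min_le_left _ _

theorem pl_prod {E F : Type} [AddCommGroup E] [Module ℝ E] [MeasureSpace E]
    [AddCommGroup F] [Module ℝ F] [MeasureSpace F] [SFinite (volume : Measure E)]
    [SFinite (volume : Measure F)]
    (hE : PLProp E) (hF : PLProp F) : PLProp (E × F) := by
  intro t ht f g h hf hg hh H
  rw [Measure.volume_eq_prod, lintegral_prod _ hf.aemeasurable, lintegral_prod _ hg.aemeasurable,
    lintegral_prod _ hh.aemeasurable]
  refine hE t ht _ _ _ hf.lintegral_prod_right' hg.lintegral_prod_right' hh.lintegral_prod_right' ?_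
  intro x y
  refine hF t ht _ _ _ (by fun_prop) (by fun_prop) (by fun_prop) ?_
  intro u v
  exact H (x, u) (y, v)

theorem pl_equiv {E F : Type} [AddCommGroup E] [Module ℝ E] [MeasureSpace E]
    [AddCommGroup F] [Module ℝ F] [MeasureSpace F] (hE : PLProp E) (e : E → F)
    (he : MeasurePreserving e) (hl : ∀ (a b : ℝ) x y, e (a • x + b • y) = a • e x + b • e y) :
    PLProp F := by
  intro t ht f g h hf hg hh H
  have := he.measurable
  rw [← he.lintegral_comp hf, ← he.lintegral_comp hg, ← he.lintegral_comp hh]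
  refine hE t ht _ _ _ (by fun_prop) (by fun_prop) (by fun_prop) ?_
  intro x y
  rw [hl]
  exact H _ _

theorem pl_pi (k : ℕ) : PLProp (Fin k → ℝ) := by
  induction k with
  | zero =>
    intro t ht f g h hf hg hh H
    simp only [lintegral_unique]
    have := H default default
    rw [Subsingleton.elim (t • default + (1 - t) • default) (default : Fin 0 → ℝ)] at this
    simp only [volume_pi, Measure.pi_empty_univ, mul_one]
    convert this using 3 <;> exact congrArg _ (Subsingleton.elim _ _)
  | succ k ih =>
    refine pl_equiv (pl_prod pl_real ih) _
      (volume_preserving_piFinSuccAbove (fun _ : Fin (k + 1) => ℝ) 0).symm ?_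
    intro a b x y
    ext i
    refine Fin.cases ?_ (fun j => ?_) i <;> simp [MeasurableEquiv.piFinSuccAbove]

theorem pl_euclid (k : ℕ) : PLProp (EuclideanSpace ℝ (Fin k)) :=
  pl_equiv (pl_pi k) _ (PiLp.volume_preserving_toLp (Fin k)) (fun a b x y => by simp)

theorem ball_vol {k : ℕ} {r : ℝ} (hr : 0 ≤ r) :
    volume (Metric.closedBall (0 : EuclideanSpace ℝ (Fin k)) r) =
      ENNReal.ofReal (r ^ k) * volume (Metric.closedBall (0 : EuclideanSpace ℝ (Fin k)) 1) := by
  rw [Measure.addHaar_closedBall' _ _ hr]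
  simp

theorem unit_ball_ne_zero (k : ℕ) :
    volume (Metric.closedBall (0 : EuclideanSpace ℝ (Fin k)) 1) ≠ 0 :=
  (Metric.measure_closedBall_pos _ _ one_pos).ne'

theorem unit_ball_ne_top (k : ℕ) :
    volume (Metric.closedBall (0 : EuclideanSpace ℝ (Fin k)) 1) ≠ ⊤ :=
  measure_closedBall_lt_top.ne

theorem disk_nonneg (k : ℕ) (v : ℝ≥0∞) : 0 ≤ diskRadius k v :=
  Real.rpow_nonneg ENNReal.toReal_nonneg _

theorem disk_spec {k : ℕ} (hk : k ≠ 0) {v : ℝ≥0∞} (hv : v ≠ ⊤) :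
    ENNReal.ofReal (diskRadius k v ^ k) *
      volume (Metric.closedBall (0 : EuclideanSpace ℝ (Fin k)) 1) = v := by
  have h0 := unit_ball_ne_zero k
  have h1 := unit_ball_ne_top k
  rw [diskRadius, one_div, Real.rpow_inv_natCast_pow ENNReal.toReal_nonneg hk,
    ENNReal.ofReal_toReal (ENNReal.div_ne_top hv h0), ENNReal.div_mul_cancel h0 h1]

theorem le_disk {k : ℕ} (hk : k ≠ 0) {v : ℝ≥0∞} (hv : v ≠ ⊤) {r : ℝ}
    (h : ENNReal.ofReal (r ^ k) *
      volume (Metric.closedBall (0 : EuclideanSpace ℝ (Fin k)) 1) ≤ v) :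
    r ≤ diskRadius k v := by
  rw [← disk_spec hk hv, ENNReal.mul_le_mul_iff_left (unit_ball_ne_zero k) (unit_ball_ne_top k),
    ENNReal.ofReal_le_ofReal_iff (pow_nonneg (disk_nonneg k _) _)] at h
  exact le_of_pow_le_pow_left₀ hk (disk_nonneg k _) h

theorem disk_pos {k : ℕ} (hk : k ≠ 0) {v : ℝ≥0∞} (hv : v ≠ ⊤) (h0 : 0 < v) :
    0 < diskRadius k v := by
  refine lt_of_le_of_ne (disk_nonneg k v) fun h => ?_
  have := disk_spec hk hv
  rw [← h] at this
  simp [hk] at this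
  exact h0.ne this

theorem pre_vol {k : ℕ} {a : ℝ} (ha : 0 < a) (X : Set (EuclideanSpace ℝ (Fin k))) :
    volume {x : EuclideanSpace ℝ (Fin k) | a • x ∈ X} = ENNReal.ofReal ((a ^ k)⁻¹) * volume X := by
  have := Measure.addHaar_preimage_smul (volume : Measure (EuclideanSpace ℝ (Fin k))) ha.ne' X
  rw [abs_of_pos (by positivity)] at this
  simp only [finrank_euclideanSpace, Fintype.card_fin] at this
  exact this

theorem bm_euclid {k : ℕ} (hk : k ≠ 0) {X Y Z : Set (EuclideanSpace ℝ (Fin k))}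
    (hX : MeasurableSet X) (hY : MeasurableSet Y) (hZ : MeasurableSet Z)
    (hXt : volume X ≠ ⊤) (hYt : volume Y ≠ ⊤) (hZt : volume Z ≠ ⊤)
    (hX0 : 0 < volume X) (hY0 : 0 < volume Y) {t : ℝ} (ht : t ∈ Ioo (0 : ℝ) 1)
    (H : ∀ x ∈ X, ∀ y ∈ Y, t • x + (1 - t) • y ∈ Z) :
    0 < volume Z ∧ t * diskRadius k (volume X) + (1 - t) * diskRadius k (volume Y) ≤
      diskRadius k (volume Z) := by
  have h0 := ht.1
  have h1 : 0 < 1 - t := sub_pos.2 ht.2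
  have ha := disk_pos hk hXt hX0
  have hb := disk_pos hk hYt hY0
  have sa := disk_spec hk hXt
  have sb := disk_spec hk hYt
  set a := diskRadius k (volume X)
  set b := diskRadius k (volume Y)
  set m := t * a + (1 - t) * b with hm
  have m0 : 0 < m := by positivity
  set w := volume (Metric.closedBall (0 : EuclideanSpace ℝ (Fin k)) 1) with hw
  have w0 := unit_ball_ne_zero k
  have wt := unit_ball_ne_top k
  rw [← hw] at w0 wt
  have hθ : t * a / m ∈ Ioo (0 : ℝ) 1 := by
    constructor
    · positivity
    · rw [div_lt_one m0, hm]
      have : 0 < (1 - t) * b := by positivity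
      linarith
  have ha' : m * (t * a / m) = t * a := by field_simp
  have hb' : m * (1 - t * a / m) = (1 - t) * b := by
    rw [mul_sub, ha', hm]; ring
  set θ := t * a / m with hθd
  have mX : ∀ {c : ℝ} {S : Set (EuclideanSpace ℝ (Fin k))}, MeasurableSet S →
      MeasurableSet {x : EuclideanSpace ℝ (Fin k) | c • x ∈ S} := by
    intro c S hS
    exact (measurable_const_smul c) hS
  have key := pl_euclid k θ hθ (indicator {x | a • x ∈ X} 1) (indicator {x | b • x ∈ Y} 1)
    (indicator {x | m • x ∈ Z} 1) (measurable_one.indicator (mX hX))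
    (measurable_one.indicator (mX hY)) (measurable_one.indicator (mX hZ)) ?_
  · rw [lintegral_indicator_one (mX hX), lintegral_indicator_one (mX hY),
      lintegral_indicator_one (mX hZ), pre_vol ha, pre_vol hb, pre_vol m0] at key
    have one : ∀ {c : ℝ}, 0 < c → ENNReal.ofReal ((c ^ k)⁻¹) * ENNReal.ofReal (c ^ k) = 1 := by
      intro c hc
      rw [← ENNReal.ofReal_mul (by positivity), inv_mul_cancel₀ (by positivity), ENNReal.ofReal_one]
    rw [← sa, ← sb, ← mul_assoc, ← mul_assoc, one ha, one hb, one_mul,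
      ← ENNReal.rpow_add_of_nonneg _ _ hθ.1.le (sub_pos.2 hθ.2).le, add_sub_cancel,
      ENNReal.rpow_one] at key
    have key2 : ENNReal.ofReal (m ^ k) * w ≤ volume Z := by
      grw [key, ← mul_assoc, mul_comm (ENNReal.ofReal (m ^ k)), one m0, one_mul]
    refine ⟨lt_of_lt_of_le ?_ key2, le_disk hk hZt key2⟩
    exact ENNReal.mul_pos (by simpa using pow_pos m0 k) w0
  · intro x y
    by_cases hx : a • x ∈ X
    · by_cases hy : b • y ∈ Y
      · have : m • (θ • x + (1 - θ) • y) ∈ Z := by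
          rw [smul_add, smul_smul, smul_smul, ha', hb', ← smul_smul, ← smul_smul]
          exact H _ hx _ hy
        rw [indicator_of_mem (s := {x | m • x ∈ Z}) this]
        simp [indicator, hx, hy]
      · simp [indicator, hy, hθ.2]
    · simp [indicator, hx, hθ.1]

theorem schwarz_meas {k : ℕ} {E : Set (EuclideanSpace ℝ (Fin k) × ℝ)} (hE : MeasurableSet E) :
    MeasurableSet (schwarzSymm E) := by
  have hF : Measurable fun s : ℝ => volume (vslice E s) := measurable_measure_prodMk_right hE
  have hD : Measurable fun s : ℝ => diskRadius k (volume (vslice E s)) := by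
    unfold diskRadius
    fun_prop
  have : schwarzSymm E = {p | 0 < volume (vslice E p.2)} ∩
      {p | ‖p.1‖ ≤ diskRadius k (volume (vslice E p.2))} := by
    ext p; simp [schwarzSymm]
  rw [this]
  exact (measurableSet_lt measurable_const (hF.comp measurable_snd)).inter
    (measurableSet_le measurable_fst.norm (hD.comp measurable_snd))

theorem schwarz_vol {k : ℕ} (hk : k ≠ 0) {E : Set (EuclideanSpace ℝ (Fin k) × ℝ)}
    (hE : MeasurableSet E) (hf : ∀ s, volume (vslice E s) ≠ ⊤) :
    volume E = volume (schwarzSymm E) := by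
  rw [Measure.volume_eq_prod, Measure.prod_apply_symm hE, Measure.prod_apply_symm (schwarz_meas hE)]
  refine lintegral_congr fun s => ?_
  change volume (vslice E s) = volume {y | 0 < volume (vslice E s) ∧
      y ∈ Metric.closedBall 0 (diskRadius k (volume (vslice E s)))}
  rcases eq_or_ne (volume (vslice E s)) 0 with h | h
  · simp [h]
  · simp only [pos_iff_ne_zero.2 h, true_and, ofPred_mem_eq]
    rw [ball_vol (disk_nonneg _ _), disk_spec hk (hf s)]

theorem steiner_meas {k : ℕ} {E : Set (EuclideanSpace ℝ (Fin k) × ℝ)} (hE : MeasurableSet E) :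
    MeasurableSet (steinerSymm E) := by
  have hF : Measurable fun y => volume (hfiber E y) := measurable_measure_prodMk_left hE
  have hF' : Measurable fun p : EuclideanSpace ℝ (Fin k) × ℝ => volume (hfiber E p.1) :=
    hF.comp measurable_fst
  have : steinerSymm E = {p | 0 < volume (hfiber E p.1)} ∩
      ({p | -((volume (hfiber E p.1)).toReal / 2) ≤ p.2} ∩
      {p | p.2 ≤ (volume (hfiber E p.1)).toReal / 2}) := by
    ext p; simp [steinerSymm]
  rw [this]
  exact (measurableSet_lt measurable_const hF').inter
    ((measurableSet_le (by fun_prop) measurable_snd).inter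
    (measurableSet_le measurable_snd (by fun_prop)))

theorem steiner_vol {k : ℕ} {E : Set (EuclideanSpace ℝ (Fin k) × ℝ)}
    (hE : MeasurableSet E) (hf : ∀ y, volume (hfiber E y) ≠ ⊤) :
    volume E = volume (steinerSymm E) := by
  rw [Measure.volume_eq_prod, Measure.prod_apply hE, Measure.prod_apply (steiner_meas hE)]
  refine lintegral_congr fun y => ?_
  change volume (hfiber E y) = volume {s | 0 < volume (hfiber E y) ∧
      s ∈ Icc (-((volume (hfiber E y)).toReal / 2)) ((volume (hfiber E y)).toReal / 2)}
  rcases eq_or_ne (volume (hfiber E y)) 0 with h | h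
  · simp [h]
  · simp only [pos_iff_ne_zero.2 h, true_and, ofPred_mem_eq]
    rw [Real.volume_Icc, sub_neg_eq_add, add_halves, ENNReal.ofReal_toReal (hf y)]

theorem vslice_meas {k : ℕ} {E : Set (EuclideanSpace ℝ (Fin k) × ℝ)} (hE : MeasurableSet E)
    (s : ℝ) : MeasurableSet (vslice E s) := measurable_prodMk_right hE

theorem hfiber_meas {k : ℕ} {E : Set (EuclideanSpace ℝ (Fin k) × ℝ)} (hE : MeasurableSet E)
    (y : EuclideanSpace ℝ (Fin k)) : MeasurableSet (hfiber E y) := measurable_prodMk_left hE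

theorem schwarz_sub {k : ℕ} (hk : k ≠ 0) {A B C : Set (EuclideanSpace ℝ (Fin k) × ℝ)}
    (hA : MeasurableSet A) (hB : MeasurableSet B) (hC : MeasurableSet C)
    (fA : ∀ s, volume (vslice A s) ≠ ⊤) (fB : ∀ s, volume (vslice B s) ≠ ⊤)
    (fC : ∀ s, volume (vslice C s) ≠ ⊤) {t : ℝ} (ht : t ∈ Ioo (0 : ℝ) 1)
    (H : t • A + (1 - t) • B ⊆ C) :
    t • schwarzSymm A + (1 - t) • schwarzSymm B ⊆ schwarzSymm C := by
  have h1 : 0 < 1 - t := sub_pos.2 ht.2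
  rintro _ ⟨_, ⟨⟨x, r⟩, ⟨hx0, hx⟩, rfl⟩, _, ⟨⟨y, s⟩, ⟨hy0, hy⟩, rfl⟩, rfl⟩
  obtain ⟨z0, hz⟩ := bm_euclid hk (vslice_meas hA r) (vslice_meas hB s)
    (vslice_meas hC (t * r + (1 - t) * s)) (fA r) (fB s) (fC _) hx0 hy0 ht
    (fun u hu v hv => H (add_mem_add (smul_mem_smul_set (s := A) (a := t) (b := (u, r)) hu)
      (smul_mem_smul_set (s := B) (a := 1 - t) (b := (v, s)) hv)))
  refine ⟨z0, ?_⟩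
  simp only [mem_closedBall_zero_iff] at hx hy ⊢
  refine le_trans ?_ hz
  change ‖t • x + (1 - t) • y‖ ≤ _
  refine (norm_add_le _ _).trans ?_
  rw [norm_smul, norm_smul, Real.norm_of_nonneg ht.1.le, Real.norm_of_nonneg h1.le]
  exact add_le_add (mul_le_mul_of_nonneg_left hx ht.1.le) (mul_le_mul_of_nonneg_left hy h1.le)

theorem steiner_sub {k : ℕ} {A B C : Set (EuclideanSpace ℝ (Fin k) × ℝ)}
    (hA : MeasurableSet A) (hB : MeasurableSet B)
    (fA : ∀ s, volume (hfiber A s) ≠ ⊤) (fB : ∀ s, volume (hfiber B s) ≠ ⊤)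
    (fC : ∀ s, volume (hfiber C s) ≠ ⊤) {t : ℝ} (ht : t ∈ Ioo (0 : ℝ) 1)
    (H : t • A + (1 - t) • B ⊆ C) :
    t • steinerSymm A + (1 - t) • steinerSymm B ⊆ steinerSymm C := by
  have h1 : 0 < 1 - t := sub_pos.2 ht.2
  rintro _ ⟨_, ⟨⟨x, r⟩, ⟨hx0, hx⟩, rfl⟩, _, ⟨⟨y, s⟩, ⟨hy0, hy⟩, rfl⟩, rfl⟩
  have key := bm_one (Z := hfiber C (t • x + (1 - t) • y)) (hfiber_meas hA x) (hfiber_meas hB y)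
    (nonempty_of_measure_ne_zero hx0.ne') (nonempty_of_measure_ne_zero hy0.ne') ht
    (fun u hu v hv => H (add_mem_add (smul_mem_smul_set (s := A) (a := t) (b := (x, u)) hu)
      (smul_mem_smul_set (s := B) (a := 1 - t) (b := (y, v)) hv)))
  simp only at hx0 hy0 hx hy
  have z0 : 0 < volume (hfiber C (t • x + (1 - t) • y)) := by
    refine lt_of_lt_of_le ?_ (le_self_add.trans key)
    exact ENNReal.mul_pos (by simpa using ht.1) hx0.ne'
  have key2 := ENNReal.toReal_mono (fC _) key
  rw [ENNReal.toReal_add (ENNReal.mul_ne_top ENNReal.ofReal_ne_top (fA x))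
    (ENNReal.mul_ne_top ENNReal.ofReal_ne_top (fB y)), ENNReal.toReal_mul, ENNReal.toReal_mul,
    ENNReal.toReal_ofReal ht.1.le, ENNReal.toReal_ofReal h1.le] at key2
  refine ⟨z0, ?_⟩
  change t * r + (1 - t) * s ∈ Icc (-((volume (hfiber C (t • x + (1 - t) • y))).toReal / 2))
    ((volume (hfiber C (t • x + (1 - t) • y))).toReal / 2)
  have e1 := mul_le_mul_of_nonneg_left hx.1 ht.1.le
  have e2 := mul_le_mul_of_nonneg_left hx.2 ht.1.le
  have e3 := mul_le_mul_of_nonneg_left hy.1 h1.le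
  have e4 := mul_le_mul_of_nonneg_left hy.2 h1.le
  constructor <;> linarith

theorem vslice_fin {k : ℕ} {E : Set (EuclideanSpace ℝ (Fin k) × ℝ)} (hE : IsCompact E)
    (s : ℝ) : volume (vslice E s) ≠ ⊤ := by
  refine ne_top_of_le_ne_top (hE.image continuous_fst).measure_lt_top.ne (measure_mono ?_)
  exact fun y hy => ⟨(y, s), hy, rfl⟩

theorem hfiber_fin {k : ℕ} {E : Set (EuclideanSpace ℝ (Fin k) × ℝ)} (hE : IsCompact E)
    (y : EuclideanSpace ℝ (Fin k)) : volume (hfiber E y) ≠ ⊤ := by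
  refine ne_top_of_le_ne_top (hE.image continuous_snd).measure_lt_top.ne (measure_mono ?_)
  exact fun s hs => ⟨(y, s), hs, rfl⟩

theorem vslice_steiner_fin {k : ℕ} {E : Set (EuclideanSpace ℝ (Fin k) × ℝ)} (hE : IsCompact E)
    (s : ℝ) : volume (vslice (steinerSymm E) s) ≠ ⊤ := by
  refine ne_top_of_le_ne_top (hE.image continuous_fst).measure_lt_top.ne (measure_mono ?_)
  rintro y ⟨hy, -⟩
  obtain ⟨r, hr⟩ := nonempty_of_measure_ne_zero hy.ne'
  exact ⟨(y, r), hr, rfl⟩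

/-- M. Christ: the symmetrizations `∗`, `⋆`, `♮` preserve the measure of
compact sets and decrease the measure of convex combinations. -/
theorem statement3 (n : ℕ) (hn : 2 ≤ n)
    (A B : Set (EuclideanSpace ℝ (Fin (n - 1)) × ℝ))
    (hA : IsCompact A) (hB : IsCompact B) (t : ℝ) (ht : t ∈ Set.Ioo (0 : ℝ) 1) :
    volume A = volume (schwarzSymm A) ∧
    volume A = volume (steinerSymm A) ∧
    volume A = volume (natSymm A) ∧
    volume (t • schwarzSymm A + (1 - t) • schwarzSymm B) ≤ volume (t • A + (1 - t) • B) ∧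
    volume (t • steinerSymm A + (1 - t) • steinerSymm B) ≤ volume (t • A + (1 - t) • B) ∧
    volume (t • natSymm A + (1 - t) • natSymm B) ≤ volume (t • A + (1 - t) • B) := by
  have hk : n - 1 ≠ 0 := by omega
  have hC : IsCompact (t • A + (1 - t) • B) := (hA.smul t).add (hB.smul (1 - t))
  set C := t • A + (1 - t) • B with hCd
  have mA := hA.measurableSet
  have mB := hB.measurableSet
  have mC := hC.measurableSet
  have nat_vol : ∀ {E : Set (EuclideanSpace ℝ (Fin (n - 1)) × ℝ)}, IsCompact E →
      volume E = volume (natSymm E) := fun hE =>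
    (steiner_vol hE.measurableSet (hfiber_fin hE)).trans
      (schwarz_vol hk (steiner_meas hE.measurableSet) (vslice_steiner_fin hE))
  have ss := steiner_sub mA mB (hfiber_fin hA) (hfiber_fin hB) (hfiber_fin hC) ht hCd.ge
  refine ⟨schwarz_vol hk mA (vslice_fin hA), steiner_vol mA (hfiber_fin hA), nat_vol hA, ?_, ?_, ?_⟩
  · rw [schwarz_vol hk mC (vslice_fin hC)]
    exact measure_mono (schwarz_sub hk mA mB mC (vslice_fin hA) (vslice_fin hB) (vslice_fin hC)
      ht hCd.ge)
  · rw [steiner_vol mC (hfiber_fin hC)]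
    exact measure_mono ss
  · rw [nat_vol hC]
    exact measure_mono (schwarz_sub hk (steiner_meas mA) (steiner_meas mB) (steiner_meas mC)
      (vslice_steiner_fin hA) (vslice_steiner_fin hB) (vslice_steiner_fin hC) ht ss)
end

section
/- Let n ≥ 2 and let A ⊆ ℝⁿ be a compact set. Then for almost every λ > 0 one has |A \ π^{−1}(𝒜(λ))| = |A^♮ \ π^{−1}(𝒜^♮(λ))| and H^{n−1}(𝒜(λ)) = H^{n−1}(𝒜^♮(λ)), where 𝒜(λ) := {y ∈ ℝ^{n−1} : H¹(A_y) > λ} and 𝒜^♮(λ) := {y ∈ ℝ^{n−1} : H¹(A^♮_y) > λ}. -/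
open MeasureTheory Set Pointwise
open scoped ENNReal

section helpers

lemma lay_cake {α : Type*} [MeasurableSpace α] (μ : Measure α) (f : α → ℝ≥0∞)
    (hf : Measurable f) (l : ℝ)
    (hfin : μ {a | ENNReal.ofReal l < f a} ≠ ∞) :
    ∫⁻ a, ({a | f a ≤ ENNReal.ofReal l}.indicator f a) ∂μ =
      ∫⁻ t in Ioi (0 : ℝ), if t < l then
        μ {a | ENNReal.ofReal t < f a} - μ {a | ENNReal.ofReal l < f a} else 0 := by
  have hms : MeasurableSet {a | f a ≤ ENNReal.ofReal l} := hf measurableSet_Iic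
  set h := {a | f a ≤ ENNReal.ofReal l}.indicator f with hh
  have hle : ∀ a, h a ≤ ENNReal.ofReal l := by
    intro a
    by_cases ha : f a ≤ ENNReal.ofReal l
    · simpa [hh, Set.indicator, ha] using ha
    · simp [hh, Set.indicator, ha]
  have hne : ∀ a, h a ≠ ∞ := fun a => ne_top_of_le_ne_top ENNReal.ofReal_ne_top (hle a)
  have hm : Measurable h := hf.indicator hms
  have e1 : ∫⁻ a, h a ∂μ = ∫⁻ a, ENNReal.ofReal ((h a).toReal) ∂μ :=
    lintegral_congr fun a => (ENNReal.ofReal_toReal (hne a)).symm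
  rw [e1, lintegral_eq_lintegral_meas_lt μ (ae_of_all _ fun a => ENNReal.toReal_nonneg)
    hm.ennreal_toReal.aemeasurable]
  refine setLIntegral_congr_fun measurableSet_Ioi fun t ht => ?_
  have ht0 : (0 : ℝ) < t := ht
  have e2 : {a | t < (h a).toReal} = {a | ENNReal.ofReal t < h a} := by
    ext a
    exact (ENNReal.ofReal_lt_iff_lt_toReal ht0.le (hne a)).symm
  simp only [e2]
  split_ifs with htl
  · rw [← measure_sdiff _ (measurableSet_lt measurable_const hf).nullMeasurableSet hfin]
    · congr 1
      ext a
      by_cases ha : f a ≤ ENNReal.ofReal l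
      · simp [hh, Set.indicator, ha]
      · simp [hh, Set.indicator, ha]
    · intro a ha
      have ha : ENNReal.ofReal l < f a := ha
      exact lt_of_le_of_lt (ENNReal.ofReal_le_ofReal htl.le) ha
  · have : {a | ENNReal.ofReal t < h a} = ∅ := by
      ext a
      simp only [mem_ofPred_eq, mem_empty_iff_false, iff_false, not_lt]
      exact (hle a).trans (ENNReal.ofReal_le_ofReal (not_lt.1 htl))
    rw [this, measure_empty]

lemma vol_diff {k : ℕ} (E : Set (EuclideanSpace ℝ (Fin k) × ℝ)) (hE : MeasurableSet E) (l : ℝ) :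
    volume (E \ {p | ENNReal.ofReal l < volume (hfiber E p.1)}) =
      ∫⁻ y, ({y | volume (hfiber E y) ≤ ENNReal.ofReal l}.indicator
        (fun y => volume (hfiber E y)) y) := by
  have hm : Measurable fun y => volume (hfiber E y) := measurable_measure_prodMk_left hE
  have hS : MeasurableSet (E \ {p | ENNReal.ofReal l < volume (hfiber E p.1)}) :=
    hE.diff (measurableSet_lt measurable_const (hm.comp measurable_fst))
  rw [Measure.volume_eq_prod, Measure.prod_apply hS]
  refine lintegral_congr fun y => ?_
  by_cases hy : volume (hfiber E y) ≤ ENNReal.ofReal l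
  · simp only [Set.indicator, mem_ofPred_eq, hy, if_true]
    congr 1
    ext s
    simp [hfiber] at hy ⊢
    intro _
    exact hy
  · simp only [Set.indicator, mem_ofPred_eq, hy, if_false]
    convert measure_empty (μ := (volume : Measure ℝ))
    ext s
    simp [hfiber] at hy ⊢
    intro _
    exact hy

lemma vol_disk {k : ℕ} (hk : k ≠ 0) (v : ℝ≥0∞) (hv : v ≠ ∞) :
    volume (Metric.closedBall (0 : EuclideanSpace ℝ (Fin k)) (diskRadius k v)) = v := by
  have h0 : volume (Metric.closedBall (0 : EuclideanSpace ℝ (Fin k)) 1) ≠ 0 :=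
    (Metric.measure_closedBall_pos _ _ one_pos).ne'
  have h1 : volume (Metric.closedBall (0 : EuclideanSpace ℝ (Fin k)) 1) ≠ ∞ :=
    measure_closedBall_lt_top.ne
  have hr : 0 ≤ diskRadius k v := Real.rpow_nonneg ENNReal.toReal_nonneg _
  rw [Measure.addHaar_closedBall' _ _ hr, finrank_euclideanSpace_fin]
  have : diskRadius k v ^ k =
      (v / volume (Metric.closedBall (0 : EuclideanSpace ℝ (Fin k)) 1)).toReal := by
    unfold diskRadius
    rw [one_div, Real.rpow_inv_natCast_pow ENNReal.toReal_nonneg hk]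
  rw [this, ENNReal.ofReal_toReal (ENNReal.div_ne_top hv h0), ENNReal.div_mul_cancel h0 h1]

lemma diskRadius_mono {k : ℕ} {v w : ℝ≥0∞} (hw : w ≠ ∞) (h : v ≤ w) :
    diskRadius k v ≤ diskRadius k w := by
  have h0 : volume (Metric.closedBall (0 : EuclideanSpace ℝ (Fin k)) 1) ≠ 0 :=
    (Metric.measure_closedBall_pos _ _ one_pos).ne'
  unfold diskRadius
  refine Real.rpow_le_rpow ENNReal.toReal_nonneg ?_ (by positivity)
  exact ENNReal.toReal_mono (ENNReal.div_ne_top hw h0) (ENNReal.div_le_div_right h _)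

lemma measurable_diskRadius (k : ℕ) : Measurable (diskRadius k) := by
  unfold diskRadius
  fun_prop

lemma meas_steiner {k : ℕ} (E : Set (EuclideanSpace ℝ (Fin k) × ℝ)) (hE : MeasurableSet E) :
    MeasurableSet (steinerSymm E) := by
  have hm : Measurable fun p : EuclideanSpace ℝ (Fin k) × ℝ => volume (hfiber E p.1) :=
    (measurable_measure_prodMk_left hE).comp measurable_fst
  have h2 : Measurable fun p : EuclideanSpace ℝ (Fin k) × ℝ =>
    (volume (hfiber E p.1)).toReal / 2 := hm.ennreal_toReal.div_const 2
  exact (measurableSet_lt measurable_const hm).inter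
    ((measurableSet_le h2.neg measurable_snd).inter (measurableSet_le measurable_snd h2))

lemma meas_schwarz {k : ℕ} (E : Set (EuclideanSpace ℝ (Fin k) × ℝ)) (hE : MeasurableSet E) :
    MeasurableSet (schwarzSymm E) := by
  have hm : Measurable fun p : EuclideanSpace ℝ (Fin k) × ℝ => volume (vslice E p.2) :=
    (measurable_measure_prodMk_right hE).comp measurable_snd
  exact (measurableSet_lt measurable_const hm).inter
    (measurableSet_le (measurable_fst.dist measurable_const)
      ((measurable_diskRadius k).comp hm))

lemma hfiber_lt_top {k : ℕ} (A : Set (EuclideanSpace ℝ (Fin k) × ℝ)) (hA : IsCompact A)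
    (y : EuclideanSpace ℝ (Fin k)) : volume (hfiber A y) ≠ ∞ := by
  refine ((measure_mono ?_).trans_lt (hA.image continuous_snd).measure_lt_top).ne
  intro s hs
  exact ⟨(y, s), hs, rfl⟩

lemma vslice_steiner_anti {k : ℕ} (A : Set (EuclideanSpace ℝ (Fin k) × ℝ)) {s t : ℝ}
    (h : |s| ≤ |t|) : vslice (steinerSymm A) t ⊆ vslice (steinerSymm A) s := by
  rintro y ⟨h0, h1⟩
  refine ⟨h0, ?_⟩
  exact abs_le.1 (h.trans (abs_le.2 h1))

lemma supp_lt_top {k : ℕ} (A : Set (EuclideanSpace ℝ (Fin k) × ℝ)) (hA : IsCompact A) :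
    volume {y | 0 < volume (hfiber A y)} ≠ ∞ := by
  refine ((measure_mono ?_).trans_lt (hA.image continuous_fst).measure_lt_top).ne
  intro y hy
  have hy : 0 < volume (hfiber A y) := hy
  obtain ⟨s, hs⟩ := nonempty_of_measure_ne_zero hy.ne'
  exact ⟨(y, s), hs, rfl⟩

lemma equi {k : ℕ} (hk : k ≠ 0) (A : Set (EuclideanSpace ℝ (Fin k) × ℝ)) (hA : IsCompact A)
    (l : ℝ) (hl : 0 < l) :
    volume {y : EuclideanSpace ℝ (Fin k) | ENNReal.ofReal l < volume (hfiber A y)} =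
      volume {y : EuclideanSpace ℝ (Fin k) |
        ENNReal.ofReal l < volume (hfiber (natSymm A) y)} := by
  set u : ℕ → ℝ := fun n => l / 2 + 1 / ((n : ℝ) + 1) with hu
  have upos : ∀ n, l / 2 < u n := fun n => by
    have : (0 : ℝ) < 1 / ((n : ℝ) + 1) := by positivity
    simp only [hu]; linarith
  have uabs : ∀ n, |u n| = u n := fun n => abs_of_pos (by linarith [upos n])
  have uanti : ∀ m n, m ≤ n → u n ≤ u m := fun m n h => by
    simp only [hu]
    have : 1 / ((n : ℝ) + 1) ≤ 1 / ((m : ℝ) + 1) := Nat.one_div_le_one_div h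
    linarith
  have uex : ∀ s, l / 2 < s → ∃ n, u n < s := fun s hs => by
    obtain ⟨n, hn⟩ := exists_nat_one_div_lt (sub_pos.2 hs)
    exact ⟨n, by simp only [hu]; linarith⟩
  have gfin : ∀ s, volume (vslice (steinerSymm A) s) ≠ ∞ := fun s =>
    ne_top_of_le_ne_top (supp_lt_top A hA) (measure_mono fun y hy => hy.1)
  have Santi : ∀ s t : ℝ, |s| ≤ |t| → vslice (natSymm A) t ⊆ vslice (natSymm A) s := by
    rintro s t h y ⟨h0, h1⟩
    have hg := measure_mono (μ := volume) (vslice_steiner_anti A h)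
    exact ⟨h0.trans_le hg, Metric.closedBall_subset_closedBall (diskRadius_mono (gfin s) hg) h1⟩
  have Svol : ∀ s, volume (vslice (natSymm A) s) = volume (vslice (steinerSymm A) s) := by
    intro s
    by_cases h0 : 0 < volume (vslice (steinerSymm A) s)
    · rw [← vol_disk hk _ (gfin s)]
      congr 1
      ext y
      exact ⟨fun h => h.2, fun h => ⟨h0, h⟩⟩
    · have : vslice (natSymm A) s = ∅ := by
        ext y
        exact ⟨fun h => h0 h.1, fun h => h.elim⟩
      rw [this, measure_empty]
      exact (le_antisymm (not_lt.1 h0) zero_le).symm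
  have e1 : {y : EuclideanSpace ℝ (Fin k) | ENNReal.ofReal l < volume (hfiber A y)} =
      ⋃ n, vslice (steinerSymm A) (u n) := by
    ext y
    have hfin := hfiber_lt_top A hA y
    rw [mem_iUnion]
    constructor
    · intro h
      have h : ENNReal.ofReal l < volume (hfiber A y) := h
      have h' := (ENNReal.ofReal_lt_iff_lt_toReal hl.le hfin).1 h
      obtain ⟨n, hn⟩ := uex ((volume (hfiber A y)).toReal / 2) (by linarith)
      exact ⟨n, zero_le.trans_lt h, by simp only; linarith [upos n], hn.le⟩
    · rintro ⟨n, h0, h1, h2⟩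
      refine (ENNReal.ofReal_lt_iff_lt_toReal hl.le hfin).2 ?_
      simp only at h2
      linarith [upos n]
  have e2 : {y : EuclideanSpace ℝ (Fin k) | ENNReal.ofReal l < volume (hfiber (natSymm A) y)} =
      ⋃ n, vslice (natSymm A) (u n) := by
    ext y
    rw [mem_iUnion]
    constructor
    · intro h
      have h : ENNReal.ofReal l < volume (hfiber (natSymm A) y) := h
      by_contra! hc
      refine absurd h (not_lt.2 ?_)
      have : hfiber (natSymm A) y ⊆ Icc (-(l/2)) (l/2) := by
        intro s hs
        refine abs_le.1 ?_
        by_contra! hs2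
        obtain ⟨n, hn⟩ := uex _ hs2
        exact hc n (Santi (u n) s (by rw [uabs]; exact hn.le) hs)
      refine (measure_mono this).trans ?_
      rw [Real.volume_Icc]
      exact ENNReal.ofReal_le_ofReal (by linarith)
    · rintro ⟨n, h⟩
      have : Icc (-(u n)) (u n) ⊆ hfiber (natSymm A) y := by
        intro s hs
        exact Santi s (u n) (by rw [uabs]; exact abs_le.2 hs) h
      refine lt_of_lt_of_le ?_ (measure_mono this)
      rw [Real.volume_Icc]
      exact (ENNReal.ofReal_lt_ofReal_iff (by linarith [upos n])).2 (by linarith [upos n])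
  rw [e1, e2, Monotone.measure_iUnion, Monotone.measure_iUnion]
  · simp only [Svol]
  · exact fun m n h => Santi _ _ (by rw [uabs, uabs]; exact uanti m n h)
  · exact fun m n h => vslice_steiner_anti A (by rw [uabs, uabs]; exact uanti m n h)

end helpers

/-- M. Christ: for a compact `A ⊆ ℝⁿ`, for a.e. `λ > 0` the
`♮`-symmetrization preserves both the measure of `A \ π⁻¹(𝒜(λ))` and the
`(n-1)`-dimensional measure of the superlevel set `𝒜(λ) = {y : H¹(A_y) > λ}`. -/
theorem statement4 (n : ℕ) (hn : 2 ≤ n)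
    (A : Set (EuclideanSpace ℝ (Fin (n - 1)) × ℝ)) (hA : IsCompact A) :
    ∀ᵐ lam : ℝ ∂volume, 0 < lam →
      volume (A \ {p | ENNReal.ofReal lam < volume (hfiber A p.1)}) =
        volume (natSymm A \ {p | ENNReal.ofReal lam < volume (hfiber (natSymm A) p.1)}) ∧
      volume {y : EuclideanSpace ℝ (Fin (n - 1)) | ENNReal.ofReal lam < volume (hfiber A y)} =
        volume {y : EuclideanSpace ℝ (Fin (n - 1)) |
          ENNReal.ofReal lam < volume (hfiber (natSymm A) y)} := by
  have hk : n - 1 ≠ 0 := by omega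
  have mA := hA.measurableSet
  have mN : MeasurableSet (natSymm A) := meas_schwarz _ (meas_steiner _ mA)
  refine Filter.Eventually.of_forall fun l hl => ?_
  have he := equi hk A hA l hl
  have hfin : volume {y | ENNReal.ofReal l < volume (hfiber A y)} ≠ ∞ :=
    ne_top_of_le_ne_top (supp_lt_top A hA)
      (measure_mono fun y hy =>
        show 0 < volume (hfiber A y) from
          (zero_le : 0 ≤ ENNReal.ofReal l).trans_lt hy)
  refine ⟨?_, he⟩
  rw [vol_diff A mA, vol_diff _ mN,
    lay_cake volume (fun y => volume (hfiber A y)) (measurable_measure_prodMk_left mA) l hfin,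
    lay_cake volume (fun y => volume (hfiber (natSymm A) y)) (measurable_measure_prodMk_left mN) l (he ▸ hfin)]
  refine setLIntegral_congr_fun measurableSet_Ioi fun t ht => ?_
  have h1 := equi hk A hA t ht
  simp only [h1, he]
end

section
/- Let n ≥ 2 and let A, B ⊆ ℝⁿ be compact sets such that |A|, |B| ≥ 1/2 and |tA + (1 − t)B| ≤ 2 for some t ∈ (0, 1); set τ := min{t, 1 − t}. There exists a constant M > 1, depending only on n, such that: (i) the ratio (sup_y H¹(A_y)) / (sup_y H¹(B_y)) lies in (τⁿ/M, M/τⁿ); (ii) the ratio H^{n−1}(π(A)) / H^{n−1}(π(B)) lies in (τⁿ/M, M/τⁿ); (iii) both products (sup_y H¹(A_y)) · H^{n−1}(π(A)) and (sup_y H¹(B_y)) · H^{n−1}(π(B)) lie in (1/M, M/τ^{2n}); and (iv) there exists λ > 0 such that, after applying the measure-preserving affine map (y, s) ↦ (λy, λ^{1−n}s) to both A and B, one has H^{n−1}(π(A)) + H^{n−1}(π(B)) + sup_y H¹(A_y) + sup_y H¹(B_y) ≤ M/τ^{2n}. -/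
open MeasureTheory Set Pointwise
open scoped ENNReal

lemma vol_le_sup_mul {k : ℕ} (A : Set (EuclideanSpace ℝ (Fin k) × ℝ)) (hA : IsCompact A) :
    volume A ≤ (⨆ y, volume (hfiber A y)) * volume (Prod.fst '' A) := by
  have hm : MeasurableSet (Prod.fst '' A) := (hA.image continuous_fst).measurableSet
  rw [Measure.volume_eq_prod, Measure.prod_apply hA.measurableSet, ← lintegral_indicator_const hm]
  refine lintegral_mono fun y => ?_
  by_cases hy : y ∈ Prod.fst '' A
  · rw [indicator_of_mem hy]
    exact le_iSup (fun y => volume (hfiber A y)) y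
  · rw [indicator_of_notMem hy]
    have : Prod.mk y ⁻¹' A = ∅ := by
      ext s
      simp only [mem_preimage, mem_empty_iff_false, iff_false]
      exact fun h => hy ⟨_, h, rfl⟩
    simp [this]

lemma key_bound {k : ℕ} (A B : Set (EuclideanSpace ℝ (Fin k) × ℝ)) (hA : IsCompact A)
    (hB : IsCompact B) (s r : ℝ) (hs : 0 < s) (hr : 0 < r) :
    ENNReal.ofReal s * (⨆ y, volume (hfiber A y)) *
      (ENNReal.ofReal (r ^ k) * volume (Prod.fst '' B)) ≤ volume (s • A + r • B) := by
  rw [ENNReal.mul_iSup, ENNReal.iSup_mul]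
  refine iSup_le fun y0 => ?_
  have hC : IsCompact (s • A + r • B) := (hA.smul s).add (hB.smul r)
  have hP : IsCompact (Prod.fst '' B) := hB.image continuous_fst
  set D : Set (EuclideanSpace ℝ (Fin k)) := (s • y0) +ᵥ (r • (Prod.fst '' B)) with hD
  have hDm : MeasurableSet D := ((hP.smul r).vadd (s • y0)).measurableSet
  have hDv : volume D = ENNReal.ofReal (r ^ k) * volume (Prod.fst '' B) := by
    rw [hD, measure_vadd, Measure.addHaar_smul]
    simp [abs_of_pos hr]
  rw [← hDv, Measure.volume_eq_prod, Measure.prod_apply hC.measurableSet,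
    ← lintegral_indicator_const hDm]
  refine lintegral_mono fun y => ?_
  by_cases hy : y ∈ D
  · rw [indicator_of_mem hy]
    obtain ⟨_, ⟨_, ⟨b, hb, rfl⟩, rfl⟩, rfl⟩ := hy
    have hsub : (r * b.2) +ᵥ (s • hfiber A y0) ⊆
        Prod.mk ((s • y0) +ᵥ (r • b.1)) ⁻¹' (s • A + r • B) := by
      rintro _ ⟨_, ⟨x, hx, rfl⟩, rfl⟩
      refine ⟨s • (y0, x), ⟨_, hx, rfl⟩, r • b, ⟨_, hb, rfl⟩, ?_⟩
      ext1
      · simp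
      · simp [add_comm]
    refine le_trans (le_of_eq ?_) (measure_mono hsub)
    rw [measure_vadd, Measure.addHaar_smul]
    simp [abs_of_pos hs]
  · rw [indicator_of_notMem hy]
    exact zero_le

lemma sup_ne_top {k : ℕ} (A : Set (EuclideanSpace ℝ (Fin k) × ℝ)) (hA : IsCompact A) :
    (⨆ y, volume (hfiber A y)) ≠ ⊤ := by
  refine ne_top_of_le_ne_top (hA.image continuous_snd).measure_lt_top.ne
    (iSup_le fun y => measure_mono ?_)
  exact fun s hs => ⟨_, hs, rfl⟩

lemma vol_fst_scale {k : ℕ} (A : Set (EuclideanSpace ℝ (Fin k) × ℝ)) (l c : ℝ) (hl : 0 < l) :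
    volume (Prod.fst '' ((fun p : EuclideanSpace ℝ (Fin k) × ℝ => (l • p.1, c * p.2)) '' A)) =
      ENNReal.ofReal (l ^ k) * volume (Prod.fst '' A) := by
  have : Prod.fst '' ((fun p : EuclideanSpace ℝ (Fin k) × ℝ => (l • p.1, c * p.2)) '' A) =
      l • (Prod.fst '' A) := by
    rw [image_image, ← image_smul, image_image]
  rw [this, Measure.addHaar_smul]
  simp [abs_of_pos hl]

lemma sup_scale_le {k : ℕ} (A : Set (EuclideanSpace ℝ (Fin k) × ℝ)) (l c : ℝ) (hl : 0 < l)
    (hc : 0 < c) :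
    (⨆ y, volume (hfiber ((fun p : EuclideanSpace ℝ (Fin k) × ℝ => (l • p.1, c * p.2)) '' A) y)) ≤
      ENNReal.ofReal c * (⨆ y, volume (hfiber A y)) := by
  refine iSup_le fun y => ?_
  have hsub : hfiber ((fun p : EuclideanSpace ℝ (Fin k) × ℝ => (l • p.1, c * p.2)) '' A) y ⊆
      c • hfiber A (l⁻¹ • y) := by
    rintro s ⟨p, hp, h⟩
    simp only [Prod.mk.injEq] at h
    refine ⟨p.2, ?_, h.2⟩
    have : l⁻¹ • y = p.1 := by rw [← h.1, smul_smul, inv_mul_cancel₀ hl.ne', one_smul]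
    rw [this]
    exact hp
  refine (measure_mono hsub).trans ?_
  rw [Measure.addHaar_smul]
  simp only [Module.finrank_self, pow_one, abs_of_pos hc]
  gcongr
  exact le_iSup (fun y => volume (hfiber A y)) _

/-- The real-number content. -/
lemma real_part (a b P Q T : ℝ) (ha : 0 ≤ a) (hb : 0 ≤ b) (hP : 0 ≤ P) (hQ : 0 ≤ Q)
    (hT : 0 < T) (hT1 : T ≤ 1) (haP : 1 / 2 ≤ a * P) (hbQ : 1 / 2 ≤ b * Q)
    (haQ : T * (a * Q) ≤ 2) (hbP : T * (b * P) ≤ 2) :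
    0 < a ∧ 0 < b ∧ 0 < P ∧ 0 < Q ∧ (a / b ≤ 4 / T) ∧ (T / 4 ≤ a / b) ∧
    (P / Q ≤ 4 / T) ∧ (T / 4 ≤ P / Q) ∧ a * P ≤ 8 / T ^ 2 ∧ b * Q ≤ 8 / T ^ 2 ∧
    1 + Q / P + P * a + P * b ≤ 15 / T ^ 2 := by
  have ha' : 0 < a := by
    rcases ha.eq_or_lt with h | h
    · rw [← h] at haP; norm_num at haP
    · exact h
  have hb' : 0 < b := by
    rcases hb.eq_or_lt with h | h
    · rw [← h] at hbQ; norm_num at hbQ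
    · exact h
  have hP' : 0 < P := by
    rcases hP.eq_or_lt with h | h
    · rw [← h] at haP; norm_num at haP
    · exact h
  have hQ' : 0 < Q := by
    rcases hQ.eq_or_lt with h | h
    · rw [← h] at hbQ; norm_num at hbQ
    · exact h
  have h1 : T * a ≤ 4 * b := by
    refine le_of_mul_le_mul_right ?_ hQ'
    nlinarith
  have h2 : T * b ≤ 4 * a := by
    refine le_of_mul_le_mul_right ?_ hP'
    nlinarith
  have h3 : T * P ≤ 4 * Q := by
    refine le_of_mul_le_mul_right ?_ hb'
    nlinarith
  have h4 : T * Q ≤ 4 * P := by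
    refine le_of_mul_le_mul_right ?_ ha'
    nlinarith
  have h5 : T ^ 2 * (a * P) ≤ 8 := by
    nlinarith [mul_le_mul_of_nonneg_right h1 (mul_pos hT hP').le]
  have h6 : T ^ 2 * (b * Q) ≤ 8 := by
    nlinarith [mul_le_mul_of_nonneg_right h2 (mul_pos hT hQ').le]
  have hQP : Q / P ≤ 4 / T := by rw [div_le_div_iff₀ hP' hT]; linarith
  have hT2 : T ^ 2 ≤ T := by nlinarith
  refine ⟨ha', hb', hP', hQ', ?_, ?_, ?_, ?_, ?_, ?_, ?_⟩
  · rw [div_le_div_iff₀ hb' hT]; linarith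
  · rw [div_le_div_iff₀ (by norm_num) hb']; linarith
  · rw [div_le_div_iff₀ hQ' hT]; linarith
  · rw [div_le_div_iff₀ (by norm_num) hQ']; linarith
  · rw [le_div_iff₀ (by positivity)]; linarith
  · rw [le_div_iff₀ (by positivity)]; linarith
  · have e1 : P * a ≤ 8 / T ^ 2 := by rw [le_div_iff₀ (by positivity)]; linarith
    have e2 : P * b ≤ 2 / T := by rw [le_div_iff₀ hT]; linarith
    have e3 : 1 / T ≤ 1 / T ^ 2 := one_div_le_one_div_of_le (by positivity) hT2
    have e4 : 1 ≤ 1 / T := by rw [le_div_iff₀ hT]; linarith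
    have f1 : 4 / T = 4 * (1 / T) := by ring
    have f2 : 2 / T = 2 * (1 / T) := by ring
    have f3 : 8 / T ^ 2 = 8 * (1 / T ^ 2) := by ring
    have f4 : 15 / T ^ 2 = 15 * (1 / T ^ 2) := by ring
    rw [f4]; rw [f1] at hQP; rw [f2] at e2; rw [f3] at e1
    linarith

/-- normalization lemma: if `|A|, |B| ≥ 1/2` and `|tA + (1-t)B| ≤ 2`,
then with `τ = min{t, 1-t}` the quantities `sup_y H¹(A_y)`, `sup_y H¹(B_y)`,
`H^{n-1}(π(A))`, `H^{n-1}(π(B))` are comparable in terms of a dimensional constant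
`M > 1`, and after a measure-preserving affine renormalization
`(y, s) ↦ (λ y, λ^{1-n} s)` their sum is at most `M / τ^{2n}`. -/
theorem statement5 (n : ℕ) (hn : 2 ≤ n) :
    ∃ M : ℝ, 1 < M ∧
      ∀ (A B : Set (EuclideanSpace ℝ (Fin (n - 1)) × ℝ)) (t τ : ℝ),
        IsCompact A → IsCompact B → t ∈ Set.Ioo (0 : ℝ) 1 →
        τ = min t (1 - t) →
        ENNReal.ofReal (1 / 2) ≤ volume A → ENNReal.ofReal (1 / 2) ≤ volume B →
        volume (t • A + (1 - t) • B) ≤ 2 →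
        (ENNReal.ofReal (τ ^ n / M) <
            (⨆ y, volume (hfiber A y)) / (⨆ y, volume (hfiber B y)) ∧
          (⨆ y, volume (hfiber A y)) / (⨆ y, volume (hfiber B y)) <
            ENNReal.ofReal (M / τ ^ n)) ∧
        (ENNReal.ofReal (τ ^ n / M) <
            volume (Prod.fst '' A) / volume (Prod.fst '' B) ∧
          volume (Prod.fst '' A) / volume (Prod.fst '' B) <
            ENNReal.ofReal (M / τ ^ n)) ∧
        (ENNReal.ofReal (1 / M) < (⨆ y, volume (hfiber A y)) * volume (Prod.fst '' A) ∧
          (⨆ y, volume (hfiber A y)) * volume (Prod.fst '' A) <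
            ENNReal.ofReal (M / τ ^ (2 * n))) ∧
        (ENNReal.ofReal (1 / M) < (⨆ y, volume (hfiber B y)) * volume (Prod.fst '' B) ∧
          (⨆ y, volume (hfiber B y)) * volume (Prod.fst '' B) <
            ENNReal.ofReal (M / τ ^ (2 * n))) ∧
        ∃ lam : ℝ, 0 < lam ∧
          volume (Prod.fst ''
              ((fun p : EuclideanSpace ℝ (Fin (n - 1)) × ℝ =>
                (lam • p.1, lam ^ (1 - (n : ℝ)) * p.2)) '' A)) +
            volume (Prod.fst ''
              ((fun p : EuclideanSpace ℝ (Fin (n - 1)) × ℝ =>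
                (lam • p.1, lam ^ (1 - (n : ℝ)) * p.2)) '' B)) +
            (⨆ y, volume (hfiber
              ((fun p : EuclideanSpace ℝ (Fin (n - 1)) × ℝ =>
                (lam • p.1, lam ^ (1 - (n : ℝ)) * p.2)) '' A) y)) +
            (⨆ y, volume (hfiber
              ((fun p : EuclideanSpace ℝ (Fin (n - 1)) × ℝ =>
                (lam • p.1, lam ^ (1 - (n : ℝ)) * p.2)) '' B) y)) ≤
            ENNReal.ofReal (M / τ ^ (2 * n)) := by
  obtain ⟨k, rfl⟩ : ∃ k, n = k + 1 := ⟨n - 1, by omega⟩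
  have hk : k ≠ 0 := by omega
  refine ⟨16, by norm_num, ?_⟩
  rw [Nat.add_sub_cancel]
  intro A B t τ hA hB ht hτ hAv hBv hC
  obtain ⟨ht0, ht1⟩ := ht
  have ht1' : 0 < 1 - t := by linarith
  have hτ0 : 0 < τ := by rw [hτ]; exact lt_min ht0 ht1'
  have hτt : τ ≤ t := hτ ▸ min_le_left _ _
  have hτt' : τ ≤ 1 - t := hτ ▸ min_le_right _ _
  have k1 := (key_bound A B hA hB t (1 - t) ht0 ht1').trans hC
  have k2 := key_bound B A hB hA (1 - t) t ht1' ht0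
  rw [add_comm ((1 - t) • B)] at k2
  replace k2 := k2.trans hC
  have v1 := hAv.trans (vol_le_sup_mul A hA)
  have v2 := hBv.trans (vol_le_sup_mul B hB)
  have sA := fun l c hl hc => sup_scale_le A l c hl hc
  have sB := fun l c hl hc => sup_scale_le B l c hl hc
  have pA := fun l c hl => vol_fst_scale A l c hl
  have pB := fun l c hl => vol_fst_scale B l c hl
  obtain ⟨a, ha, hae⟩ : ∃ a : ℝ, 0 ≤ a ∧ (⨆ y, volume (hfiber A y)) = ENNReal.ofReal a :=
    ⟨_, ENNReal.toReal_nonneg, (ENNReal.ofReal_toReal (sup_ne_top A hA)).symm⟩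
  obtain ⟨b, hb, hbe⟩ : ∃ a : ℝ, 0 ≤ a ∧ (⨆ y, volume (hfiber B y)) = ENNReal.ofReal a :=
    ⟨_, ENNReal.toReal_nonneg, (ENNReal.ofReal_toReal (sup_ne_top B hB)).symm⟩
  obtain ⟨P, hP, hPe⟩ : ∃ a : ℝ, 0 ≤ a ∧ volume (Prod.fst '' A) = ENNReal.ofReal a :=
    ⟨_, ENNReal.toReal_nonneg,
      (ENNReal.ofReal_toReal (hA.image continuous_fst).measure_lt_top.ne).symm⟩
  obtain ⟨Q, hQ, hQe⟩ : ∃ a : ℝ, 0 ≤ a ∧ volume (Prod.fst '' B) = ENNReal.ofReal a :=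
    ⟨_, ENNReal.toReal_nonneg,
      (ENNReal.ofReal_toReal (hB.image continuous_fst).measure_lt_top.ne).symm⟩
  have two : (2 : ℝ≥0∞) = ENNReal.ofReal 2 := by simp
  rw [hae, hQe, two, ← ENNReal.ofReal_mul ht0.le, ← ENNReal.ofReal_mul (by positivity),
    ← ENNReal.ofReal_mul (by positivity), ENNReal.ofReal_le_ofReal_iff (by norm_num)] at k1
  rw [hbe, hPe, two, ← ENNReal.ofReal_mul ht1'.le, ← ENNReal.ofReal_mul (by positivity),
    ← ENNReal.ofReal_mul (by positivity), ENNReal.ofReal_le_ofReal_iff (by norm_num)] at k2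
  rw [hae, hPe, ← ENNReal.ofReal_mul ha, ENNReal.ofReal_le_ofReal_iff (by positivity)] at v1
  rw [hbe, hQe, ← ENNReal.ofReal_mul hb, ENNReal.ofReal_le_ofReal_iff (by positivity)] at v2
  have hT : 0 < τ ^ (k + 1) := by positivity
  have hT1 : τ ^ (k + 1) ≤ 1 := pow_le_one₀ hτ0.le (by linarith)
  have w1 : τ ^ (k + 1) ≤ t * (1 - t) ^ k := by
    rw [pow_succ']; gcongr
  have w2 : τ ^ (k + 1) ≤ (1 - t) * t ^ k := by
    rw [pow_succ']; gcongr
  have u1 : τ ^ (k + 1) * (a * Q) ≤ 2 := by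
    have := mul_le_mul_of_nonneg_right w1 (mul_nonneg ha hQ)
    nlinarith
  have u2 : τ ^ (k + 1) * (b * P) ≤ 2 := by
    have := mul_le_mul_of_nonneg_right w2 (mul_nonneg hb hP)
    nlinarith
  have hT2 : τ ^ (2 * (k + 1)) = (τ ^ (k + 1)) ^ 2 := by rw [mul_comm, pow_mul]
  rw [hae, hbe, hPe, hQe, hT2]
  rw [hae] at sA
  rw [hbe] at sB
  rw [hPe] at pA
  rw [hQe] at pB
  generalize τ ^ (k + 1) = T at *
  obtain ⟨ha', hb', hP', hQ', r1, r2, r3, r4, r5, r6, r7⟩ :=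
    real_part a b P Q T ha hb hP hQ hT hT1 v1 v2 u1 u2
  have g1 : 4 / T < 16 / T := by gcongr; norm_num
  have g2 : T / 16 < T / 4 := by gcongr; norm_num
  have g3 : 8 / T ^ 2 < 16 / T ^ 2 := by gcongr; norm_num
  have g4 : 15 / T ^ 2 ≤ 16 / T ^ 2 := by gcongr; norm_num
  rw [← ENNReal.ofReal_div_of_pos hb', ← ENNReal.ofReal_div_of_pos hQ', ← ENNReal.ofReal_mul ha,
    ← ENNReal.ofReal_mul hb]
  have lt_of : ∀ x y : ℝ, 0 ≤ x → x < y → ENNReal.ofReal x < ENNReal.ofReal y :=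
    fun x y hx h => (ENNReal.ofReal_lt_ofReal_iff (hx.trans_lt h)).2 h
  refine ⟨⟨lt_of _ _ (by positivity) (by linarith), lt_of _ _ (by positivity) (by linarith)⟩,
    ⟨lt_of _ _ (by positivity) (by linarith), lt_of _ _ (by positivity) (by linarith)⟩,
    ⟨lt_of _ _ (by positivity) (by linarith), lt_of _ _ (by positivity) (by linarith)⟩,
    ⟨lt_of _ _ (by positivity) (by linarith), lt_of _ _ (by positivity) (by linarith)⟩, ?_⟩
  set l : ℝ := P⁻¹ ^ ((k : ℝ)⁻¹) with hl
  have hl0 : 0 < l := by positivity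
  have hlk : l ^ k = P⁻¹ := Real.rpow_inv_natCast_pow (by positivity) hk
  have hlc : l ^ (1 - ((k + 1 : ℕ) : ℝ)) = P := by
    have : 1 - ((k + 1 : ℕ) : ℝ) = -(k : ℝ) := by push_cast; ring
    rw [this, Real.rpow_neg hl0.le, Real.rpow_natCast, hlk, inv_inv]
  refine ⟨l, hl0, ?_⟩
  rw [hlc, pA l P hl0, pB l P hl0, hlk]
  refine (add_le_add (add_le_add le_rfl (sA l P hl0 hP')) (sB l P hl0 hP')).trans ?_
  have hi : 0 ≤ P⁻¹ := by positivity
  rw [← ENNReal.ofReal_mul hi, ← ENNReal.ofReal_mul hi, ← ENNReal.ofReal_mul hP,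
    ← ENNReal.ofReal_mul hP, ← ENNReal.ofReal_add (by positivity) (by positivity),
    ← ENNReal.ofReal_add (by positivity) (by positivity),
    ← ENNReal.ofReal_add (by positivity) (by positivity)]
  refine ENNReal.ofReal_le_ofReal (le_trans (le_of_eq ?_) (r7.trans g4))
  rw [inv_mul_cancel₀ hP'.ne', div_eq_inv_mul]
end

section
/- Let 0 < τ ≤ 1/2, t ∈ [τ, 1 − τ], and γ ∈ (0, 1]. Then t γ^{−1} + (1 − t) γ^{t/(1−t)} − 1 ≥ (τ/2) (γ − 1)². (In particular, the function γ ↦ t γ^{−1} + (1 − t) γ^{t/(1−t)} is convex on (0, 1], attains its minimum value 1 at γ = 1, and its second derivative is bounded below by τ on (0, 1].) -/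
open Real

lemma aux_d1 (t a x : ℝ) (hx : 0 < x) (h : (1 - t) * a = t) :
    HasDerivAt (fun γ : ℝ => t * γ⁻¹ + (1 - t) * γ ^ a)
      (t * (-(x ^ 2)⁻¹) + t * x ^ (a - 1)) x := by
  have h1 := (hasDerivAt_inv hx.ne').const_mul t
  have h2 := (Real.hasDerivAt_rpow_const (p := a) (Or.inl hx.ne')).const_mul (1 - t)
  refine (h1.add h2).congr_deriv ?_
  rw [← mul_assoc, h]

lemma aux_d2 (t a x : ℝ) (hx : 0 < x) :
    HasDerivAt (fun γ : ℝ => t * (-(γ ^ 2)⁻¹) + t * γ ^ (a - 1))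
      (t * (2 * (x ^ 3)⁻¹ + (a - 1) * x ^ (a - 2))) x := by
  have h1 := (((hasDerivAt_pow 2 x).inv (by positivity)).neg).const_mul t
  have h2 := (Real.hasDerivAt_rpow_const (p := a - 1) (Or.inl hx.ne')).const_mul t
  refine (h1.add h2).congr_deriv ?_
  rw [show a - 1 - 1 = a - 2 by ring]
  field_simp
  norm_num
  ring

lemma aux_bd (t a x : ℝ) (ht : 0 < t) (ha : 0 < a) (hx : 0 < x) (hx1 : x ≤ 1) :
    t ≤ t * (2 * (x ^ 3)⁻¹ + (a - 1) * x ^ (a - 2)) := by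
  have h1 : x ^ (a - 2) ≤ (x ^ 3)⁻¹ := by
    have : (x ^ 3)⁻¹ = x ^ (-3 : ℝ) := by
      rw [Real.rpow_neg hx.le]; norm_cast
    rw [this]
    exact Real.rpow_le_rpow_of_exponent_ge hx hx1 (by linarith)
  have h2 : 1 ≤ (x ^ 3)⁻¹ := (one_le_inv₀ (by positivity)).2 (pow_le_one₀ hx.le hx1)
  have h3 : 0 < x ^ (a - 2) := Real.rpow_pos_of_pos hx _
  have h4 : 0 < a * x ^ (a - 2) := mul_pos ha h3
  nlinarith

/-- elementary inequality used in the proof of Lemma `pi close`: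
for `t ∈ [τ, 1-τ]` and `γ ∈ (0, 1]` one has
`t γ⁻¹ + (1-t) γ^{t/(1-t)} - 1 ≥ (τ/2)(γ-1)²`; moreover the function
`γ ↦ t γ⁻¹ + (1-t) γ^{t/(1-t)}` is convex on `(0, 1]`, attains its minimum value `1`
at `γ = 1`, and its second derivative is bounded below by `τ` on `(0, 1]`. -/
theorem statement7 (τ t : ℝ) (hτ : 0 < τ) (hτ' : τ ≤ 1 / 2)
    (ht : t ∈ Set.Icc τ (1 - τ)) :
    (∀ γ : ℝ, 0 < γ → γ ≤ 1 →
      τ / 2 * (γ - 1) ^ 2 ≤ t * γ⁻¹ + (1 - t) * γ ^ (t / (1 - t)) - 1) ∧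
    ConvexOn ℝ (Set.Ioc (0 : ℝ) 1)
      (fun γ : ℝ => t * γ⁻¹ + (1 - t) * γ ^ (t / (1 - t))) ∧
    (∀ γ ∈ Set.Ioc (0 : ℝ) 1, 1 ≤ t * γ⁻¹ + (1 - t) * γ ^ (t / (1 - t))) ∧
    t * (1 : ℝ)⁻¹ + (1 - t) * (1 : ℝ) ^ (t / (1 - t)) = 1 ∧
    (∀ γ ∈ Set.Ioc (0 : ℝ) 1,
      τ ≤ iteratedDeriv 2
        (fun γ : ℝ => t * γ⁻¹ + (1 - t) * γ ^ (t / (1 - t))) γ) := by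
  obtain ⟨ht1, ht2⟩ := ht
  have ht0 : 0 < t := by linarith
  have h1t : 0 < 1 - t := by linarith
  have ha : 0 < t / (1 - t) := div_pos ht0 h1t
  have hat : (1 - t) * (t / (1 - t)) = t := by field_simp
  generalize t / (1 - t) = a at *
  have hI : interior (Set.Ioc (0 : ℝ) 1) = Set.Ioo 0 1 := interior_Ioc
  have key : ∀ γ : ℝ, 0 < γ → γ ≤ 1 →
      τ / 2 * (γ - 1) ^ 2 ≤ t * γ⁻¹ + (1 - t) * γ ^ a - 1 := by
    have d2 : ∀ x : ℝ, 0 < x → HasDerivAt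
        (fun γ : ℝ => (t * (-(γ ^ 2)⁻¹) + t * γ ^ (a - 1)) - τ * (γ - 1))
        (t * (2 * (x ^ 3)⁻¹ + (a - 1) * x ^ (a - 2)) - τ) x := by
      intro x hx
      have := (aux_d2 t a x hx).sub (((hasDerivAt_id x).sub_const 1).const_mul τ)
      refine this.congr_deriv ?_
      simp
    have d1 : ∀ x : ℝ, 0 < x → HasDerivAt
        (fun γ : ℝ => (t * γ⁻¹ + (1 - t) * γ ^ a) - τ / 2 * (γ - 1) ^ 2)
        ((t * (-(x ^ 2)⁻¹) + t * x ^ (a - 1)) - τ * (x - 1)) x := by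
      intro x hx
      have := (aux_d1 t a x hx hat).sub
        ((((hasDerivAt_id x).sub_const 1).pow 2).const_mul (τ / 2))
      refine this.congr_deriv ?_
      simp
      ring
    have mono : MonotoneOn
        (fun γ : ℝ => (t * (-(γ ^ 2)⁻¹) + t * γ ^ (a - 1)) - τ * (γ - 1))
        (Set.Ioc 0 1) := by
      apply monotoneOn_of_deriv_nonneg (convex_Ioc 0 1)
      · exact fun x hx => (d2 x hx.1).continuousAt.continuousWithinAt
      · rw [hI]
        exact fun x hx => (d2 x hx.1).differentiableAt.differentiableWithinAt
      · rw [hI]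
        intro x hx
        rw [(d2 x hx.1).deriv]
        have := aux_bd t a x ht0 ha hx.1 hx.2.le
        linarith
    have anti : AntitoneOn
        (fun γ : ℝ => (t * γ⁻¹ + (1 - t) * γ ^ a) - τ / 2 * (γ - 1) ^ 2)
        (Set.Ioc 0 1) := by
      apply antitoneOn_of_deriv_nonpos (convex_Ioc 0 1)
      · exact fun x hx => (d1 x hx.1).continuousAt.continuousWithinAt
      · rw [hI]
        exact fun x hx => (d1 x hx.1).differentiableAt.differentiableWithinAt
      · rw [hI]
        intro x hx
        rw [(d1 x hx.1).deriv]
        have := mono ⟨hx.1, hx.2.le⟩ ⟨one_pos, le_rfl⟩ hx.2.le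
        simpa using this
    intro γ h0 h1
    have := anti ⟨h0, h1⟩ ⟨one_pos, le_rfl⟩ h1
    simp at this
    linarith
  have hev : ∀ x : ℝ, 0 < x →
      deriv (fun γ : ℝ => t * γ⁻¹ + (1 - t) * γ ^ a) =ᶠ[nhds x]
        (fun γ : ℝ => t * (-(γ ^ 2)⁻¹) + t * γ ^ (a - 1)) := by
    intro x hx
    filter_upwards [lt_mem_nhds hx] with y hy
    exact (aux_d1 t a y hy hat).deriv
  have hd2 : ∀ x : ℝ, 0 < x → HasDerivAt
      (deriv (fun γ : ℝ => t * γ⁻¹ + (1 - t) * γ ^ a))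
      (t * (2 * (x ^ 3)⁻¹ + (a - 1) * x ^ (a - 2))) x :=
    fun x hx => (aux_d2 t a x hx).congr_of_eventuallyEq (hev x hx)
  refine ⟨key, ?_, ?_, by simp, ?_⟩
  · apply convexOn_of_deriv2_nonneg (convex_Ioc 0 1)
    · exact fun x hx => (aux_d1 t a x hx.1 hat).continuousAt.continuousWithinAt
    · rw [hI]
      exact fun x hx => (aux_d1 t a x hx.1 hat).differentiableAt.differentiableWithinAt
    · rw [hI]
      exact fun x hx => (hd2 x hx.1).differentiableAt.differentiableWithinAt
    · rw [hI]
      intro x hx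
      simp only [Function.iterate_succ, Function.iterate_zero, Function.comp, id]
      rw [(hd2 x hx.1).deriv]
      exact ht0.le.trans (aux_bd t a x ht0 ha hx.1 hx.2.le)
  · intro γ hγ
    have := key γ hγ.1 hγ.2
    have h2 : 0 ≤ τ / 2 * (γ - 1) ^ 2 := by positivity
    linarith
  · intro γ hγ
    rw [iteratedDeriv_succ, iteratedDeriv_one, (hd2 γ hγ.1).deriv]
    exact ht1.trans (aux_bd t a γ ht0 ha hγ.1 hγ.2)
end

section
/- Let n ≥ 2, let A, B ⊆ ℝⁿ be compact sets, let 0 < τ ≤ 1/2 and t ∈ [τ, 1 − τ], and set S := tA + (1 − t)B. Define ρ_A(s) := H^{n−1}(A(s))/|A|, ρ_B(s) := H^{n−1}(B(s))/|B|, and let T : ℝ → ℝ be the monotone (increasing) rearrangement pushing ρ_A(s) ds forward to ρ_B(s) ds. There exist constants C(n) and c(n) > 0 depending only on n such that: if ||A| − 1| + ||B| − 1| + ||S| − 1| ≤ δ and δ/τⁿ ≤ c(n), then ∫_ℝ |ρ_A(s)/ρ_B(T(s)) − 1| ρ_A(s) ds ≤ C(n) τ^{−n/2} δ^{1/2}.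 -/
open MeasureTheory Set Pointwise
open scoped ENNReal

lemma bm1_compact {K L : Set ℝ} (hK : IsCompact K) (hL : IsCompact L) (hKn : K.Nonempty)
    (hLn : L.Nonempty) {t : ℝ} (ht0 : 0 < t) (ht1 : t < 1) :
    ENNReal.ofReal t * volume K + ENNReal.ofReal (1 - t) * volume L
      ≤ volume (t • K + (1 - t) • L) := by
  obtain ⟨p, hpK, hp⟩ := hK.exists_isGreatest hKn
  obtain ⟨q, hqL, hq⟩ := hL.exists_isLeast hLn
  set z := t * p + (1 - t) * q
  let U : Set ℝ := (fun x => x + (1 - t) * q) '' (t • K)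
  let V : Set ℝ := (fun x => t * p + x) '' ((1 - t) • L)
  have hUc : IsCompact U := (hK.smul t).image (by fun_prop)
  have hVc : IsCompact V := (hL.smul (1 - t)).image (by fun_prop)
  have hU : volume U = ENNReal.ofReal t * volume K := by
    simp only [U, image_add_right, measure_preimage_add_right, Measure.addHaar_smul]
    simp [abs_of_pos ht0]
  have hV : volume V = ENNReal.ofReal (1 - t) * volume L := by
    simp only [V, image_add_left, measure_preimage_add, Measure.addHaar_smul]
    simp [abs_of_pos (sub_pos.2 ht1)]
  have hUV : AEDisjoint volume U V := by
    refine measure_mono_null (t := {z}) ?_ (by simp)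
    rintro x ⟨⟨_, ⟨k, hk, rfl⟩, rfl⟩, ⟨_, ⟨l, hl, rfl⟩, h⟩⟩
    simp only [smul_eq_mul] at h ⊢
    have h1 : t * k ≤ t * p := mul_le_mul_of_nonneg_left (hp hk) ht0.le
    have h2 : (1 - t) * q ≤ (1 - t) * l := mul_le_mul_of_nonneg_left (hq hl) (by linarith)
    rw [mem_singleton_iff]; simp only [z]; linarith
  rw [← hU, ← hV, ← measure_union₀ hVc.measurableSet.nullMeasurableSet hUV]
  apply measure_mono
  apply union_subset
  · rintro _ ⟨x, hx, rfl⟩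
    exact add_mem_add hx ⟨q, hqL, rfl⟩
  · rintro _ ⟨x, hx, rfl⟩
    exact add_mem_add ⟨p, hpK, rfl⟩ hx

lemma bm1 {P Q : Set ℝ} (hP : MeasurableSet P) (hQ : MeasurableSet Q) (hPn : P.Nonempty)
    (hQn : Q.Nonempty) {t : ℝ} (ht0 : 0 < t) (ht1 : t < 1) :
    ENNReal.ofReal t * volume P + ENNReal.ofReal (1 - t) * volume Q
      ≤ volume (t • P + (1 - t) • Q) := by
  have key : ∀ K ⊆ P, IsCompact K → ∀ L ⊆ Q, IsCompact L →
    ENNReal.ofReal t * volume K + ENNReal.ofReal (1 - t) * volume L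
      ≤ volume (t • P + (1 - t) • Q) := by
    intro K hKP hK L hLQ hL
    obtain ⟨p, hp⟩ := hPn
    obtain ⟨q, hq⟩ := hQn
    calc _ ≤ ENNReal.ofReal t * volume (insert p K) + ENNReal.ofReal (1 - t) * volume (insert q L) := by
          gcongr <;> exact subset_insert _ _
      _ ≤ _ := bm1_compact (hK.insert p) (hL.insert q) (by simp) (by simp) ht0 ht1
      _ ≤ _ := by
          apply measure_mono
          exact add_subset_add (smul_set_mono (insert_subset hp hKP))
            (smul_set_mono (insert_subset hq hLQ))
  rw [hP.measure_eq_iSup_isCompact, hQ.measure_eq_iSup_isCompact]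
  simp only [ENNReal.mul_iSup]
  have e1 : (⨆ K, ⨆ (_ : K ⊆ P), ⨆ (_ : IsCompact K), ENNReal.ofReal t * volume K) =
      ⨆ K : {K : Set ℝ // K ⊆ P ∧ IsCompact K}, ENNReal.ofReal t * volume K.1 := by
    rw [iSup_subtype]; simp only [iSup_and]
  have e2 : (⨆ K, ⨆ (_ : K ⊆ Q), ⨆ (_ : IsCompact K), ENNReal.ofReal (1-t) * volume K) =
      ⨆ K : {K : Set ℝ // K ⊆ Q ∧ IsCompact K}, ENNReal.ofReal (1-t) * volume K.1 := by
    rw [iSup_subtype]; simp only [iSup_and]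
  rw [e1, e2]
  have : Nonempty {K : Set ℝ // K ⊆ P ∧ IsCompact K} := ⟨∅, by simp, isCompact_empty⟩
  have : Nonempty {K : Set ℝ // K ⊆ Q ∧ IsCompact K} := ⟨∅, by simp, isCompact_empty⟩
  exact ENNReal.iSup_add_iSup_le fun K L => key _ K.2.1 K.2.2 _ L.2.1 L.2.2

lemma layer_one {F : ℝ → ℝ} (hF : Measurable F) (h0 : ∀ s, 0 ≤ F s) (h1 : ∀ s, F s ≤ 1) :
    ∫⁻ s, ENNReal.ofReal (F s) = ∫⁻ l in Ioo (0:ℝ) 1, volume {s | l ≤ F s} := by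
  rw [lintegral_eq_lintegral_meas_le volume (Filter.Eventually.of_forall h0) hF.aemeasurable]
  have : Ioi (0:ℝ) = Ioc 0 1 ∪ Ioi 1 := (Ioc_union_Ioi_eq_Ioi zero_le_one).symm
  rw [this, lintegral_union measurableSet_Ioi (by
    rw [Set.disjoint_left]; intro x hx hx'; exact absurd hx.2 (not_le.2 hx')),
    setLIntegral_congr_fun (g := fun _ => 0) measurableSet_Ioi, lintegral_zero, add_zero]
  · exact setLIntegral_congr Ioo_ae_eq_Ioc.symm
  · intro l hl
    have : {s | l ≤ F s} = ∅ := by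
      ext s; simp only [mem_ofPred_eq, mem_empty_iff_false, iff_false, not_le]
      exact (h1 s).trans_lt hl
    simp [this]

lemma pl1 {F G H : ℝ → ℝ} (hF : Measurable F) (hG : Measurable G) (hH : Measurable H)
    (F0 : ∀ s, 0 ≤ F s) (F1 : ∀ s, F s ≤ 1) (G0 : ∀ s, 0 ≤ G s) (G1 : ∀ s, G s ≤ 1)
    (H0 : ∀ s, 0 ≤ H s) (Fs : ∀ l < 1, ∃ s, l ≤ F s) (Gs : ∀ l < 1, ∃ s, l ≤ G s)
    {t : ℝ} (ht0 : 0 < t) (ht1 : t < 1)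
    (h : ∀ l, 0 < l → l < 1 → ∀ s r, l ≤ F s → l ≤ G r → l ≤ H (t * s + (1 - t) * r)) :
    ENNReal.ofReal t * (∫⁻ s, ENNReal.ofReal (F s)) +
        ENNReal.ofReal (1 - t) * (∫⁻ s, ENNReal.ofReal (G s))
      ≤ ∫⁻ s, ENNReal.ofReal (H s) := by
  rw [layer_one hF F0 F1, layer_one hG G0 G1,
    lintegral_eq_lintegral_meas_le volume (Filter.Eventually.of_forall H0) hH.aemeasurable,
    ← lintegral_const_mul' _ _ ENNReal.ofReal_ne_top, ← lintegral_const_mul' _ _ ENNReal.ofReal_ne_top]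
  have hm : Measurable fun l : ℝ => ENNReal.ofReal t * volume {s | l ≤ F s} := by
    apply Measurable.const_mul
    apply Antitone.measurable
    intro a b hab
    exact measure_mono fun s hs => le_trans hab hs
  rw [← lintegral_add_left hm]
  calc _ ≤ ∫⁻ l in Ioo (0:ℝ) 1, volume {s | l ≤ H s} := by
        apply setLIntegral_mono' measurableSet_Ioo
        intro l hl
        refine (bm1 (measurableSet_le measurable_const hF) (measurableSet_le measurable_const hG)
          (Fs l hl.2) (Gs l hl.2) ht0 ht1).trans ?_
        apply measure_mono
        rintro _ ⟨_, ⟨s, hs, rfl⟩, _, ⟨r, hr, rfl⟩, rfl⟩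
        exact h l hl.1 hl.2 s r hs hr
    _ ≤ _ := lintegral_mono_set fun x hx => hx.1

/-- Brunn–Minkowski in dimension `k`, root-free form. -/
def BMP (X : Type*) [TopologicalSpace X] [AddCommGroup X] [Module ℝ X] [MeasureSpace X] (k : ℕ) : Prop :=
  ∀ t : ℝ, 0 < t → t < 1 → ∀ K L : Set X, IsCompact K → IsCompact L → ∀ a b : ℝ, 0 < a → 0 < b →
    ENNReal.ofReal (a ^ k) ≤ volume K → ENNReal.ofReal (b ^ k) ≤ volume L →
    ENNReal.ofReal ((t * a + (1 - t) * b) ^ k) ≤ volume (t • K + (1 - t) • L)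

lemma BMP.transfer {X Y : Type*} [TopologicalSpace X] [AddCommGroup X] [Module ℝ X] [MeasureSpace X]
    [T2Space X] [BorelSpace X]
    [TopologicalSpace Y] [AddCommGroup Y] [Module ℝ Y] [MeasureSpace Y] [ContinuousAdd Y]
    [ContinuousConstSMul ℝ Y]
    {k : ℕ} (hX : BMP X k) (e : Y →ₗ[ℝ] X) (hc : Continuous e) (hi : Function.Injective e)
    (hm : MeasurePreserving e) : BMP Y k := by
  have hv : ∀ K : Set Y, IsCompact K → volume (e '' K) = volume K := by
    intro K hK
    rw [← hm.measure_preimage (hK.image hc).measurableSet.nullMeasurableSet, preimage_image_eq _ hi]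
  intro t t0 t1 K L hK hL a b ha hb hKa hLb
  have := hX t t0 t1 (e '' K) (e '' L) (hK.image hc) (hL.image hc) a b ha hb
    (by rwa [hv K hK]) (by rwa [hv L hL])
  rwa [← image_smul_set, ← image_smul_set, ← image_add, hv] at this
  exact (hK.smul _).add (hL.smul _)

lemma BMP_real : BMP ℝ 1 := by
  intro t t0 t1 K L hK hL a b ha hb hKa hLb
  simp only [pow_one] at *
  have hKn : K.Nonempty := by
    rw [nonempty_iff_ne_empty]; rintro rfl; simp at hKa; linarith
  have hLn : L.Nonempty := by
    rw [nonempty_iff_ne_empty]; rintro rfl; simp at hLb; linarith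
  refine le_trans ?_ (bm1_compact hK hL hKn hLn t0 t1)
  rw [ENNReal.ofReal_add (by positivity) (mul_nonneg (by linarith) hb.le),
    ENNReal.ofReal_mul t0.le, ENNReal.ofReal_mul (by linarith)]
  gcongr

lemma holder_aux {t α β a b : ℝ} (k : ℕ) (t0 : 0 < t) (t1 : t < 1) (hα : 0 < α) (hβ : 0 < β)
    (ha : 0 < a) (hb : 0 < b) :
    (t * a + (1 - t) * b) ^ (k + 1) ≤
      (t * α + (1 - t) * β) ^ k * (t * (a ^ (k + 1) / α ^ k) + (1 - t) * (b ^ (k + 1) / β ^ k)) := by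
  have t1' : 0 < 1 - t := by linarith
  set W := t * α + (1 - t) * β with hW
  have hWp : 0 < W := by positivity
  have := (convexOn_pow (𝕜 := ℝ) (k + 1)).2 (show a / α ∈ Ici 0 from (div_pos ha hα).le)
    (show b / β ∈ Ici 0 from (div_pos hb hβ).le) (show 0 ≤ t * α / W by positivity)
    (show 0 ≤ (1 - t) * β / W by positivity)
    (by rw [← add_div, ← hW, div_self hWp.ne'])
  simp only [smul_eq_mul] at this
  have e1 : t * α / W * (a / α) + (1 - t) * β / W * (b / β) = (t * a + (1 - t) * b) / W := by
    field_simp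
  have e2 : W ^ (k+1) * (t * α / W * (a / α) ^ (k+1) + (1 - t) * β / W * (b / β) ^ (k+1)) =
     W ^ k * (t * (a ^ (k + 1) / α ^ k) + (1 - t) * (b ^ (k + 1) / β ^ k)) := by
    rw [div_pow, div_pow]
    field_simp
    ring
  rw [e1, div_pow, div_le_iff₀ (by positivity)] at this
  rw [← e2, mul_comm (W ^ (k + 1))]
  exact this

section slices
variable {X : Type*} [NormedAddCommGroup X] [NormedSpace ℝ X] [MeasureSpace X] [BorelSpace X]
  [SecondCountableTopology X] [IsFiniteMeasureOnCompacts (volume : Measure X)]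
  [SigmaFinite (volume : Measure X)]

def sl (E : Set (X × ℝ)) (s : ℝ) : Set X := {y | (y, s) ∈ E}

lemma sl_compact {K : Set (X × ℝ)} (hK : IsCompact K) (s : ℝ) : IsCompact (sl K s) := by
  refine (hK.image continuous_fst).of_isClosed_subset ?_ ?_
  · exact hK.isClosed.preimage (by fun_prop : Continuous fun y : X => (y, s))
  · intro y hy; exact ⟨(y, s), hy, rfl⟩

lemma sl_meas {K : Set (X × ℝ)} (hK : IsCompact K) : Measurable fun s => volume (sl K s) :=
  measurable_measure_prodMk_right hK.measurableSet

lemma sl_lintegral {K : Set (X × ℝ)} (hK : IsCompact K) :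
    ∫⁻ s, volume (sl K s) = volume K :=
  (Measure.prod_apply_symm hK.measurableSet).symm

lemma sl_add (K L : Set (X × ℝ)) (t s r : ℝ) :
    t • sl K s + (1 - t) • sl L r ⊆ sl (t • K + (1 - t) • L) (t * s + (1 - t) * r) := by
  rintro _ ⟨_, ⟨x, hx, rfl⟩, _, ⟨y, hy, rfl⟩, rfl⟩
  exact ⟨_, ⟨_, hx, rfl⟩, _, ⟨_, hy, rfl⟩, rfl⟩

/-- normalized slice function -/
lemma sl_norm {K : Set (X × ℝ)} (hK : IsCompact K) {k : ℕ} (hk : k ≠ 0) (hpos : 0 < volume K) :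
    ∃ α : ℝ, 0 < α ∧ (∀ s, volume (sl K s) ≤ ENNReal.ofReal (α ^ k)) ∧
      (∀ l < 1, ∃ s, l ≤ (volume (sl K s)).toReal / α ^ k) := by
  set M : ℝ≥0∞ := ⨆ s, volume (sl K s) with hM
  have hle : ∀ s, volume (sl K s) ≤ M := fun s => le_iSup (fun s => volume (sl K s)) s
  have hMtop : M ≠ ∞ := by
    have : M ≤ volume (Prod.fst '' K) :=
      iSup_le fun s => measure_mono fun y hy => ⟨(y, s), hy, rfl⟩
    exact (this.trans_lt (hK.image continuous_fst).measure_lt_top).ne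
  have hM0 : M ≠ 0 := by
    intro h
    have : volume K = 0 := by
      rw [← sl_lintegral hK]
      simp only [fun s => le_antisymm ((hle s).trans h.le) zero_le, lintegral_zero]
    exact hpos.ne' this
  have hMr : 0 < M.toReal := ENNReal.toReal_pos hM0 hMtop
  have hα : (M.toReal ^ ((k : ℝ)⁻¹)) ^ k = M.toReal := Real.rpow_inv_natCast_pow hMr.le hk
  refine ⟨M.toReal ^ ((k : ℝ)⁻¹), by positivity, ?_, ?_⟩
  · intro s; rw [hα, ENNReal.ofReal_toReal hMtop]; exact hle s
  · intro l hl
    rw [hα]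
    have : ENNReal.ofReal (l * M.toReal) < M := by
      rw [← ENNReal.ofReal_toReal hMtop, ENNReal.toReal_ofReal hMr.le]
      rw [ENNReal.ofReal_lt_ofReal_iff hMr]
      nlinarith
    obtain ⟨s, hs⟩ := lt_iSup_iff.1 this
    refine ⟨s, ?_⟩
    rw [le_div_iff₀ hMr]
    exact (ENNReal.ofReal_le_iff_le_toReal ((hle s).trans_lt hMtop.lt_top).ne).1 hs.le

lemma BMP_step {k : ℕ} (hk : k ≠ 0) (hX : BMP X k) : BMP (X × ℝ) (k + 1) := by
  intro t t0 t1 K L hK hL a b ha hb hKa hLb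
  have t1' : 0 < 1 - t := by linarith
  obtain ⟨α, hα, hα1, hα2⟩ := sl_norm hK hk
    (lt_of_lt_of_le (by simpa using pow_pos ha _) hKa)
  obtain ⟨β, hβ, hβ1, hβ2⟩ := sl_norm hL hk
    (lt_of_lt_of_le (by simpa using pow_pos hb _) hLb)
  set S := t • K + (1 - t) • L with hSdef
  have hS : IsCompact S := (hK.smul _).add (hL.smul _)
  set γ := (t * α + (1 - t) * β) ^ k with hγ
  have hγ0 : 0 < γ := by positivity
  have fin : ∀ {E : Set (X × ℝ)}, IsCompact E → ∀ s, volume (sl E s) ≠ ∞ :=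
    fun hE s => (sl_compact hE s).measure_lt_top.ne
  have norm1 : ∀ {E : Set (X × ℝ)}, IsCompact E → ∀ c : ℝ, 0 < c →
      ∫⁻ s, ENNReal.ofReal ((volume (sl E s)).toReal / c) = volume E * ENNReal.ofReal (c⁻¹) := by
    intro E hE c hc
    rw [← sl_lintegral hE, ← lintegral_mul_const' _ _ ENNReal.ofReal_ne_top]
    apply lintegral_congr
    intro s
    rw [div_eq_mul_inv, ENNReal.ofReal_mul ENNReal.toReal_nonneg, ENNReal.ofReal_toReal (fin hE s)]
  have main := pl1 (F := fun s => (volume (sl K s)).toReal / α ^ k)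
    (G := fun s => (volume (sl L s)).toReal / β ^ k)
    (H := fun s => (volume (sl S s)).toReal / γ)
    ((sl_meas hK).ennreal_toReal.div_const _) ((sl_meas hL).ennreal_toReal.div_const _)
    ((sl_meas hS).ennreal_toReal.div_const _)
    (fun s => by positivity)
    (fun s => (div_le_one (by positivity)).2 (ENNReal.toReal_le_of_le_ofReal (by positivity) (hα1 s)))
    (fun s => by positivity)
    (fun s => (div_le_one (by positivity)).2 (ENNReal.toReal_le_of_le_ofReal (by positivity) (hβ1 s)))
    (fun s => by positivity) hα2 hβ2 t0 t1 (by
      intro l l0 l1 s r hs hr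
      rw [le_div_iff₀ (by positivity)] at hs hr ⊢
      have hl : (l ^ ((k : ℝ)⁻¹)) ^ k = l := Real.rpow_inv_natCast_pow l0.le hk
      set e := l ^ ((k : ℝ)⁻¹)
      have he : 0 < e := by positivity
      rw [← ENNReal.ofReal_le_iff_le_toReal (fin hK s), ← hl, ← mul_pow] at hs
      rw [← ENNReal.ofReal_le_iff_le_toReal (fin hL r), ← hl, ← mul_pow] at hr
      rw [← ENNReal.ofReal_le_iff_le_toReal (fin hS _)]
      have := hX t t0 t1 _ _ (sl_compact hK s) (sl_compact hL r) _ _ (by positivity) (by positivity)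
        hs hr
      refine le_trans (le_of_eq ?_) (this.trans (measure_mono (sl_add K L t s r)))
      congr 1
      rw [hγ, ← hl, ← mul_pow]
      ring_nf)
  rw [norm1 hK _ (by positivity), norm1 hL _ (by positivity), norm1 hS _ hγ0] at main
  have h1 : ENNReal.ofReal (t * (a ^ (k + 1) / α ^ k) + (1 - t) * (b ^ (k + 1) / β ^ k)) ≤
      volume S * ENNReal.ofReal γ⁻¹ := by
    refine le_trans ?_ main
    rw [ENNReal.ofReal_add (by positivity) (by positivity), ENNReal.ofReal_mul t0.le,
      ENNReal.ofReal_mul t1'.le, div_eq_mul_inv, div_eq_mul_inv,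
      ENNReal.ofReal_mul (by positivity), ENNReal.ofReal_mul (by positivity)]
    gcongr
  calc _ ≤ ENNReal.ofReal (γ * (t * (a ^ (k + 1) / α ^ k) + (1 - t) * (b ^ (k + 1) / β ^ k))) :=
        ENNReal.ofReal_le_ofReal (holder_aux k t0 t1 hα hβ ha hb)
    _ ≤ ENNReal.ofReal γ * (volume S * ENNReal.ofReal γ⁻¹) := by
        rw [ENNReal.ofReal_mul hγ0.le]; gcongr
    _ = volume S := by
        rw [mul_comm, mul_assoc, ← ENNReal.ofReal_mul (by positivity), inv_mul_cancel₀ hγ0.ne']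
        simp

end slices

lemma BMP_pi (k : ℕ) : BMP (Fin (k + 1) → ℝ) (k + 1) := by
  induction k with
  | zero =>
    exact BMP_real.transfer (LinearMap.proj (0 : Fin 1)) (continuous_apply _)
      (fun f g h => by ext i; fin_cases i; exact h)
      (volume_preserving_funUnique (Fin 1) ℝ)
  | succ k ih =>
    have h := BMP_step (Nat.succ_ne_zero k) ih
    refine h.transfer ((LinearMap.funLeft ℝ ℝ Fin.succ).prod (LinearMap.proj 0)) ?_ ?_ ?_
    · exact (continuous_pi fun i => continuous_apply _).prodMk (continuous_apply _)
    · intro f g h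
      ext i
      have h' := Prod.mk.inj h
      refine Fin.cases h'.2 (fun j => congrFun h'.1 j) i
    · exact (Measure.measurePreserving_swap).comp
        (volume_preserving_piFinSuccAbove (fun _ : Fin (k + 1 + 1) => ℝ) 0)

lemma BMP_euc (k : ℕ) : BMP (EuclideanSpace ℝ (Fin (k + 1))) (k + 1) :=
  (BMP_pi k).transfer (WithLp.linearEquiv 2 ℝ (Fin (k + 1) → ℝ)).toLinearMap
    (PiLp.continuous_ofLp 2 _) (WithLp.linearEquiv 2 ℝ (Fin (k + 1) → ℝ)).injective
    (PiLp.volume_preserving_ofLp _)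

/-- The truncated quadratic. -/
noncomputable def phi (z : ℝ) : ℝ := min |z| (z ^ 2)

lemma phi_nonneg (z : ℝ) : 0 ≤ phi z := le_min (abs_nonneg z) (sq_nonneg z)

lemma abs_le_phi {z η : ℝ} (h0 : 0 < η) (h1 : η ≤ 1) : |z| ≤ η + phi z / η := by
  unfold phi
  rcases le_total |z| (z ^ 2) with h | h
  · rw [min_eq_left h]
    have : |z| ≤ |z| / η := by
      rw [le_div_iff₀ h0]; nlinarith [abs_nonneg z]
    linarith
  · rw [min_eq_right h]
    have : |z| * η ≤ η * η + z ^ 2 := by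
      nlinarith [sq_abs z, sq_nonneg (|z| - η), abs_nonneg z]
    have h2 : η + z ^ 2 / η = (η * η + z ^ 2) / η := by field_simp
    rw [h2, le_div_iff₀ h0]; exact this

lemma ptw_x (m : ℕ) (hm : m ≠ 0) {τ t x : ℝ} (τ0 : 0 < τ) (τ1 : τ ≤ 1 / 2) (ht : τ ≤ t)
    (ht' : t ≤ 1 - τ) (hx : 0 < x) :
    1 + 1 / (4 * m ^ 2 * 8 ^ m) * τ ^ m * phi (x ^ m - 1) ≤
      (t + (1 - t) / x) ^ m * (t + (1 - t) * x ^ m) := by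
  have t0 : 0 < t := by linarith
  have t1 : 0 < 1 - t := by linarith
  have hm1 : (1 : ℝ) ≤ m := by exact_mod_cast Nat.one_le_iff_ne_zero.2 hm
  set y := t * (1 - t) * (x - 1) ^ 2 / x with hy
  have hy0 : 0 ≤ y := by positivity
  have htt : τ / 2 ≤ t * (1 - t) := by nlinarith
  have hconv : (t + (1 - t) * x) ^ m ≤ t + (1 - t) * x ^ m := by
    have := (convexOn_pow (𝕜 := ℝ) m).2 (show (1:ℝ) ∈ Ici 0 from mem_Ici.2 zero_le_one)
      (show x ∈ Ici 0 from hx.le) t0.le t1.le (by ring)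
    simpa using this
  have hprod : (1 + y) ^ m ≤ (t + (1 - t) / x) ^ m * (t + (1 - t) * x ^ m) := by
    have e : 1 + y = (t + (1 - t) / x) * (t + (1 - t) * x) := by
      rw [hy]; field_simp; ring
    rw [e, mul_pow]
    gcongr
  refine le_trans ?_ hprod
  rcases le_or_gt 2 x with h2 | h2
  · have hyx : τ * x / 8 ≤ y := by
      rw [hy, le_div_iff₀ hx]
      have : x ^ 2 / 4 ≤ (x - 1) ^ 2 := by nlinarith
      calc τ * x / 8 * x = τ / 2 * (x ^ 2 / 4) := by ring
        _ ≤ _ := by gcongr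
    have h1 : (1:ℝ) ^ m + y ^ m ≤ (1 + y) ^ m := pow_add_pow_le zero_le_one hy0 hm
    have h3 : (τ * x / 8) ^ m ≤ y ^ m := by gcongr
    have hxm : 1 ≤ x ^ m := one_le_pow₀ (by linarith)
    have h4 : phi (x ^ m - 1) ≤ x ^ m := by
      refine (min_le_left _ _).trans ?_
      rw [abs_of_nonneg (by linarith)]; linarith
    have h5 : 1 / (4 * (m:ℝ) ^ 2 * 8 ^ m) ≤ 1 / 8 ^ m := by
      apply one_div_le_one_div_of_le (by positivity)
      have : (1:ℝ) ≤ 4 * m ^ 2 := by nlinarith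
      nlinarith [pow_pos (show (0:ℝ) < 8 by norm_num) m]
    have h6 : 1 / (4 * (m:ℝ) ^ 2 * 8 ^ m) * τ ^ m * phi (x ^ m - 1) ≤ 1 / 8 ^ m * τ ^ m * x ^ m := by
      gcongr
      exact phi_nonneg _
    have h7 : 1 / 8 ^ m * τ ^ m * x ^ m = (τ * x / 8) ^ m := by
      rw [div_pow, mul_pow]; ring
    rw [one_pow] at h1
    linarith
  · have hyx : τ / 4 * (x - 1) ^ 2 ≤ y := by
      rw [hy, le_div_iff₀ hx]
      calc τ / 4 * (x - 1) ^ 2 * x ≤ τ / 4 * (x - 1) ^ 2 * 2 := by gcongr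
        _ = τ / 2 * (x - 1) ^ 2 := by ring
        _ ≤ _ := by gcongr
    have h1 : 1 + m * y ≤ (1 + y) ^ m := one_add_mul_le_pow (by linarith) m
    have h1' : y ≤ m * y := by nlinarith
    have h2' : |x ^ m - 1| ≤ |x - 1| * m * 2 ^ m := by
      have := abs_pow_sub_pow_le x 1 m
      rw [one_pow] at this
      refine this.trans ?_
      have : max |x| |1| ≤ 2 := by
        rw [abs_of_pos hx, abs_one]; exact max_le h2.le one_le_two
      gcongr
      calc max |x| |1| ^ (m - 1) ≤ 2 ^ (m - 1) := by gcongr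
        _ ≤ 2 ^ m := by gcongr <;> [norm_num; omega]
    have h3 : phi (x ^ m - 1) ≤ (x - 1) ^ 2 * m ^ 2 * 4 ^ m := by
      refine (min_le_right _ _).trans ?_
      rw [← sq_abs (x ^ m - 1), ← sq_abs (x - 1)]
      calc |x ^ m - 1| ^ 2 ≤ (|x - 1| * m * 2 ^ m) ^ 2 := by gcongr
        _ = _ := by rw [mul_pow, mul_pow, ← pow_mul, mul_comm m 2, pow_mul]; norm_num
    have h4 : τ ^ m ≤ τ := pow_le_of_le_one τ0.le (by linarith) hm
    have h48 : (4:ℝ) ^ m ≤ 8 ^ m := by gcongr; norm_num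
    have : 1 / (4 * (m:ℝ) ^ 2 * 8 ^ m) * τ ^ m * phi (x ^ m - 1) ≤ τ / 4 * (x - 1) ^ 2 := by
      calc _ ≤ 1 / (4 * (m:ℝ) ^ 2 * 8 ^ m) * τ * ((x - 1) ^ 2 * m ^ 2 * 8 ^ m) := by
            gcongr
            · exact phi_nonneg _
            · exact h3.trans (by gcongr)
        _ = _ := by field_simp
    linarith

lemma ptw (m : ℕ) (hm : m ≠ 0) {τ t p q : ℝ} (τ0 : 0 < τ) (τ1 : τ ≤ 1 / 2) (ht : τ ≤ t)
    (ht' : t ≤ 1 - τ) (hp : 0 < p) (hq : 0 < q) :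
    p ^ m * (1 + 1 / (4 * m ^ 2 * 8 ^ m) * τ ^ m * phi (p ^ m / q ^ m - 1)) ≤
      (t * p + (1 - t) * q) ^ m * (t + (1 - t) * (p ^ m / q ^ m)) := by
  have h := ptw_x m hm τ0 τ1 ht ht' (div_pos hp hq)
  rw [div_pow] at h
  have e : (t * p + (1 - t) * q) ^ m = p ^ m * (t + (1 - t) / (p / q)) ^ m := by
    rw [← mul_pow]; congr 1; field_simp
  rw [e, mul_assoc (p ^ m)]
  exact mul_le_mul_of_nonneg_left h (pow_nonneg hp.le m)

lemma transport {ρA ρB T : ℝ → ℝ} (hA : Integrable ρA) (hB : Integrable ρB)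
    (mA : Measurable ρA)
    (A0 : ∀ s, 0 ≤ ρA s) (B0 : ∀ s, 0 ≤ ρB s) (hT : Monotone T)
    (hpush : ∀ E : Set ℝ, MeasurableSet E → (∫ s in E, ρB s) = ∫ s in T ⁻¹' E, ρA s) :
    ∀ᵐ s, DifferentiableAt ℝ T s ∧ ρA s ≤ deriv T s * ρB (T s) := by
  have hd := hT.ae_differentiableAt
  have hpush' : ∀ E : Set ℝ, MeasurableSet E →
      ∫⁻ s in E, ENNReal.ofReal (ρB s) = ∫⁻ s in T ⁻¹' E, ENNReal.ofReal (ρA s) := by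
    intro E hE
    rw [← ofReal_integral_eq_lintegral_ofReal hB.integrableOn (Filter.Eventually.of_forall B0),
      ← ofReal_integral_eq_lintegral_ofReal hA.integrableOn (Filter.Eventually.of_forall A0),
      hpush E hE]
  set D := {s | DifferentiableAt ℝ T s} with hD
  have mD : MeasurableSet D := measurableSet_of_differentiableAt ℝ T
  have Dae : ∀ E : Set ℝ, (E ∩ D : Set ℝ) =ᵐ[volume] E := by
    intro E
    filter_upwards [hd] with s hs
    apply propext
    exact ⟨fun h => h.1, fun h => ⟨h, hs⟩⟩
  have key : (fun s => ENNReal.ofReal (ρA s)) ≤ᵐ[volume]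
      fun s => ENNReal.ofReal (deriv T s) * ENNReal.ofReal (ρB (T s)) := by
    apply ae_le_of_forall_setLIntegral_le_of_sigmaFinite mA.ennreal_ofReal
    intro E hE _
    rw [← setLIntegral_congr (Dae E),
      ← setLIntegral_congr (f := fun s => ENNReal.ofReal (deriv T s) * ENNReal.ofReal (ρB (T s))) (Dae E),
      ← lintegral_image_eq_lintegral_deriv_mul_of_monotoneOn (f := T) (f' := deriv T)
        (hE.inter mD) (fun x hx => hx.2.hasDerivAt.hasDerivWithinAt) (hT.monotoneOn _)
        (fun s => ENNReal.ofReal (ρB s)),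
      ← Measure.restrict_toMeasurable_of_sFinite (T '' (E ∩ D)), hpush' _ (measurableSet_toMeasurable _ _)]
    apply lintegral_mono_set
    intro s hs
    exact subset_toMeasurable _ _ ⟨s, hs, rfl⟩
  filter_upwards [hd, key] with s hs hk
  refine ⟨hs, ?_⟩
  rw [← ENNReal.ofReal_mul hT.deriv_nonneg] at hk
  exact (ENNReal.ofReal_le_ofReal_iff (mul_nonneg hT.deriv_nonneg (B0 _))).1 hk

section core
variable {X : Type*} [NormedAddCommGroup X] [NormedSpace ℝ X] [MeasureSpace X] [BorelSpace X]
  [SecondCountableTopology X] [IsFiniteMeasureOnCompacts (volume : Measure X)]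
  [SigmaFinite (volume : Measure X)]

lemma rho_props {A : Set (X × ℝ)} (hA : IsCompact A) (ha : 0 < (volume A).toReal) {ρ : ℝ → ℝ}
    (hρ : ρ = fun s => (volume (sl A s)).toReal / (volume A).toReal) :
    Measurable ρ ∧ (∀ s, 0 ≤ ρ s) ∧ Integrable ρ ∧ ∫ s, ρ s = 1 := by
  have hfin : ∫⁻ s, volume (sl A s) ≠ ∞ := by
    rw [sl_lintegral hA]; exact hA.measure_lt_top.ne
  have hi : Integrable fun s => (volume (sl A s)).toReal :=
    integrable_toReal_of_lintegral_ne_top (sl_meas hA).aemeasurable hfin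
  subst hρ
  refine ⟨(sl_meas hA).ennreal_toReal.div_const _, fun s => by positivity, hi.div_const _, ?_⟩
  rw [integral_div, integral_toReal (sl_meas hA).aemeasurable
    (Filter.Eventually.of_forall fun s => (sl_compact hA s).measure_lt_top), sl_lintegral hA]
  exact div_self ha.ne'

lemma core {m : ℕ} (hm : m ≠ 0) (hX : BMP X m) {A B : Set (X × ℝ)} (hA : IsCompact A)
    (hB : IsCompact B) {τ t δ : ℝ} (τ0 : 0 < τ) (τ1 : τ ≤ 1 / 2) (ht : τ ≤ t) (ht' : t ≤ 1 - τ)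
    {ρA ρB T : ℝ → ℝ}
    (hρA : ρA = fun s => (volume (sl A s)).toReal / (volume A).toReal)
    (hρB : ρB = fun s => (volume (sl B s)).toReal / (volume B).toReal)
    (hT : Monotone T)
    (hpush : ∀ E : Set ℝ, MeasurableSet E → (∫ s in E, ρB s) = ∫ s in T ⁻¹' E, ρA s)
    (hδ1 : δ < 1)
    (ha : 1 - δ ≤ (volume A).toReal) (hb : 1 - δ ≤ (volume B).toReal) :
    Integrable (fun s => phi (ρA s / ρB (T s) - 1) * ρA s) ∧
    (1 - δ) * (1 + 1 / (4 * m ^ 2 * 8 ^ m) * τ ^ m * ∫ s, phi (ρA s / ρB (T s) - 1) * ρA s) ≤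
      (volume (t • A + (1 - t) • B)).toReal := by
  have t0 : 0 < t := by linarith
  have t1 : 0 < 1 - t := by linarith
  have d1 : 0 < 1 - δ := by linarith
  have ha0 : 0 < (volume A).toReal := by linarith
  have hb0 : 0 < (volume B).toReal := by linarith
  obtain ⟨mA, A0, iA, intA⟩ := rho_props hA ha0 hρA
  obtain ⟨mB, B0, iB, intB⟩ := rho_props hB hb0 hρB
  have tr := transport iA iB mA A0 B0 hT hpush
  set S := t • A + (1 - t) • B with hSdef
  have hS : IsCompact S := (hA.smul _).add (hB.smul _)
  have hm0 : (0:ℝ) < m := by exact_mod_cast Nat.pos_of_ne_zero hm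
  set κ : ℝ := 1 / (4 * m ^ 2 * 8 ^ m) * τ ^ m with hκ
  have κ0 : 0 < κ := by positivity
  set R : ℝ → ℝ := fun s => t * s + (1 - t) * T s with hR
  have hRmono : Monotone R := fun x y hxy => by
    have := hT hxy
    simp only [hR]; gcongr
  set D := {s | DifferentiableAt ℝ T s} with hD
  have mD : MeasurableSet D := measurableSet_of_differentiableAt ℝ T
  have Dae : D =ᵐ[volume] univ := by
    filter_upwards [tr] with s hs
    exact propext ⟨fun _ => trivial, fun _ => hs.1⟩
  set Φ : ℝ → ℝ := fun s => phi (ρA s / ρB (T s) - 1) * ρA s with hΦ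
  have mphi : Measurable phi := by
    unfold phi; fun_prop
  have mΦ : Measurable Φ :=
    (mphi.comp ((mA.div (mB.comp hT.measurable)).sub_const 1)).mul mA
  have Φ0 : ∀ s, 0 ≤ Φ s := fun s => mul_nonneg (phi_nonneg _) (A0 s)
  have hcv : ∫⁻ s, ENNReal.ofReal (t + (1 - t) * deriv T s) * volume (sl S (R s)) ≤ volume S := by
    rw [← sl_lintegral hS, ← setLIntegral_univ, ← setLIntegral_congr Dae,
      ← lintegral_image_eq_lintegral_deriv_mul_of_monotoneOn (f := R)
        (f' := fun s => t + (1 - t) * deriv T s) mD ?_ (hRmono.monotoneOn _)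
        (fun s => volume (sl S s))]
    · exact setLIntegral_le_lintegral _ _
    · intro s hs
      have h1 : HasDerivAt T (deriv T s) s := DifferentiableAt.hasDerivAt hs
      have := ((hasDerivAt_id s).const_mul t).add (h1.const_mul (1 - t))
      simp only [mul_one] at this
      exact this.hasDerivWithinAt
  have hpt : ∀ᵐ s, ENNReal.ofReal ((1 - δ) * (ρA s + κ * Φ s)) ≤
      ENNReal.ofReal (t + (1 - t) * deriv T s) * volume (sl S (R s)) := by
    filter_upwards [tr] with s hs
    rcases (A0 s).eq_or_lt with h0 | hpos
    · have : Φ s = 0 := by simp [hΦ, ← h0]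
      simp [this, ← h0]
    · have hBpos : 0 < ρB (T s) := by
        rcases (B0 (T s)).eq_or_lt with h | h
        · rw [← h, mul_zero] at hs; linarith [hs.2]
        · exact h
      have hlam : ρA s / ρB (T s) ≤ deriv T s := (div_le_iff₀ hBpos).2 hs.2
      have hp := Real.rpow_inv_natCast_pow (A0 s) hm
      have hq := Real.rpow_inv_natCast_pow (B0 (T s)) hm
      have hc := Real.rpow_inv_natCast_pow d1.le hm
      set p := ρA s ^ ((m:ℝ)⁻¹)
      set q := ρB (T s) ^ ((m:ℝ)⁻¹)
      set c := (1 - δ) ^ ((m:ℝ)⁻¹)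
      have p0 : 0 < p := by positivity
      have q0 : 0 < q := by positivity
      have c0 : 0 < c := by positivity
      have hAs : ENNReal.ofReal ((c * p) ^ m) ≤ volume (sl A s) := by
        rw [ENNReal.ofReal_le_iff_le_toReal (sl_compact hA s).measure_lt_top.ne, mul_pow, hc, hp]
        have : (volume (sl A s)).toReal = (volume A).toReal * ρA s := by
          rw [hρA]; field_simp
        rw [this]; gcongr
      have hBs : ENNReal.ofReal ((c * q) ^ m) ≤ volume (sl B (T s)) := by
        rw [ENNReal.ofReal_le_iff_le_toReal (sl_compact hB _).measure_lt_top.ne, mul_pow, hc, hq]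
        have : (volume (sl B (T s))).toReal = (volume B).toReal * ρB (T s) := by
          rw [hρB]; field_simp
        rw [this]; gcongr
      have hbm := (hX t t0 (by linarith) _ _ (sl_compact hA s) (sl_compact hB (T s)) _ _
        (by positivity) (by positivity) hAs hBs).trans (measure_mono (sl_add A B t s (T s)))
      have hpw := ptw m hm τ0 τ1 ht ht' p0 q0
      rw [hp, hq, ← hκ] at hpw
      have dT : 0 ≤ deriv T s := hT.deriv_nonneg
      calc ENNReal.ofReal ((1 - δ) * (ρA s + κ * Φ s))
          ≤ ENNReal.ofReal ((t + (1 - t) * deriv T s) * (t * (c * p) + (1 - t) * (c * q)) ^ m) := by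
            apply ENNReal.ofReal_le_ofReal
            have e : (t * (c * p) + (1 - t) * (c * q)) ^ m = (1 - δ) * (t * p + (1 - t) * q) ^ m := by
              rw [← hc, ← mul_pow]; ring_nf
            rw [e]
            calc (1 - δ) * (ρA s + κ * Φ s)
                = (1 - δ) * (ρA s * (1 + κ * phi (ρA s / ρB (T s) - 1))) := by
                  simp only [hΦ]; ring
              _ ≤ (1 - δ) * ((t * p + (1 - t) * q) ^ m * (t + (1 - t) * (ρA s / ρB (T s)))) := by
                  exact mul_le_mul_of_nonneg_left hpw d1.le
              _ ≤ (1 - δ) * ((t * p + (1 - t) * q) ^ m * (t + (1 - t) * deriv T s)) := by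
                  gcongr
              _ = _ := by ring
        _ = ENNReal.ofReal (t + (1 - t) * deriv T s) *
              ENNReal.ofReal ((t * (c * p) + (1 - t) * (c * q)) ^ m) :=
            ENNReal.ofReal_mul (by positivity)
        _ ≤ _ := by gcongr
  have hle := (lintegral_mono_ae hpt).trans hcv
  have mG : Measurable fun s => (1 - δ) * (ρA s + κ * Φ s) := (mA.add (mΦ.const_mul κ)).const_mul _
  have G0 : ∀ s, 0 ≤ (1 - δ) * (ρA s + κ * Φ s) := fun s =>
    mul_nonneg d1.le (add_nonneg (A0 s) (mul_nonneg κ0.le (Φ0 s)))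
  have Stop : volume S ≠ ∞ := hS.measure_lt_top.ne
  have iG : Integrable fun s => (1 - δ) * (ρA s + κ * Φ s) := by
    refine ⟨mG.aestronglyMeasurable, ?_⟩
    rw [hasFiniteIntegral_iff_ofReal (Filter.Eventually.of_forall G0)]
    exact hle.trans_lt Stop.lt_top
  have iΦ : Integrable Φ := by
    refine (iG.const_mul ((1 - δ) * κ)⁻¹).mono mΦ.aestronglyMeasurable
      (Filter.Eventually.of_forall fun s => ?_)
    rw [Real.norm_of_nonneg (Φ0 s), Real.norm_of_nonneg (mul_nonneg (by positivity) (G0 s))]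
    rw [← div_eq_inv_mul, le_div_iff₀ (by positivity)]
    nlinarith [mul_nonneg d1.le (A0 s)]
  refine ⟨iΦ, ?_⟩
  have e : ∫ s, (1 - δ) * (ρA s + κ * Φ s) = (1 - δ) * (1 + κ * ∫ s, Φ s) := by
    rw [integral_const_mul, integral_add iA (iΦ.const_mul κ), integral_const_mul, intA]
  rw [← e, ← ENNReal.ofReal_le_iff_le_toReal Stop,
    ofReal_integral_eq_lintegral_ofReal iG (Filter.Eventually.of_forall G0)]
  exact hle

end core

/-- Lemma `BM n n-1`, second part: if moreover
`||A|-1| + ||B|-1| + ||S|-1| ≤ δ` with `t ∈ [τ, 1-τ]` and `δ/τⁿ` sufficiently small, then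
`∫ |ρ_A(s)/ρ_B(T(s)) - 1| ρ_A(s) ds ≤ C(n) τ^{-n/2} δ^{1/2}`. -/
theorem statement10 (n : ℕ) (hn : 2 ≤ n) :
    ∃ C c : ℝ, 0 < C ∧ 0 < c ∧
      ∀ (A B : Set (EuclideanSpace ℝ (Fin (n - 1)) × ℝ)) (τ t δ : ℝ)
        (ρA ρB : ℝ → ℝ) (T : ℝ → ℝ),
        IsCompact A → IsCompact B →
        0 < τ → τ ≤ 1 / 2 → t ∈ Set.Icc τ (1 - τ) →
        ρA = (fun s => (volume (vslice A s)).toReal / (volume A).toReal) →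
        ρB = (fun s => (volume (vslice B s)).toReal / (volume B).toReal) →
        Monotone T →
        (∀ E : Set ℝ, MeasurableSet E →
          (∫ s in E, ρB s) = ∫ s in T ⁻¹' E, ρA s) →
        |(volume A).toReal - 1| + |(volume B).toReal - 1| +
          |(volume (t • A + (1 - t) • B)).toReal - 1| ≤ δ →
        δ / τ ^ n ≤ c →
        (∫ s : ℝ, |ρA s / ρB (T s) - 1| * ρA s) ≤
          C * τ ^ (-(n : ℝ) / 2) * δ ^ ((1 : ℝ) / 2) := by
  obtain ⟨k, rfl⟩ : ∃ k, n = k + 1 + 1 := ⟨n - 2, by omega⟩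
  set K : ℝ := 4 * ((k + 1 : ℕ) : ℝ) ^ 2 * 8 ^ (k + 1) with hK
  have K0 : 0 < K := by positivity
  refine ⟨1 + 4 * K, 1 / 4, by positivity, by norm_num, ?_⟩
  intro A B τ t δ ρA ρB T hA hB τ0 τ1 ht hρA hρB hT hpush hδ hc
  have hτn : 0 < τ ^ (k + 1 + 1) := by positivity
  have hδ0 : 0 ≤ δ := le_trans (by positivity) hδ
  have hτ1 : τ ^ (k + 1 + 1) ≤ 1 := pow_le_one₀ τ0.le (by linarith)
  have hδ4 : δ ≤ 1 / 4 := by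
    rw [div_le_iff₀ hτn] at hc; linarith
  set VA := (volume A).toReal
  set VB := (volume B).toReal
  set VS := (volume (t • A + (1 - t) • B)).toReal
  have ha : 1 - δ ≤ VA := by
    linarith [neg_abs_le (VA - 1), abs_nonneg (VB - 1), abs_nonneg (VS - 1)]
  have hb : 1 - δ ≤ VB := by
    linarith [neg_abs_le (VB - 1), abs_nonneg (VA - 1), abs_nonneg (VS - 1)]
  have hs : VS ≤ 1 + δ := by
    linarith [le_abs_self (VS - 1), abs_nonneg (VA - 1), abs_nonneg (VB - 1)]
  obtain ⟨iΦ, hcore⟩ := core (m := k + 1) (Nat.succ_ne_zero k) (BMP_euc k) hA hB τ0 τ1 ht.1 ht.2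
    (ρA := ρA) (ρB := ρB) (T := T) hρA hρB hT hpush (by linarith) ha hb
  obtain ⟨mA, A0, iA, intA⟩ := rho_props (X := EuclideanSpace ℝ (Fin (k + 1))) hA
    (by linarith : 0 < VA) (ρ := ρA) hρA
  set J := ∫ s, phi (ρA s / ρB (T s) - 1) * ρA s with hJ
  have J0 : 0 ≤ J := integral_nonneg fun s => mul_nonneg (phi_nonneg _) (A0 s)
  rw [← hK] at hcore
  set ε := δ / τ ^ (k + 1 + 1) with hε
  have ε0 : 0 ≤ ε := by positivity
  have hJε : J ≤ 4 * K * ε := by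
    set w := 1 / K * τ ^ (k + 1) * J with hw
    have w0 : 0 ≤ w := by positivity
    have h1 : w ≤ 4 * δ := by
      have : VS ≤ 1 + δ := hs
      nlinarith
    have h2 : J * τ ^ (k + 1) ≤ 4 * K * δ := by
      have : J * τ ^ (k + 1) = K * w := by rw [hw]; field_simp
      rw [this]; nlinarith
    have h3 : τ ^ (k + 1 + 1) ≤ τ ^ (k + 1) := pow_le_pow_of_le_one τ0.le (by linarith) (by omega)
    rw [hε, ← mul_div_assoc, le_div_iff₀ hτn]
    exact (mul_le_mul_of_nonneg_left h3 J0).trans h2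
  have hI : ∀ η : ℝ, 0 < η → η ≤ 1 →
      (∫ s : ℝ, |ρA s / ρB (T s) - 1| * ρA s) ≤ η + J / η := by
    intro η η0 η1
    calc (∫ s : ℝ, |ρA s / ρB (T s) - 1| * ρA s)
        ≤ ∫ s : ℝ, (η * ρA s + (phi (ρA s / ρB (T s) - 1) * ρA s) / η) := by
          apply integral_mono_of_nonneg
          · exact Filter.Eventually.of_forall fun s => mul_nonneg (abs_nonneg _) (A0 s)
          · exact (iA.const_mul η).add (iΦ.div_const η)
          · refine Filter.Eventually.of_forall fun s => ?_
            have := mul_le_mul_of_nonneg_right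
              (abs_le_phi (z := ρA s / ρB (T s) - 1) η0 η1) (A0 s)
            refine this.trans (le_of_eq ?_)
            ring
      _ = η + J / η := by
          rw [integral_add (iA.const_mul η) (iΦ.div_const η), integral_const_mul, intA,
            integral_div, mul_one]
  have hfin : τ ^ (-((k + 1 + 1 : ℕ) : ℝ) / 2) * δ ^ ((1 : ℝ) / 2) = √ε := by
    rw [hε, Real.sqrt_div hδ0, Real.sqrt_eq_rpow, Real.sqrt_eq_rpow, ← Real.rpow_natCast,
      ← Real.rpow_mul τ0.le, div_eq_mul_inv (δ ^ ((1 : ℝ) / 2)), ← Real.rpow_neg τ0.le, mul_comm]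
    congr 2
    ring
  rw [mul_assoc, hfin]
  rcases ε0.eq_or_lt with h | h
  · rw [← h, Real.sqrt_zero, mul_zero]
    have J00 : J = 0 := le_antisymm (by simpa [← h] using hJε) J0
    apply le_of_forall_pos_le_add
    intro η η0
    have := hI (min η 1) (by positivity) (min_le_right _ _)
    rw [J00, zero_div] at this
    linarith [min_le_left η 1]
  · have s0 : 0 < √ε := Real.sqrt_pos.2 h
    have s1 : √ε ≤ 1 := by rw [Real.sqrt_le_left zero_le_one]; linarith
    refine (hI _ s0 s1).trans ?_
    have : J / √ε ≤ 4 * K * √ε := by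
      rw [div_le_iff₀ s0, mul_assoc, Real.mul_self_sqrt ε0]; exact hJε
    linarith
end

section
/- Let n ≥ 2, let A, B ⊆ ℝⁿ be compact sets with |A|, |B| > 0, let t ∈ (0, 1), and set S := tA + (1 − t)B. Define ρ_A(s) := H^{n−1}(A(s))/|A|, ρ_B(s) := H^{n−1}(B(s))/|B|, let T : ℝ → ℝ be the monotone (increasing) rearrangement pushing ρ_A(s) ds forward to ρ_B(s) ds, and define μ₁(s) = ⋯ = μ_{n−1}(s) := ((1−t)/t) · (|B| ρ_B(T(s)))^{1/(n−1)} / (|A| ρ_A(s))^{1/(n−1)} and μ_n(s) := ((1−t)/t) · ρ_A(s)/ρ_B(T(s)). Then there exists a constant c(n) > 0 depending only on n such that |S| − (t|A|^{1/n} + (1 − t)|B|^{1/n})^n ≥ c(n) |A| tⁿ ∫_ℝ (1/max_i μ_i(s)) · Σ_{j=1}^n (μ_j(s) − ((1−t)/t)(|B|/|A|)^{1/n})² ρ_A(s) ds. -/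
open MeasureTheory Set Pointwise
open scoped ENNReal

lemma tangent_log {z w : ℝ} (hz : 0 < z) (hw : 0 < w) :
    w * (Real.log z - Real.log w) ≤ z - w := by
  have h := Real.log_le_sub_one_of_pos (div_pos hz hw)
  rw [Real.log_div hz.ne' hw.ne'] at h
  calc w * (Real.log z - Real.log w) ≤ w * (z / w - 1) := by gcongr
    _ = z - w := by field_simp

lemma log_stab {z L M : ℝ} (hz : 0 < z) (hL : 0 < L) (hzM : z ≤ M) (hLM : L ≤ M) :
    L * (Real.log z - Real.log L) ≤ (z - L) - (z - L) ^ 2 / (4 * M) := by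
  obtain ⟨a, ha, rfl⟩ : ∃ a : ℝ, 0 < a ∧ z = a ^ 2 :=
    ⟨√z, Real.sqrt_pos.2 hz, (Real.sq_sqrt hz.le).symm⟩
  obtain ⟨b, hb, rfl⟩ : ∃ a : ℝ, 0 < a ∧ L = a ^ 2 :=
    ⟨√L, Real.sqrt_pos.2 hL, (Real.sq_sqrt hL.le).symm⟩
  have hM : 0 < M := lt_of_lt_of_le hz hzM
  have h := tangent_log ha hb
  rw [Real.log_pow, Real.log_pow]
  have h2 : (a ^ 2 - b ^ 2) ^ 2 / (4 * M) ≤ (a - b) ^ 2 := by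
    rw [div_le_iff₀ (by positivity)]
    have : (a + b) ^ 2 ≤ 4 * M := by nlinarith [sq_nonneg (a - b)]
    nlinarith [mul_le_mul_of_nonneg_left this (sq_nonneg (a - b))]
  push_cast
  nlinarith [mul_le_mul_of_nonneg_left h hb.le]

lemma amgm_stab (k : ℕ) {x y L M : ℝ} (hx : 0 < x) (hy : 0 < y) (hL : 0 < L)
    (hxM : x ≤ M) (hyM : y ≤ M) (hLM : L ≤ M) (h : x ^ k * y = L ^ (k + 1)) :
    (k * (x - L) ^ 2 + (y - L) ^ 2) / (4 * M) ≤ k * x + y - (k + 1) * L := by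
  have hlog : k * (Real.log x - Real.log L) + (Real.log y - Real.log L) = 0 := by
    have := congrArg Real.log h
    rw [Real.log_mul (by positivity) hy.ne', Real.log_pow, Real.log_pow] at this
    push_cast at this
    linarith
  have h1 := log_stab hx hL hxM hLM
  have h2 := log_stab hy hL hyM hLM
  have h3 := mul_le_mul_of_nonneg_left h1 (Nat.cast_nonneg (α := ℝ) k)
  have h4 : L * (k * (Real.log x - Real.log L) + (Real.log y - Real.log L)) = 0 := by
    rw [hlog, mul_zero]
  rw [add_div, mul_div_assoc]
  nlinarith

lemma expand_ge (k : ℕ) {x y L : ℝ} (hx : 0 < x) (hy : 0 < y) (hL : 0 < L)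
    (h : x ^ k * y = L ^ (k + 1)) :
    k * x + y - (k + 1) * L ≤ (1 + x) ^ k * (1 + y) - (1 + L) ^ (k + 1) := by
  have hlog : k * (Real.log x - Real.log L) + (Real.log y - Real.log L) = 0 := by
    have := congrArg Real.log h
    rw [Real.log_mul (by positivity) hy.ne', Real.log_pow, Real.log_pow] at this
    push_cast at this
    linarith
  have e0 : ∀ z : ℝ, (1 + z) ^ k = ∑ j ∈ Finset.range (k + 1), (k.choose j : ℝ) * z ^ j := by
    intro z
    rw [add_comm, add_pow]
    refine Finset.sum_congr rfl fun j _ => ?_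
    simp [mul_comm]
  have e1 : ∀ z : ℝ, (1 + z) ^ k
      = 1 + ∑ j ∈ Finset.range (k + 1), (k.choose (j + 1) : ℝ) * z ^ (j + 1) := by
    intro z
    rw [e0, Finset.sum_range_succ', Finset.sum_range_succ]
    simp [add_comm]
  have e2 : (1 + x) ^ k * (1 + y) - (1 + L) ^ (k + 1)
      = ∑ j ∈ Finset.range (k + 1), ((k.choose (j + 1) : ℝ) * (x ^ (j + 1) - L ^ (j + 1))
          + (k.choose j : ℝ) * (x ^ j * y - L ^ (j + 1))) := by
    have a1 : (1 + x) ^ k * (1 + y) - (1 + L) ^ (k + 1)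
      = (1 + x) ^ k - (1 + L) ^ k + ((1 + x) ^ k * y - (1 + L) ^ k * L) := by ring
    rw [a1]
    nth_rewrite 1 [e1 x]
    nth_rewrite 1 [e1 L]
    rw [e0 x, e0 L, add_sub_add_left_eq_sub, Finset.sum_mul, Finset.sum_mul,
      ← Finset.sum_sub_distrib, ← Finset.sum_sub_distrib, ← Finset.sum_add_distrib]
    refine Finset.sum_congr rfl fun j _ => ?_
    ring
  rw [e2]
  have hnn : ∀ j ∈ Finset.range (k + 1), 0 ≤ ((k.choose (j + 1) : ℝ) * (x ^ (j + 1) - L ^ (j + 1))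
          + (k.choose j : ℝ) * (x ^ j * y - L ^ (j + 1))) := by
    intro j hj
    have hjk : j ≤ k := by simpa [Nat.lt_succ_iff] using hj
    have t1 := tangent_log (z := x ^ (j + 1)) (w := L ^ (j + 1)) (by positivity) (by positivity)
    have t2 := tangent_log (z := x ^ j * y) (w := L ^ (j + 1)) (by positivity) (by positivity)
    rw [Real.log_mul (by positivity) hy.ne', Real.log_pow, Real.log_pow] at t2
    rw [Real.log_pow, Real.log_pow] at t1
    push_cast at t1 t2
    have hc : (k.choose (j + 1) : ℝ) * (j + 1) = k.choose j * (k - j) := by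
      have := Nat.choose_succ_right_eq k j
      rw [← Nat.cast_sub hjk]
      exact_mod_cast this
    have t1' := mul_le_mul_of_nonneg_left t1 (Nat.cast_nonneg (α := ℝ) (k.choose (j + 1)))
    have t2' := mul_le_mul_of_nonneg_left t2 (Nat.cast_nonneg (α := ℝ) (k.choose j))
    refine le_trans (le_of_eq ?_) (add_le_add t1' t2')
    have hly : Real.log y = Real.log L - k * (Real.log x - Real.log L) := by linarith
    rw [hly]
    linear_combination (-(L ^ (j + 1) * (Real.log x - Real.log L))) * hc
  refine le_trans (le_of_eq ?_) (Finset.single_le_sum hnn (Finset.mem_range.2 (Nat.succ_pos k)))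
  simp
  ring

lemma pointwise_ge (k : ℕ) {x y L : ℝ} (hx : 0 < x) (hy : 0 < y) (hL : 0 < L)
    (h : x ^ k * y = L ^ (k + 1)) :
    (1 + L) ^ (k + 1) + 1 / 4 * (1 / max x y * (k * (x - L) ^ 2 + (y - L) ^ 2))
      ≤ (1 + x) ^ k * (1 + y) := by
  have hM : 0 < max x y := lt_max_of_lt_left hx
  have hLM : L ≤ max x y := by
    refine le_of_pow_le_pow_left₀ (Nat.succ_ne_zero k) hM.le ?_
    rw [← h, pow_succ]
    gcongr
    · exact le_max_left _ _
    · exact le_max_right _ _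
  have h1 := amgm_stab k hx hy hL (le_max_left x y) (le_max_right x y) hLM h
  have h2 := expand_ge k hx hy hL h
  have : (k * (x - L) ^ 2 + (y - L) ^ 2) / (4 * max x y)
    = 1 / 4 * (1 / max x y * (k * (x - L) ^ 2 + (y - L) ^ 2)) := by
    field_simp
  linarith

lemma deriv_T (f g : ℝ → ℝ≥0∞) (hf : Measurable f) (hg : Measurable g)
    (hff : ∀ s, f s ≠ ∞)
    [IsProbabilityMeasure (volume.withDensity f)] [IsProbabilityMeasure (volume.withDensity g)]
    (T : ℝ → ℝ) (hT : Monotone T)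
    (hmap : (volume.withDensity f).map T = volume.withDensity g) :
    ∀ᵐ s, f s ≠ 0 → (g (T s)).toReal ≠ 0 ∧
      HasDerivAt T ((f s).toReal / (g (T s)).toReal) s := by
  set μ := volume.withDensity f with hμ
  set ν := volume.withDensity g with hν
  have hTm : Measurable T := hT.measurable
  have hμa : ∀ x, μ {x} = 0 := fun x =>
    withDensity_absolutelyContinuous _ _ (by simp)
  have hνa : ∀ x, ν {x} = 0 := fun x =>
    withDensity_absolutelyContinuous _ _ (by simp)
  have hcomp : ∀ x, ProbabilityTheory.cdf ν (T x) = ProbabilityTheory.cdf μ x := by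
    intro x
    rw [ProbabilityTheory.cdf_eq_real, ProbabilityTheory.cdf_eq_real]
    unfold Measure.real
    congr 1
    apply le_antisymm
    · have h1 : ν (Iic (T x)) = ν (Iio (T x)) := by
        rw [← Iio_union_right]
        refine le_antisymm ((measure_union_le _ _).trans (by rw [hνa]; simp)) (measure_mono subset_union_left)
      rw [h1, ← hmap, Measure.map_apply hTm measurableSet_Iio]
      refine measure_mono fun z hz => ?_
      by_contra hzx
      simp only [mem_Iic, not_le] at hzx
      exact absurd (hT hzx.le) (not_le.2 hz)
    · rw [← hmap, Measure.map_apply hTm measurableSet_Iic]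
      exact measure_mono fun z hz => hT hz
  have dA : ∀ᵐ x, HasDerivAt (ProbabilityTheory.cdf μ) (f x).toReal x := by
    have h1 := (ProbabilityTheory.cdf μ).ae_hasDerivAt
    rw [ProbabilityTheory.measure_cdf] at h1
    have h2 := Measure.rnDeriv_withDensity volume hf
    filter_upwards [h1, h2] with x hx1 hx2
    rwa [hμ, hx2] at hx1
  have dB : ∀ᵐ x, HasDerivAt (ProbabilityTheory.cdf ν) (g x).toReal x := by
    have h1 := (ProbabilityTheory.cdf ν).ae_hasDerivAt
    rw [ProbabilityTheory.measure_cdf] at h1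
    have h2 := Measure.rnDeriv_withDensity volume hg
    filter_upwards [h1, h2] with x hx1 hx2
    rwa [hν, hx2] at hx1
  have dB' : ∀ᵐ s, f s ≠ 0 → HasDerivAt (ProbabilityTheory.cdf ν) (g (T s)).toReal (T s) := by
    rw [← ae_withDensity_iff hf]
    have h1 : ∀ᵐ x ∂ν, HasDerivAt (ProbabilityTheory.cdf ν) (g x).toReal x :=
      (withDensity_absolutelyContinuous _ _).ae_le dB
    rw [← hmap] at h1
    have := ae_of_ae_map hTm.aemeasurable h1
    rwa [hmap] at this
  filter_upwards [dA, dB', hT.ae_differentiableAt] with s h1 h2 h3 hs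
  have h2 := h2 hs
  have hc := h2.comp s h3.hasDerivAt
  have he : (ProbabilityTheory.cdf ν) ∘ T = ProbabilityTheory.cdf μ := funext hcomp
  rw [he] at hc
  have hu := hc.unique h1
  have hpos : (f s).toReal ≠ 0 := by simp [ENNReal.toReal_eq_zero_iff, hs, hff]
  have hg0 : (g (T s)).toReal ≠ 0 := by
    intro h0; rw [h0, zero_mul] at hu; exact hpos hu.symm
  refine ⟨hg0, ?_⟩
  have : (f s).toReal / (g (T s)).toReal = deriv T s := by
    rw [← hu]; field_simp
  rw [this]
  exact h3.hasDerivAt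

/-- The Brunn-Minkowski inequality for compact sets of positive measure, exponent `k`. -/
def BMprop (E : Type) [AddCommGroup E] [Module ℝ E] [TopologicalSpace E] [MeasureSpace E]
    (k : ℕ) : Prop :=
  ∀ (A B : Set E) (t : ℝ), IsCompact A → IsCompact B → 0 < volume A → 0 < volume B →
    t ∈ Set.Ioo (0 : ℝ) 1 →
    (t * (volume A).toReal ^ (1 / (k : ℝ)) + (1 - t) * (volume B).toReal ^ (1 / (k : ℝ))) ^ k
      ≤ (volume (t • A + (1 - t) • B)).toReal

section slices
variable {k : ℕ}

lemma vslice_compact {A : Set (EuclideanSpace ℝ (Fin k) × ℝ)} (hA : IsCompact A) (s : ℝ) :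
    IsCompact (vslice A s) := by
  have : vslice A s = Prod.fst '' (A ∩ Prod.snd ⁻¹' {s}) := by
    ext y
    simp [vslice]
  rw [this]
  exact (hA.inter_right (isClosed_singleton.preimage continuous_snd)).image continuous_fst

/-- The slice density. -/
noncomputable def sdens (A : Set (EuclideanSpace ℝ (Fin k) × ℝ)) (s : ℝ) : ℝ≥0∞ :=
  volume (vslice A s) / volume A

lemma vol_eq_slices {A : Set (EuclideanSpace ℝ (Fin k) × ℝ)} (hA : IsCompact A) :
    volume A = ∫⁻ s, volume (vslice A s) := by
  rw [Measure.volume_eq_prod, Measure.prod_apply_symm hA.measurableSet]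
  rfl

lemma meas_slices {A : Set (EuclideanSpace ℝ (Fin k) × ℝ)} (hA : IsCompact A) :
    Measurable fun s => volume (vslice A s) :=
  measurable_measure_prodMk_right hA.measurableSet

lemma meas_sdens {A : Set (EuclideanSpace ℝ (Fin k) × ℝ)} (hA : IsCompact A) :
    Measurable (sdens A) := (meas_slices hA).div_const _

lemma sdens_ne_top {A : Set (EuclideanSpace ℝ (Fin k) × ℝ)} (hA : IsCompact A)
    (h0 : 0 < volume A) (s : ℝ) : sdens A s ≠ ∞ :=
  ENNReal.div_ne_top (vslice_compact hA s).measure_lt_top.ne h0.ne'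

lemma lintegral_sdens {A : Set (EuclideanSpace ℝ (Fin k) × ℝ)} (hA : IsCompact A)
    (h0 : 0 < volume A) : ∫⁻ s, sdens A s = 1 := by
  simp only [sdens, div_eq_mul_inv]
  rw [lintegral_mul_const _ (meas_slices hA), ← vol_eq_slices hA]
  exact ENNReal.mul_inv_cancel h0.ne' hA.measure_lt_top.ne

lemma prob_sdens {A : Set (EuclideanSpace ℝ (Fin k) × ℝ)} (hA : IsCompact A)
    (h0 : 0 < volume A) : IsProbabilityMeasure (volume.withDensity (sdens A)) :=
  ⟨by rw [withDensity_apply _ MeasurableSet.univ, Measure.restrict_univ, lintegral_sdens hA h0]⟩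

lemma slice_sum_subset (A B : Set (EuclideanSpace ℝ (Fin k) × ℝ)) (t s r : ℝ) :
    t • vslice A s + (1 - t) • vslice B r ⊆ vslice (t • A + (1 - t) • B) (t * s + (1 - t) * r) := by
  rintro _ ⟨_, ⟨y, hy, rfl⟩, _, ⟨z, hz, rfl⟩, rfl⟩
  exact ⟨_, ⟨(y, s), hy, rfl⟩, _, ⟨(z, r), hz, rfl⟩, rfl⟩

lemma key_lintegral (hk : 1 ≤ k) (hBM : BMprop (EuclideanSpace ℝ (Fin k)) k)
    {A B : Set (EuclideanSpace ℝ (Fin k) × ℝ)} {t : ℝ} (hA : IsCompact A) (hB : IsCompact B)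
    (hA0 : 0 < volume A) (hB0 : 0 < volume B) (ht : t ∈ Set.Ioo (0 : ℝ) 1)
    {T : ℝ → ℝ} (hT : Monotone T)
    (hmap : (volume.withDensity (sdens A)).map T = volume.withDensity (sdens B))
    (μ₁ μₙ : ℝ → ℝ) (L : ℝ)
    (hμ₁ : μ₁ = (fun s => (1 - t) / t *
          (((volume B).toReal * (sdens B (T s)).toReal) ^ (1 / (k : ℝ)) /
            ((volume A).toReal * (sdens A s).toReal) ^ (1 / (k : ℝ)))))
    (hμₙ : μₙ = (fun s => (1 - t) / t * ((sdens A s).toReal / (sdens B (T s)).toReal)))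
    (hL : L = (1 - t) / t * ((volume B).toReal / (volume A).toReal) ^ (1 / ((k : ℝ) + 1))) :
    ∫⁻ s, ENNReal.ofReal (t ^ (k + 1) * (volume A).toReal * (sdens A s).toReal *
      ((1 + L) ^ (k + 1) + 1 / 4 * (1 / max (μ₁ s) (μₙ s) *
        (k * (μ₁ s - L) ^ 2 + (μₙ s - L) ^ 2)))) ≤ volume (t • A + (1 - t) • B) := by
  obtain ⟨ht0, ht1⟩ := ht
  have ht1' : 0 < 1 - t := by linarith
  have := prob_sdens hA hA0
  have := prob_sdens hB hB0
  have hS : IsCompact (t • A + (1 - t) • B) := (hA.smul t).add (hB.smul (1 - t))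
  set VA := (volume A).toReal with hVA
  set VB := (volume B).toReal with hVB
  have hVA0 : 0 < VA := ENNReal.toReal_pos hA0.ne' hA.measure_lt_top.ne
  have hVB0 : 0 < VB := ENNReal.toReal_pos hB0.ne' hB.measure_lt_top.ne
  have hL0 : 0 < L := by rw [hL]; positivity
  have hd := deriv_T (sdens A) (sdens B) (meas_sdens hA) (meas_sdens hB) (sdens_ne_top hA hA0)
    T hT hmap
  obtain ⟨N, hN, hNm, hN0⟩ := exists_measurable_superset_of_null (ae_iff.1 hd)
  set G : Set ℝ := {s | sdens A s ≠ 0} \ N with hG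
  have hGm : MeasurableSet G :=
    ((meas_sdens hA) (measurableSet_singleton 0).compl).diff hNm
  have hGd : ∀ s ∈ G, sdens A s ≠ 0 ∧ (sdens B (T s)).toReal ≠ 0 ∧
      HasDerivAt T ((sdens A s).toReal / (sdens B (T s)).toReal) s := by
    rintro s ⟨hs, hsN⟩
    by_contra hcon
    apply hsN
    apply hN
    intro hc
    exact hcon ⟨hs, hc hs⟩
  set F : ℝ → ℝ := fun s => t * s + (1 - t) * T s with hF
  have hFmono : StrictMono F := by
    intro a b hab
    have h1 := mul_lt_mul_of_pos_left hab ht0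
    have h2 := mul_le_mul_of_nonneg_left (hT hab.le) ht1'.le
    simp only [hF]; linarith
  have hFd : ∀ s ∈ G, HasDerivWithinAt F
      (t + (1 - t) * ((sdens A s).toReal / (sdens B (T s)).toReal)) G s := by
    intro s hs
    have h1 := ((hasDerivAt_id s).const_mul t).add ((hGd s hs).2.2.const_mul (1 - t))
    rw [mul_one] at h1
    exact h1.hasDerivWithinAt
  have hcv := lintegral_image_eq_lintegral_abs_deriv_mul hGm hFd hFmono.injective.injOn
    (fun σ => volume (vslice (t • A + (1 - t) • B) σ))
  have hle : ∫⁻ s in G, ENNReal.ofReal |t + (1 - t) * ((sdens A s).toReal / (sdens B (T s)).toReal)|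
      * volume (vslice (t • A + (1 - t) • B) (F s)) ≤ volume (t • A + (1 - t) • B) := by
    rw [← hcv, vol_eq_slices hS]
    exact setLIntegral_le_lintegral _ _
  refine le_trans ?_ hle
  rw [← lintegral_indicator hGm]
  have hNae : ∀ᵐ s, s ∉ N := measure_eq_zero_iff_ae_notMem.1 hN0
  refine lintegral_mono_ae ?_
  filter_upwards [hNae] with s hsN
  by_cases hs0 : sdens A s = 0
  · simp [hs0]
  have hsG : s ∈ G := ⟨hs0, hsN⟩
  rw [indicator_of_mem hsG]
  obtain ⟨-, hb0, -⟩ := hGd s hsG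
  have ha0 : 0 < (sdens A s).toReal := ENNReal.toReal_pos hs0 (sdens_ne_top hA hA0 s)
  have hb0 : 0 < (sdens B (T s)).toReal := lt_of_le_of_ne ENNReal.toReal_nonneg hb0.symm
  set a := (sdens A s).toReal with ha
  set b := (sdens B (T s)).toReal with hb
  have hva : (volume (vslice A s)).toReal = VA * a := by
    rw [ha, sdens, ENNReal.toReal_div, ← hVA]; field_simp
  have hvb : (volume (vslice B (T s))).toReal = VB * b := by
    rw [hb, sdens, ENNReal.toReal_div, ← hVB]; field_simp
  have hbm := hBM (vslice A s) (vslice B (T s)) t (vslice_compact hA s) (vslice_compact hB (T s))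
    (by
      rw [pos_iff_ne_zero]; intro h0; rw [h0] at hva
      have : 0 < VA * a := by positivity
      simp at hva; grind)
    (by
      rw [pos_iff_ne_zero]; intro h0; rw [h0] at hvb
      have : 0 < VB * b := by positivity
      simp at hvb; grind) ⟨ht0, ht1⟩
  rw [hva, hvb] at hbm
  have hfin : volume (vslice (t • A + (1 - t) • B) (F s)) ≠ ∞ :=
    (vslice_compact hS _).measure_lt_top.ne
  have hbm2 := hbm.trans (ENNReal.toReal_mono hfin (measure_mono (slice_sum_subset A B t s (T s))))
  have hD : 0 < t + (1 - t) * (a / b) := by positivity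
  rw [abs_of_pos hD, ← ENNReal.ofReal_toReal hfin, ← ENNReal.ofReal_mul hD.le]
  apply ENNReal.ofReal_le_ofReal
  refine le_trans ?_ (mul_le_mul_of_nonneg_left hbm2 hD.le)
  have hk0 : (k : ℝ) ≠ 0 := by positivity
  have hpk : ∀ z : ℝ, 0 ≤ z → (z ^ (1 / (k : ℝ))) ^ k = z := by
    intro z hz
    rw [one_div]
    exact Real.rpow_inv_natCast_pow hz (by omega)
  set α := (VA * a) ^ (1 / (k : ℝ)) with hα
  set β := (VB * b) ^ (1 / (k : ℝ)) with hβ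
  have hα0 : 0 < α := by positivity
  have hβ0 : 0 < β := by positivity
  have hαk : α ^ k = VA * a := hpk _ (by positivity)
  have hβk : β ^ k = VB * b := hpk _ (by positivity)
  have hm1 : μ₁ s = (1 - t) / t * (β / α) := by rw [hμ₁]
  have hmn : μₙ s = (1 - t) / t * (a / b) := by rw [hμₙ]
  have hLk : L ^ (k + 1) = ((1 - t) / t) ^ (k + 1) * (VB / VA) := by
    rw [hL, mul_pow]
    congr 1
    have := Real.rpow_inv_natCast_pow (x := VB / VA) (n := k + 1) (by positivity) (by omega)
    push_cast at this
    rw [one_div]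
    exact this
  have hprod : (μ₁ s) ^ k * μₙ s = L ^ (k + 1) := by
    rw [hm1, hmn, hLk, mul_pow, div_pow β, hαk, hβk, pow_succ]
    generalize (1 - t) / t = q
    field_simp
  have hpw := pointwise_ge k (x := μ₁ s) (y := μₙ s) (by rw [hm1]; positivity)
    (by rw [hmn]; positivity) hL0 hprod
  refine le_trans (mul_le_mul_of_nonneg_left hpw (by positivity)) (le_of_eq ?_)
  have e1 : t * α + (1 - t) * β = t * α * (1 + μ₁ s) := by rw [hm1]; field_simp
  have e2 : t + (1 - t) * (a / b) = t * (1 + μₙ s) := by rw [hmn]; field_simp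
  rw [e1, e2, mul_pow, mul_pow, hαk]
  ring

end slices

lemma exists_T (μ ν : Measure ℝ) [IsProbabilityMeasure μ] [IsProbabilityMeasure ν] [NullSingletonClass μ]
    (m M : ℝ) (hm : ν (Iio m) = 0) (hM : ν (Iic M) = 1) :
    ∃ T : ℝ → ℝ, Monotone T ∧ μ.map T = ν := by
  set FA := ProbabilityTheory.cdf μ with hFA
  set FB := ProbabilityTheory.cdf ν with hFB
  have hFBM : FB M = 1 := by
    rw [hFB, ProbabilityTheory.cdf_eq_real, Measure.real, hM]; simp
  set S : ℝ → Set ℝ := fun x => {y | m ≤ y ∧ FA x ≤ FB y} with hS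
  have hmM : m ≤ M := by
    by_contra h
    push Not at h
    have : ν (Iic M) ≤ ν (Iio m) := measure_mono fun z hz => lt_of_le_of_lt hz h
    rw [hM, hm] at this
    simp at this
  have hMS : ∀ x, M ∈ S x := fun x => ⟨hmM, by rw [hFBM]; exact ProbabilityTheory.cdf_le_one μ x⟩
  have hbdd : ∀ x, BddBelow (S x) := fun x => ⟨m, fun y hy => hy.1⟩
  set T : ℝ → ℝ := fun x => sInf (S x) with hT
  have hTS : ∀ x, T x ∈ S x := by
    intro x
    refine ⟨le_csInf ⟨M, hMS x⟩ fun y hy => hy.1, ?_⟩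
    have hlim : Filter.Tendsto FB (nhdsWithin (T x) (Ioi (T x))) (nhds (FB (T x))) :=
      ((FB.right_continuous (T x)).mono_left (nhdsWithin_mono _ Ioi_subset_Ici_self))
    refine ge_of_tendsto hlim ?_
    filter_upwards [self_mem_nhdsWithin] with y hy
    obtain ⟨z, hz, hzy⟩ := exists_lt_of_csInf_lt ⟨M, hMS x⟩ hy
    exact hz.2.trans (FB.mono hzy.le)
  have hTmono : Monotone T := by
    intro x x' hxx
    refine csInf_le (hbdd x) ⟨(hTS x').1, (FA.mono hxx).trans (hTS x').2⟩
  refine ⟨T, hTmono, ?_⟩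
  have : IsFiniteMeasure (μ.map T) := inferInstance
  refine Measure.ext_of_Iic _ _ fun y => ?_
  rw [Measure.map_apply hTmono.measurable measurableSet_Iic]
  by_cases hy : y < m
  · have h1 : ν (Iic y) = 0 := measure_mono_null (fun z hz => lt_of_le_of_lt hz hy) hm
    have h2 : T ⁻¹' Iic y = ∅ := by
      ext x
      simp only [mem_preimage, mem_Iic, mem_empty_iff_false, iff_false, not_le]
      exact lt_of_lt_of_le hy (hTS x).1
    rw [h1, h2, measure_empty]
  push Not at hy
  have hpre : T ⁻¹' Iic y = {x | FA x ≤ FB y} := by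
    ext x
    constructor
    · intro hx
      exact (hTS x).2.trans (FB.mono hx)
    · intro hx
      exact csInf_le (hbdd x) ⟨hy, hx⟩
  rw [hpre, ← ProbabilityTheory.ofReal_cdf ν y, ← hFB]
  set c := FB y with hc
  have hc0 : 0 ≤ c := ProbabilityTheory.cdf_nonneg ν y
  have hc1 : c ≤ 1 := ProbabilityTheory.cdf_le_one ν y
  rcases hc1.eq_or_lt with h1 | h1
  · have : {x | FA x ≤ c} = univ := by
      ext x; simp only [mem_ofPred_eq, mem_univ, iff_true]
      rw [h1]; exact ProbabilityTheory.cdf_le_one μ x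
    rw [this, h1]; simp
  by_cases hne : ({x | FA x ≤ c}).Nonempty
  swap
  · have hc00 : c ≤ 0 := by
      by_contra hcc
      push Not at hcc
      have := (ProbabilityTheory.tendsto_cdf_atBot μ).eventually (eventually_lt_nhds hcc)
      obtain ⟨x, hx⟩ := this.exists
      exact hne ⟨x, le_of_lt hx⟩
    rw [not_nonempty_iff_eq_empty.1 hne, measure_empty, ENNReal.ofReal_of_nonpos hc00]
  have hba : BddAbove {x | FA x ≤ c} := by
    have := (ProbabilityTheory.tendsto_cdf_atTop μ).eventually (eventually_gt_nhds h1)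
    obtain ⟨x, hx⟩ := this.exists
    refine ⟨x, fun z hz => ?_⟩
    by_contra hzx
    push Not at hzx
    have := FA.mono hzx.le
    exact absurd (this.trans hz) (not_le.2 hx)
  set x1 := sSup {x | FA x ≤ c} with hx1
  have hIio : Iio x1 ⊆ {x | FA x ≤ c} := by
    intro z hz
    obtain ⟨w, hw, hzw⟩ := exists_lt_of_lt_csSup hne hz
    exact (FA.mono hzw.le).trans hw
  have hIic : {x | FA x ≤ c} ⊆ Iic x1 := fun z hz => le_csSup hba hz
  have hmeas : μ {x | FA x ≤ c} = μ (Iic x1) := by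
    refine le_antisymm (measure_mono hIic) ?_
    rw [← measure_congr (Iio_ae_eq_Iic (a := x1) (μ := μ))]
    exact measure_mono hIio
  rw [hmeas, ← ProbabilityTheory.ofReal_cdf μ x1, ← hFA]
  congr 1
  apply le_antisymm
  · -- left limits
    have h2 : ENNReal.ofReal (FA x1) ≤ ENNReal.ofReal c := by
      rw [hFA, ProbabilityTheory.ofReal_cdf, ← measure_congr (Iio_ae_eq_Iic (a := x1) (μ := μ))]
      have hU : Iio x1 = ⋃ w : {w : ℚ // (w : ℝ) < x1}, Iic ((w : ℚ) : ℝ) := by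
        ext z
        simp only [mem_Iio, mem_iUnion, mem_Iic, Subtype.exists, exists_prop]
        constructor
        · intro hz
          obtain ⟨q, hq1, hq2⟩ := exists_rat_btwn hz
          exact ⟨q, hq2, hq1.le⟩
        · rintro ⟨q, hq, hzq⟩
          exact lt_of_le_of_lt hzq hq
      rw [hU, Directed.measure_iUnion]
      · refine iSup_le fun w => ?_
        rw [← ProbabilityTheory.ofReal_cdf]
        exact ENNReal.ofReal_le_ofReal (hIio w.2)
      · refine Monotone.directed_le ?_
        intro w w' hww
        exact Iic_subset_Iic.2 (by exact_mod_cast hww)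
    exact (ENNReal.ofReal_le_ofReal_iff hc0).1 h2
  · have hlim : Filter.Tendsto FA (nhdsWithin x1 (Ioi x1)) (nhds (FA x1)) :=
      ((FA.right_continuous x1).mono_left (nhdsWithin_mono _ Ioi_subset_Ici_self))
    refine ge_of_tendsto hlim ?_
    filter_upwards [self_mem_nhdsWithin] with z hz
    by_contra hcon
    push Not at hcon
    have hz1 : z ≤ x1 := hIic (show FA z ≤ c from hcon.le)
    exact absurd hz1 (not_le.2 hz)

lemma bm_real : BMprop ℝ 1 := by
  intro A B t hA hB hA0 hB0 ht
  obtain ⟨ht0, ht1⟩ := ht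
  have ht1' : 0 < 1 - t := by linarith
  have h1d : ∀ A B : Set ℝ, IsCompact A → IsCompact B → A.Nonempty → B.Nonempty →
      volume A + volume B ≤ volume (A + B) := by
    intro A B hA hB hAn hBn
    obtain ⟨a, ha⟩ := hA.exists_isGreatest hAn
    obtain ⟨b, hb⟩ := hB.exists_isLeast hBn
    have hsub : (fun x => x + b) '' A ∪ (fun x => a + x) '' B ⊆ A + B := by
      rintro _ (⟨x, hx, rfl⟩ | ⟨x, hx, rfl⟩)
      · exact ⟨x, hx, b, hb.1, rfl⟩
      · exact ⟨a, ha.1, x, hx, rfl⟩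
    have hdis : AEDisjoint volume ((fun x => x + b) '' A) ((fun x => a + x) '' B) := by
      refine measure_mono_null (t := {a + b}) ?_ (by simp)
      rintro _ ⟨⟨x, hx, rfl⟩, ⟨y, hy, hxy⟩⟩
      have h1 := ha.2 hx
      have h2 := hb.2 hy
      simp only at hxy
      simp only [mem_singleton_iff]
      linarith
    have hm : MeasurableSet ((fun x => a + x) '' B) :=
      (hB.image (by fun_prop)).measurableSet
    have := measure_union₀ hm.nullMeasurableSet hdis
    refine le_trans (le_of_eq ?_) (this.symm.le.trans (measure_mono hsub))
    simp
  have hAn : A.Nonempty := nonempty_of_measure_ne_zero hA0.ne'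
  have hBn : B.Nonempty := nonempty_of_measure_ne_zero hB0.ne'
  have h := h1d (t • A) ((1 - t) • B) (hA.smul t) (hB.smul _) hAn.smul_set hBn.smul_set
  have hS : IsCompact (t • A + (1 - t) • B) := (hA.smul t).add (hB.smul (1 - t))
  have h2 := ENNReal.toReal_mono hS.measure_lt_top.ne h
  rw [ENNReal.toReal_add (hA.smul t).measure_lt_top.ne (hB.smul _).measure_lt_top.ne,
    Measure.addHaar_smul, Measure.addHaar_smul, ENNReal.toReal_mul, ENNReal.toReal_mul] at h2
  simp only [Module.finrank_self, pow_one,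
    abs_of_pos ht0, abs_of_pos ht1', ENNReal.toReal_ofReal ht0.le,
    ENNReal.toReal_ofReal ht1'.le] at h2
  simpa using h2

lemma bm_transfer {E F : Type} [NormedAddCommGroup E] [NormedSpace ℝ E] [MeasureSpace E]
    [BorelSpace E] [FiniteDimensional ℝ E] [Measure.IsAddHaarMeasure (volume : Measure E)]
    [NormedAddCommGroup F] [NormedSpace ℝ F] [MeasureSpace F]
    [BorelSpace F] [FiniteDimensional ℝ F] [Measure.IsAddHaarMeasure (volume : Measure F)]
    (hd : Module.finrank ℝ E = Module.finrank ℝ F) (k : ℕ) (hk : k ≠ 0) (h : BMprop E k) :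
    BMprop F k := by
  intro A B t hA hB hA0 hB0 ht
  obtain ⟨e⟩ : Nonempty (E ≃L[ℝ] F) := ⟨ContinuousLinearEquiv.ofFinrankEq hd⟩
  have := e.isAddHaarMeasure_map (volume : Measure E)
  have hsecond : SecondCountableTopology F := inferInstance
  have hc := Measure.isAddLeftInvariant_eq_smul (Measure.map e (volume : Measure E))
    (volume : Measure F)
  set c := (Measure.map e (volume : Measure E)).addHaarScalarFactor (volume : Measure F) with hcdef
  have hcpos : 0 < c := Measure.addHaarScalarFactor_pos_of_isAddHaarMeasure _ _
  have hvol : ∀ K : Set F, IsCompact K → volume (e.symm '' K) = (c : ℝ≥0∞) * volume K := by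
    intro K hK
    have h1 : Measure.map e volume K = volume (e.symm '' K) := by
      rw [Measure.map_apply e.continuous.measurable hK.measurableSet]
      congr 1
      exact (e.image_symm_eq_preimage K).symm
    rw [← h1, hc]
    rfl
  have hS : IsCompact (t • A + (1 - t) • B) := (hA.smul t).add (hB.smul (1 - t))
  have hc0 : (c : ℝ≥0∞) ≠ 0 := by exact_mod_cast hcpos.ne'
  have himg : t • (e.symm '' A) + (1 - t) • (e.symm '' B) = e.symm '' (t • A + (1 - t) • B) := by
    rw [image_add, image_smul_set, image_smul_set]
  have hb := h (e.symm '' A) (e.symm '' B) t (hA.image e.symm.continuous)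
    (hB.image e.symm.continuous)
    (by rw [hvol A hA]; exact ENNReal.mul_pos hc0 hA0.ne')
    (by rw [hvol B hB]; exact ENNReal.mul_pos hc0 hB0.ne') ht
  rw [himg, hvol A hA, hvol B hB, hvol _ hS] at hb
  simp only [ENNReal.toReal_mul, ENNReal.coe_toReal] at hb
  have hcr : (0 : ℝ) < c := by exact_mod_cast hcpos
  rw [Real.mul_rpow hcr.le ENNReal.toReal_nonneg, Real.mul_rpow hcr.le ENNReal.toReal_nonneg] at hb
  have hck : ((c : ℝ) ^ (1 / (k : ℝ))) ^ k = c := by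
    rw [one_div]; exact Real.rpow_inv_natCast_pow hcr.le hk
  refine le_of_mul_le_mul_left ?_ hcr
  refine le_trans (le_of_eq ?_) hb
  nth_rewrite 1 [← hck]
  rw [← mul_pow]
  ring

lemma base_term {VA VB t : ℝ} (hVA : 0 < VA) (hVB : 0 < VB) (ht : 0 < t) (k : ℕ) :
    t ^ (k + 1) * VA * (1 + (1 - t) / t * (VB / VA) ^ (1 / ((k : ℝ) + 1))) ^ (k + 1)
      = (t * VA ^ (1 / ((k : ℝ) + 1)) + (1 - t) * VB ^ (1 / ((k : ℝ) + 1))) ^ (k + 1) := by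
  have h1 : VA = (VA ^ (1 / ((k : ℝ) + 1))) ^ (k + 1) := by
    have := Real.rpow_inv_natCast_pow (x := VA) (n := k + 1) hVA.le (by omega)
    push_cast at this
    rw [one_div, this]
  rw [Real.div_rpow hVB.le hVA.le]
  nth_rewrite 1 [h1]
  rw [← mul_pow, ← mul_pow]
  have : 0 < VA ^ (1 / ((k : ℝ) + 1)) := by positivity
  congr 1
  field_simp

lemma sum_le_vol {k : ℕ} {A : Set (EuclideanSpace ℝ (Fin k) × ℝ)} (hA : IsCompact A)
    (hA0 : 0 < volume A) {S : Set (EuclideanSpace ℝ (Fin k) × ℝ)} (hS : IsCompact S)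
    {C D : ℝ} (hC : 0 ≤ C) (hD : 0 ≤ D) (G : ℝ → ℝ) (hG : ∀ s, 0 ≤ G s)
    (h : ∫⁻ s, ENNReal.ofReal (C * (sdens A s).toReal * (D + 1 / 4 * G s)) ≤ volume S) :
    1 / 4 * C * ∫ s, G s * (sdens A s).toReal ≤ (volume S).toReal - C * D := by
  have h1 : ∀ s, ENNReal.ofReal (C * (sdens A s).toReal * (D + 1 / 4 * G s))
      = ENNReal.ofReal (C * D) * sdens A s +
        ENNReal.ofReal (1 / 4 * C) * ENNReal.ofReal (G s * (sdens A s).toReal) := by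
    intro s
    have hG := hG s
    have e : C * (sdens A s).toReal * (D + 1 / 4 * G s)
      = C * D * (sdens A s).toReal + 1 / 4 * C * (G s * (sdens A s).toReal) := by ring
    have hr : 0 ≤ (sdens A s).toReal := ENNReal.toReal_nonneg
    rw [e, ENNReal.ofReal_add (by positivity) (by positivity),
      ENNReal.ofReal_mul (p := C * D) (by positivity),
      ENNReal.ofReal_mul (p := 1 / 4 * C) (by positivity),
      ENNReal.ofReal_toReal (sdens_ne_top hA hA0 s)]
  simp_rw [h1] at h
  rw [lintegral_add_left ((meas_sdens hA).const_mul _), lintegral_const_mul _ (meas_sdens hA),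
    lintegral_sdens hA hA0, mul_one, lintegral_const_mul' _ _ ENNReal.ofReal_ne_top] at h
  set I := ∫⁻ s, ENNReal.ofReal (G s * (sdens A s).toReal) with hI
  have hfin : volume S ≠ ∞ := hS.measure_lt_top.ne
  have h2 : ENNReal.ofReal (1 / 4 * C) * I ≠ ∞ :=
    ne_top_of_le_ne_top hfin (le_trans le_add_self h)
  have h3 := ENNReal.toReal_mono hfin h
  rw [ENNReal.toReal_add ENNReal.ofReal_ne_top h2, ENNReal.toReal_mul,
    ENNReal.toReal_ofReal (by positivity), ENNReal.toReal_ofReal (by positivity)] at h3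
  have h4 : ∫ s, G s * (sdens A s).toReal ≤ I.toReal := by
    have := norm_integral_le_lintegral_norm (μ := volume) (fun s => G s * (sdens A s).toReal)
    refine (le_abs_self _).trans (this.trans (le_of_eq ?_))
    rw [hI]
    congr 1
    refine lintegral_congr fun s => ?_
    rw [Real.norm_of_nonneg (mul_nonneg (hG s) ENNReal.toReal_nonneg)]
  have h5 := mul_le_mul_of_nonneg_left h4 (show 0 ≤ 1 / 4 * C by positivity)
  linarith

lemma main_ineq {k : ℕ} (hk : 1 ≤ k) (hBM : BMprop (EuclideanSpace ℝ (Fin k)) k)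
    {A B : Set (EuclideanSpace ℝ (Fin k) × ℝ)} {t : ℝ} (hA : IsCompact A) (hB : IsCompact B)
    (hA0 : 0 < volume A) (hB0 : 0 < volume B) (ht : t ∈ Set.Ioo (0 : ℝ) 1)
    {T : ℝ → ℝ} (hT : Monotone T)
    (hmap : (volume.withDensity (sdens A)).map T = volume.withDensity (sdens B))
    (μ₁ μₙ : ℝ → ℝ) (L : ℝ)
    (hμ₁ : μ₁ = (fun s => (1 - t) / t *
          (((volume B).toReal * (sdens B (T s)).toReal) ^ (1 / (k : ℝ)) /
            ((volume A).toReal * (sdens A s).toReal) ^ (1 / (k : ℝ)))))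
    (hμₙ : μₙ = (fun s => (1 - t) / t * ((sdens A s).toReal / (sdens B (T s)).toReal)))
    (hL : L = (1 - t) / t * ((volume B).toReal / (volume A).toReal) ^ (1 / ((k : ℝ) + 1))) :
    (∀ s, 0 ≤ 1 / max (μ₁ s) (μₙ s) * (k * (μ₁ s - L) ^ 2 + (μₙ s - L) ^ 2)) ∧
    1 / 4 * (t ^ (k + 1) * (volume A).toReal) * (∫ s, (1 / max (μ₁ s) (μₙ s) *
        (k * (μ₁ s - L) ^ 2 + (μₙ s - L) ^ 2)) * (sdens A s).toReal)
      ≤ (volume (t • A + (1 - t) • B)).toReal -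
        (t * (volume A).toReal ^ (1 / ((k : ℝ) + 1)) +
          (1 - t) * (volume B).toReal ^ (1 / ((k : ℝ) + 1))) ^ (k + 1) := by
  have hkey := key_lintegral hk hBM hA hB hA0 hB0 ht hT hmap μ₁ μₙ L hμ₁ hμₙ hL
  obtain ⟨ht0, ht1⟩ := ht
  have ht1' : 0 < 1 - t := by linarith
  have hVA0 : 0 < (volume A).toReal := ENNReal.toReal_pos hA0.ne' hA.measure_lt_top.ne
  have hVB0 : 0 < (volume B).toReal := ENNReal.toReal_pos hB0.ne' hB.measure_lt_top.ne
  have hL0 : 0 < L := by rw [hL]; positivity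
  have hG : ∀ s, 0 ≤ 1 / max (μ₁ s) (μₙ s) * (k * (μ₁ s - L) ^ 2 + (μₙ s - L) ^ 2) := by
    intro s
    have : 0 ≤ max (μ₁ s) (μₙ s) := by
      refine le_max_of_le_right ?_
      rw [hμₙ]
      positivity
    positivity
  refine ⟨hG, ?_⟩
  have hS : IsCompact (t • A + (1 - t) • B) := (hA.smul t).add (hB.smul (1 - t))
  have := sum_le_vol hA hA0 hS (by positivity) (by positivity) _ hG hkey
  rw [hL, base_term hVA0 hVB0 ht0 k, ← hL] at this
  exact this

lemma bm_step {k : ℕ} (hk : 1 ≤ k) (hBM : BMprop (EuclideanSpace ℝ (Fin k)) k) :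
    BMprop (EuclideanSpace ℝ (Fin k) × ℝ) (k + 1) := by
  intro A B t hA hB hA0 hB0 ht
  have := prob_sdens hA hA0
  have := prob_sdens hB hB0
  have hNA : NullSingletonClass (volume.withDensity (sdens A)) :=
    ⟨fun x => withDensity_absolutelyContinuous _ _ (by simp)⟩
  have hBn : B.Nonempty := nonempty_of_measure_ne_zero hB0.ne'
  have hBc : IsCompact (Prod.snd '' B) := hB.image continuous_snd
  obtain ⟨m, hm⟩ := hBc.bddBelow
  obtain ⟨M, hM⟩ := hBc.bddAbove
  have hzero : ∀ U : Set ℝ, MeasurableSet U → (∀ s ∈ U, s ∉ Prod.snd '' B) →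
      volume.withDensity (sdens B) U = 0 := by
    intro U hU hUB
    rw [withDensity_apply _ hU]
    rw [setLIntegral_congr_fun (g := fun _ => 0) hU]
    · simp
    · intro s hs
      have : vslice B s = ∅ := by
        ext y
        simp only [vslice, mem_ofPred_eq, mem_empty_iff_false, iff_false]
        intro hy
        exact hUB s hs ⟨(y, s), hy, rfl⟩
      simp [sdens, this]
  obtain ⟨T, hT, hmap⟩ := exists_T (volume.withDensity (sdens A)) (volume.withDensity (sdens B)) m M
    (hzero _ measurableSet_Iio fun s hs hsB => absurd (hm hsB) (not_le.2 hs))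
    (by
      rw [← prob_compl_eq_zero_iff measurableSet_Iic, compl_Iic]
      exact hzero _ measurableSet_Ioi fun s hs hsB => absurd (hM hsB) (not_le.2 hs))
  obtain ⟨hG, hmain⟩ := main_ineq hk hBM hA hB hA0 hB0 ht hT hmap _ _ _ rfl rfl rfl
  have ht0 := ht.1
  refine (fun h1 => ?_) (le_trans (mul_nonneg (by positivity) (integral_nonneg fun s => ?_)) hmain)
  · push_cast
    linarith
  · exact mul_nonneg (hG s) ENNReal.toReal_nonneg

lemma bm_all (k : ℕ) (hk : 1 ≤ k) : BMprop (EuclideanSpace ℝ (Fin k)) k := by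
  induction k, hk using Nat.le_induction with
  | base => exact bm_transfer (by simp) 1 one_ne_zero bm_real
  | succ k hk ih =>
    have : Measure.IsAddHaarMeasure (volume : Measure (EuclideanSpace ℝ (Fin k) × ℝ)) := by
      rw [Measure.volume_eq_prod]
      infer_instance
    exact bm_transfer (by simp) (k + 1) (Nat.succ_ne_zero k) (bm_step hk ih)

lemma final_aux (k : ℕ) (hk : 1 ≤ k) (A B : Set (EuclideanSpace ℝ (Fin k) × ℝ)) (t : ℝ)
    (ρA ρB : ℝ → ℝ) (T : ℝ → ℝ) (μ₁ μₙ : ℝ → ℝ)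
    (hA : IsCompact A) (hB : IsCompact B) (hA0 : 0 < volume A) (hB0 : 0 < volume B)
    (ht : t ∈ Set.Ioo (0 : ℝ) 1)
    (hρA : ρA = (fun s => (volume (vslice A s)).toReal / (volume A).toReal))
    (hρB : ρB = (fun s => (volume (vslice B s)).toReal / (volume B).toReal))
    (hT : Monotone T)
    (hmap : ∀ E : Set ℝ, MeasurableSet E → (∫ s in E, ρB s) = ∫ s in T ⁻¹' E, ρA s)
    (hμ₁ : μ₁ = (fun s => (1 - t) / t *
          (((volume B).toReal * ρB (T s)) ^ (1 / (((k + 1 : ℕ) : ℝ) - 1)) /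
            ((volume A).toReal * ρA s) ^ (1 / (((k + 1 : ℕ) : ℝ) - 1)))))
    (hμₙ : μₙ = (fun s => (1 - t) / t * (ρA s / ρB (T s)))) :
    1 / 4 * (volume A).toReal * t ^ (k + 1) *
            (∫ s : ℝ, (1 / max (μ₁ s) (μₙ s)) *
              ((((k + 1 : ℕ) : ℝ) - 1) *
                  (μ₁ s - (1 - t) / t * ((volume B).toReal / (volume A).toReal) ^ (1 / ((k + 1 : ℕ) : ℝ))) ^ 2 +
                (μₙ s - (1 - t) / t * ((volume B).toReal / (volume A).toReal) ^ (1 / ((k + 1 : ℕ) : ℝ))) ^ 2) *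
              ρA s) ≤
          (volume (t • A + (1 - t) • B)).toReal -
            (t * (volume A).toReal ^ (1 / ((k + 1 : ℕ) : ℝ)) +
              (1 - t) * (volume B).toReal ^ (1 / ((k + 1 : ℕ) : ℝ))) ^ (k + 1) := by
  have hρA' : ρA = fun s => (sdens A s).toReal := by
    rw [hρA]; funext s; rw [sdens, ENNReal.toReal_div]
  have hρB' : ρB = fun s => (sdens B s).toReal := by
    rw [hρB]; funext s; rw [sdens, ENNReal.toReal_div]
  clear hρA hρB
  subst hρA' hρB'
  have pA := prob_sdens hA hA0
  have pB := prob_sdens hB hB0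
  have hint : ∀ (D : Set (EuclideanSpace ℝ (Fin k) × ℝ)) (_ : IsCompact D) (_ : 0 < volume D)
      (E : Set ℝ), MeasurableSet E →
      (∫ s in E, (sdens D s).toReal) = (volume.withDensity (sdens D) E).toReal := by
    intro D hD hD0 E hE
    rw [withDensity_apply _ hE, integral_toReal]
    · exact (meas_sdens hD).aemeasurable
    · exact ae_of_all _ fun s => lt_top_iff_ne_top.2 (sdens_ne_top hD hD0 s)
  have hmap' : (volume.withDensity (sdens A)).map T = volume.withDensity (sdens B) := by
    ext E hE
    rw [Measure.map_apply hT.measurable hE]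
    have h1 := hmap E hE
    rw [hint B hB hB0 E hE, hint A hA hA0 _ (hT.measurable hE)] at h1
    exact ((ENNReal.toReal_eq_toReal_iff' (measure_ne_top _ _) (measure_ne_top _ _)).1 h1).symm
  push_cast at *
  simp only [add_sub_cancel_right] at *
  have := (main_ineq hk (bm_all k hk) hA hB hA0 hB0 ht hT hmap' μ₁ μₙ _ hμ₁ hμₙ rfl).2
  refine le_trans (le_of_eq ?_) this
  ring

/-- quantitative inductive Brunn–Minkowski, inequality
\eqref{eq:stability T}: with `μ₁ = ⋯ = μ_{n-1}` and `μ_n` as defined from the slice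
densities and the monotone rearrangement `T`, one has
`|S| - (t|A|^{1/n} + (1-t)|B|^{1/n})ⁿ ≥ c(n) |A| tⁿ ∫ (1/max_i μ_i) Σ_j (μ_j - ((1-t)/t)(|B|/|A|)^{1/n})² ρ_A ds`. -/
theorem statement11 (n : ℕ) (hn : 2 ≤ n) :
    ∃ c : ℝ, 0 < c ∧
      ∀ (A B : Set (EuclideanSpace ℝ (Fin (n - 1)) × ℝ)) (t : ℝ)
        (ρA ρB : ℝ → ℝ) (T : ℝ → ℝ) (μ₁ μₙ : ℝ → ℝ),
        IsCompact A → IsCompact B →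
        0 < volume A → 0 < volume B →
        t ∈ Set.Ioo (0 : ℝ) 1 →
        ρA = (fun s => (volume (vslice A s)).toReal / (volume A).toReal) →
        ρB = (fun s => (volume (vslice B s)).toReal / (volume B).toReal) →
        Monotone T →
        (∀ E : Set ℝ, MeasurableSet E →
          (∫ s in E, ρB s) = ∫ s in T ⁻¹' E, ρA s) →
        μ₁ = (fun s => (1 - t) / t *
          (((volume B).toReal * ρB (T s)) ^ (1 / ((n : ℝ) - 1)) /
            ((volume A).toReal * ρA s) ^ (1 / ((n : ℝ) - 1)))) →
        μₙ = (fun s => (1 - t) / t * (ρA s / ρB (T s))) →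
        c * (volume A).toReal * t ^ n *
            (∫ s : ℝ, (1 / max (μ₁ s) (μₙ s)) *
              (((n : ℝ) - 1) *
                  (μ₁ s - (1 - t) / t * ((volume B).toReal / (volume A).toReal) ^ (1 / (n : ℝ))) ^ 2 +
                (μₙ s - (1 - t) / t * ((volume B).toReal / (volume A).toReal) ^ (1 / (n : ℝ))) ^ 2) *
              ρA s) ≤
          (volume (t • A + (1 - t) • B)).toReal -
            (t * (volume A).toReal ^ (1 / (n : ℝ)) +
              (1 - t) * (volume B).toReal ^ (1 / (n : ℝ))) ^ n := by
  obtain ⟨k, rfl⟩ : ∃ k, n = k + 1 := ⟨n - 1, by omega⟩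
  refine ⟨1 / 4, by norm_num, ?_⟩
  intro A B t ρA ρB T μ₁ μₙ hA hB hA0 hB0 ht hρA hρB hT hmap hμ₁ hμₙ
  exact final_aux k (by omega) A B t ρA ρB T μ₁ μₙ hA hB hA0 hB0 ht hρA hρB hT hmap hμ₁ hμₙ
end
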